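/- Let n ≥ 1 and let f = e^ψ be a continuous radial density on ℝ^{n+1} (i.e. f(x) depends only on |x|) which is nondecreasing in |x| and satisfies f(x) → +∞ as |x| → +∞. Suppose there exist constants C > 0 and ε ∈ (0,1) such that ψ(x) ≤ C·((n+1)/n − ε)^{|x|/2} for all x ∈ ℝ^{n+1}. Then for every V > 0 there exists a bounded open set Ω ⊆ ℝ^{n+1} which is an isoperimetric region of volume V; moreover, every isoperimetric region of volume V is a bounded subset of ℝ^{n+1}. -/

import Mathlib

open Filter MeasureTheory Set

/-- Weighted volume of a set `Ω ⊆ ℝ^{n+1}` with respect to the density `f`. -/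
noncomputable def wvol {n : ℕ} (f : EuclideanSpace ℝ (Fin (n + 1)) → ℝ)
    (Ω : Set (EuclideanSpace ℝ (Fin (n + 1)))) : ENNReal :=
  ∫⁻ x in Ω, ENNReal.ofReal (f x)

/-- Weighted perimeter of a set `Ω ⊆ ℝ^{n+1}` with respect to the density `f`:
the integral of `f` over the topological boundary of `Ω` with respect to the
`n`-dimensional Hausdorff measure. -/
noncomputable def wper {n : ℕ} (f : EuclideanSpace ℝ (Fin (n + 1)) → ℝ)
    (Ω : Set (EuclideanSpace ℝ (Fin (n + 1)))) : ENNReal :=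
  ∫⁻ x in frontier Ω, ENNReal.ofReal (f x) ∂(μH[n])

/-- `Ω` is an isoperimetric region (minimizer) of weighted volume `V`. -/
def IsIsopRegion {n : ℕ} (f : EuclideanSpace ℝ (Fin (n + 1)) → ℝ)
    (Ω : Set (EuclideanSpace ℝ (Fin (n + 1)))) (V : ENNReal) : Prop :=
  IsOpen Ω ∧ wvol f Ω = V ∧
    ∀ U : Set (EuclideanSpace ℝ (Fin (n + 1))), IsOpen U → wvol f U = V →
      wper f Ω ≤ wper f U

section
open Topology Metric
open ENNReal (ofReal)
open scoped ENNReal NNReal Measure Real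

abbrev EE (n : ℕ) := EuclideanSpace ℝ (Fin (n + 1))

variable {n : ℕ} {f : EE n → ℝ}
local notation "Hm" => μH[n]
local notation "EN" => ENNReal

theorem haus_cover {Y : Type*} [EMetricSpace Y] [MeasurableSpace Y] [BorelSpace Y] (d : ℝ)
    (A : Set Y) (hA : μH[d] A ≠ ⊤) (δ : EN) (hδ : 0 < δ) (ε : EN) (hε : ε ≠ 0) :
    ∃ t : ℕ → Set Y, A ⊆ ⋃ i, t i ∧ (∀ i, ediam (t i) ≤ δ) ∧
      ∑' i, (⨆ _ : (t i).Nonempty, ediam (t i) ^ d) ≤ μH[d] A + ε := by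
  have h1 : ⨅ (t : ℕ → Set Y) (_ : A ⊆ ⋃ n, t n) (_ : ∀ n, ediam (t n) ≤ δ),
          ∑' n, (⨆ _ : (t n).Nonempty, ediam (t n) ^ d) < μH[d] A + ε := by
    refine lt_of_le_of_lt ?_ (ENNReal.lt_add_right hA hε)
    conv_rhs => rw [Measure.hausdorffMeasure_apply]
    exact le_iSup₂_of_le δ hδ le_rfl
  simp only [iInf_lt_iff] at h1
  obtain ⟨t, h2, h3, h4⟩ := h1
  exact ⟨t, h2, h3, h4.le⟩

theorem vol_eq_haus (n : ℕ) : ∃ c : ℝ≥0, 0 < c ∧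
    (μH[(n + 1 : ℕ)] : Measure (EE n)) = (c : EN) • (volume : Measure (EE n)) := by
  have h : (μH[(n + 1 : ℕ)] : Measure (EE n)) = μH[(Module.finrank ℝ (EE n) : ℕ)] := by simp
  have : Measure.IsAddHaarMeasure (μH[(n + 1 : ℕ)] : Measure (EE n)) := by
    rw [h]; infer_instance
  refine ⟨Measure.addHaarScalarFactor (μH[(n + 1 : ℕ)] : Measure (EE n)) volume,
    Measure.addHaarScalarFactor_pos_of_isAddHaarMeasure _ _, ?_⟩
  exact Measure.isAddLeftInvariant_eq_smul _ _

theorem vol_null_of_haus (n : ℕ) (A : Set (EE n)) (hA : μH[n] A ≠ ⊤) : volume A = 0 := by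
  obtain ⟨c, hc, h⟩ := vol_eq_haus n
  have h1 : μH[(n + 1 : ℕ)] A = 0 := by
    rcases Measure.hausdorffMeasure_zero_or_top (d₁ := n) (d₂ := (n + 1 : ℕ)) (by simp) A with h | h
    · exact h
    · exact absurd h hA
  rw [h] at h1
  simpa [hc.ne'] using h1

def sw (h : EE n) (A : Set (EE n)) : Set (EE n) :=
  {y | ∃ p ∈ A, ∃ s ∈ Icc (0 : ℝ) 1, y = p + s • h}

theorem sw_ball (n : ℕ) : ∃ C : ℝ≥0, ∀ (h a : EE n) (r : ℝ), 0 < r → r ≤ 2 * ‖h‖ →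
    volume (sw h (closedBall a r)) ≤ C * ofReal ‖h‖ * ofReal r ^ n := by
  set b := (volume (ball (0 : EE n) 1)).toNNReal with hb
  have hbt : (b : EN) = volume (ball (0 : EE n) 1) :=
    ENNReal.coe_toNNReal measure_ball_lt_top.ne
  refine ⟨5 * 2 ^ (n + 1) * b, fun h a r hr hrh => ?_⟩
  set K := ⌈‖h‖ / r⌉₊ with hK
  have hhpos : 0 < ‖h‖ := by linarith
  have hKpos : 0 < K := Nat.ceil_pos.2 (by positivity)
  have hKr : (0:ℝ) < K := by exact_mod_cast hKpos
  have hK1 : ‖h‖ / r ≤ K := Nat.le_ceil _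
  have hK2 : (K : ℝ) < ‖h‖ / r + 1 := Nat.ceil_lt_add_one (by positivity)
  have hsub : sw h (closedBall a r) ⊆
      ⋃ k ∈ Finset.range (K + 1), closedBall (a + ((k : ℝ) / K) • h) (2 * r) := by
    rintro y ⟨p, hp, s, hs, rfl⟩
    simp only [mem_iUnion]
    refine ⟨⌊s * K⌋₊, ?_, ?_⟩
    · rw [Finset.mem_range]
      have : ⌊s * K⌋₊ ≤ K := by
        apply Nat.floor_le_of_le
        nlinarith [hs.2]
      omega
    · rw [mem_closedBall, dist_eq_norm]
      have e : p + s • h - (a + ((⌊s * K⌋₊ : ℝ) / K) • h) =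
          (p - a) + (s - (⌊s * K⌋₊ : ℝ) / K) • h := by
        rw [sub_smul]; abel
      rw [e]
      have h1 : ‖p - a‖ ≤ r := by simpa [dist_eq_norm] using hp
      have f1 : (⌊s * K⌋₊ : ℝ) ≤ s * K := Nat.floor_le (by have := hs.1; positivity)
      have f2 : s * K < ⌊s * K⌋₊ + 1 := Nat.lt_floor_add_one _
      have h2 : |s - (⌊s * K⌋₊ : ℝ) / K| ≤ 1 / K := by
        have e2 : s - (⌊s * K⌋₊ : ℝ) / K = (s * K - ⌊s * K⌋₊) / K := by field_simp
        rw [e2, abs_of_nonneg (by apply div_nonneg <;> linarith)]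
        gcongr; linarith
      have h3 : ‖(s - (⌊s * K⌋₊ : ℝ) / K) • h‖ ≤ r := by
        rw [norm_smul, Real.norm_eq_abs]
        calc _ ≤ 1 / K * ‖h‖ := by gcongr
          _ ≤ r := by
            rw [div_le_iff₀ hr] at hK1
            rw [one_div, inv_mul_le_iff₀ hKr]; linarith
      linarith [norm_add_le (p - a) ((s - (⌊s * K⌋₊ : ℝ) / K) • h)]
  have hvol : ∀ k ∈ Finset.range (K + 1), volume (closedBall (a + ((k : ℝ) / K) • h) (2 * r)) ≤
      ofReal ((2 * r) ^ (n + 1)) * b := by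
    intro k _
    rw [Measure.addHaar_closedBall _ _ (by positivity), hbt]
    simp
  calc volume (sw h (closedBall a r)) ≤ _ := measure_mono hsub
    _ ≤ ∑ k ∈ Finset.range (K + 1), volume (closedBall (a + ((k : ℝ) / K) • h) (2 * r)) :=
      measure_biUnion_finset_le _ _
    _ ≤ ∑ k ∈ Finset.range (K + 1), ofReal ((2 * r) ^ (n + 1)) * b :=
      Finset.sum_le_sum hvol
    _ = ofReal ((K + 1) * (2 * r) ^ (n + 1)) * b := by
      rw [Finset.sum_const, Finset.card_range, nsmul_eq_mul, ← mul_assoc,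
        ENNReal.ofReal_mul (by positivity)]
      congr 2
      rw [← Nat.cast_succ, ENNReal.ofReal_natCast]
    _ ≤ ofReal (5 * 2 ^ (n + 1) * ‖h‖ * r ^ n) * b := by
      refine mul_le_mul' (ENNReal.ofReal_le_ofReal ?_) le_rfl
      have : (K : ℝ) + 1 ≤ 5 * ‖h‖ / r := by
        have : (2:ℝ) ≤ 4 * ‖h‖ / r := by rw [le_div_iff₀ hr]; linarith
        have e : 5 * ‖h‖ / r = 4 * ‖h‖ / r + ‖h‖ / r := by ring
        linarith
      calc ((K : ℝ) + 1) * (2 * r) ^ (n + 1) ≤ (5 * ‖h‖ / r) * (2 * r) ^ (n + 1) := by gcongr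
        _ = _ := by rw [mul_pow, pow_succ r]; field_simp
    _ = _ := by
      rw [ENNReal.ofReal_mul (by positivity), ENNReal.ofReal_mul (by positivity),
        ENNReal.ofReal_pow hr.le]
      have : ofReal (5 * 2 ^ (n + 1)) = ((5 * 2 ^ (n + 1) : ℝ≥0) : EN) := by
        rw [ofReal]; congr 1
        apply NNReal.coe_injective
        rw [Real.coe_toNNReal _ (by positivity)]
        push_cast; rfl
      rw [this]; push_cast; ring

theorem sw_vol (n : ℕ) : ∃ C : ℝ≥0, ∀ (h : EE n) (A : Set (EE n)), h ≠ 0 →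
    volume (sw h A) ≤ C * ofReal ‖h‖ * μH[n] A := by
  obtain ⟨C, hC⟩ := sw_ball n
  refine ⟨C + 1, fun h A hh => ?_⟩
  have hh' : 0 < ‖h‖ := norm_pos_iff.2 hh
  have hC1 : ((C + 1 : ℝ≥0) : EN) * ofReal ‖h‖ ≠ 0 := by simp [hh]
  by_cases hA : μH[n] A = ⊤
  · rw [hA, ENNReal.mul_top hC1]; exact le_top
  suffices H : ∀ ε : ℝ≥0, 0 < ε → volume (sw h A) ≤
      C * ofReal ‖h‖ * (μH[n] A + ε) by
    have : volume (sw h A) ≤ C * ofReal ‖h‖ * μH[n] A := by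
      by_cases hz : C * ofReal ‖h‖ = 0
      · have := H 1 one_pos
        rw [hz] at this ⊢; simpa using this
      apply ENNReal.le_of_forall_pos_le_add
      intro ε hε _
      have hne : (C : EN) * ofReal ‖h‖ ≠ ⊤ := by finiteness
      set D := ((C : EN) * ofReal ‖h‖).toNNReal with hD
      have hDe : (D : EN) = C * ofReal ‖h‖ := ENNReal.coe_toNNReal hne
      have hD0 : 0 < D := by
        rw [pos_iff_ne_zero]; intro h0; rw [h0] at hDe; exact hz (by simpa using hDe.symm)
      have := H (ε / D) (by positivity)
      rw [mul_add, ← hDe] at this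
      rw [← hDe]
      refine this.trans_eq ?_
      rw [← ENNReal.coe_mul, mul_div_cancel₀ _ hD0.ne']
    refine this.trans ?_
    gcongr; simp
  intro ε hε
  have hε' : ((ε / 2 : ℝ≥0) : EN) ≠ 0 := by simpa using hε.ne'
  obtain ⟨t, ht1, ht2, ht3⟩ := haus_cover n A hA (ofReal ‖h‖) (by simpa using hh)
    (ε / 2 : ℝ≥0) hε'
  obtain ⟨e, he, hes⟩ := ENNReal.exists_pos_sum_of_countable hε' ℕ
  have key : ∀ i, volume (sw h (t i)) ≤ C * ofReal ‖h‖ *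
      ((⨆ _ : (t i).Nonempty, ediam (t i) ^ (n:ℝ)) + e i) := by
    intro i
    rcases (t i).eq_empty_or_nonempty with h0 | hne
    · have : sw h (t i) = ∅ := by rw [h0]; ext y; simp [sw]
      rw [this]; simp
    obtain ⟨a, ha⟩ := hne
    rw [ciSup_pos ⟨a, ha⟩, ENNReal.rpow_natCast]
    set d := (ediam (t i)).toReal
    have hfin : ediam (t i) ≠ ⊤ := ne_top_of_le_ne_top ENNReal.ofReal_ne_top (ht2 i)
    have hd : ediam (t i) = ofReal d := (ENNReal.ofReal_toReal hfin).symm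
    have hd0 : 0 ≤ d := ENNReal.toReal_nonneg
    have hdh : d ≤ ‖h‖ := by
      have := ht2 i
      rwa [hd, ENNReal.ofReal_le_ofReal_iff (norm_nonneg _)] at this
    have hcont : ContinuousAt (fun r : ℝ => r ^ n) d := by fun_prop
    obtain ⟨τ, hτ, hτ'⟩ := Metric.continuousAt_iff.1 hcont (e i) (he i)
    set σ := min (τ / 2) ‖h‖
    have hσ : 0 < σ := lt_min (by linarith) hh'
    have hσ1 : σ ≤ τ / 2 := min_le_left _ _
    have hσ2 : σ ≤ ‖h‖ := min_le_right _ _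
    have h1 := hτ' (x := d + σ) (by simp [abs_of_pos hσ]; linarith)
    rw [Real.dist_eq] at h1
    have h2 : (d + σ) ^ n ≤ d ^ n + e i := by linarith [(abs_lt.1 h1).2]
    have hsub : sw h (t i) ⊆ sw h (closedBall a (d + σ)) := by
      rintro y ⟨p, hp, s, hs, rfl⟩
      refine ⟨p, ?_, s, hs, rfl⟩
      have : dist p a ≤ d := by
        rw [dist_edist]; exact ENNReal.toReal_mono hfin (edist_le_ediam_of_mem hp ha)
      rw [mem_closedBall]; linarith
    refine (measure_mono hsub).trans ((hC h a (d + σ) (by linarith) (by linarith)).trans ?_)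
    gcongr
    rw [hd, ← ENNReal.ofReal_pow (by linarith), ← ENNReal.ofReal_pow hd0]
    refine (ENNReal.ofReal_le_ofReal h2).trans ?_
    rw [ENNReal.ofReal_add (by positivity) (by positivity), ENNReal.ofReal_coe_nnreal]
  have hsub : sw h A ⊆ ⋃ i, sw h (t i) := by
    rintro y ⟨p, hp, s, hs, rfl⟩
    obtain ⟨i, hi⟩ := mem_iUnion.1 (ht1 hp)
    exact mem_iUnion.2 ⟨i, p, hi, s, hs, rfl⟩
  calc volume (sw h A) ≤ ∑' i, volume (sw h (t i)) :=
        (measure_mono hsub).trans (measure_iUnion_le _)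
    _ ≤ ∑' i, C * ofReal ‖h‖ *
      ((⨆ _ : (t i).Nonempty, ediam (t i) ^ (n:ℝ)) + e i) := ENNReal.tsum_le_tsum key
    _ = C * ofReal ‖h‖ * ((∑' i, (⨆ _ : (t i).Nonempty, ediam (t i) ^ (n:ℝ))) + ∑' i, (e i : EN)) := by
      rw [ENNReal.tsum_mul_left, ENNReal.tsum_add]
    _ ≤ C * ofReal ‖h‖ * ((μH[n] A + (ε / 2 : ℝ≥0)) + (ε / 2 : ℝ≥0)) := by
      gcongr
    _ = _ := by
      rw [add_assoc, ← ENNReal.coe_add, add_halves]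

def dsh {Y : Type*} (w : Y → EN) (k : ℤ) : Set Y := {x | w x ∈ Ico ((2:EN) ^ k) (2 ^ (k + 1))}

theorem dsh_meas {Y : Type*} [MeasurableSpace Y] {w : Y → EN} (hw : Measurable w) (k : ℤ) :
    MeasurableSet (dsh w k) := hw measurableSet_Ico

theorem dsh_exists {Y : Type*} {w : Y → EN} {x : Y} (h0 : w x ≠ 0) (h1 : w x ≠ ⊤) :
    ∃ k, x ∈ dsh w k :=
  ENNReal.exists_mem_Ico_zpow h0 h1 (by norm_num) (by norm_num)

theorem dsh_disj {Y : Type*} (w : Y → EN) : Pairwise (Function.onFun Disjoint (dsh w)) := by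
  have key : ∀ i j : ℤ, i < j → Disjoint (dsh w i) (dsh w j) := by
    intro i j hij
    rw [Set.disjoint_left]
    rintro x ⟨_, h2⟩ ⟨h3, _⟩
    have : (2:EN) ^ (i + 1) ≤ 2 ^ j := ENNReal.zpow_le_of_le (by norm_num) (by omega)
    exact absurd (lt_of_lt_of_le h2 (this.trans h3)) (lt_irrefl _)
  intro i j hij
  rcases lt_or_gt_of_ne hij with h | h
  · exact key i j h
  · exact (key j i h).symm

theorem dsh_two (k : ℤ) : (2:EN) ^ (k + 1) = 2 * 2 ^ k := by
  rw [ENNReal.zpow_add (by norm_num) (by norm_num), zpow_one, mul_comm]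

theorem dsh_sum_le {Y : Type*} [MeasurableSpace Y] {w : Y → EN} (hw : Measurable w)
    (ν : Measure Y) {A : Set Y} (hA : MeasurableSet A) :
    ∑' k : ℤ, (2:EN) ^ (k + 1) * ν (A ∩ dsh w k) ≤ 2 * ∫⁻ x in A, w x ∂ν := by
  have h1 : ∫⁻ x in ⋃ k, (A ∩ dsh w k), w x ∂ν = ∑' k : ℤ, ∫⁻ x in A ∩ dsh w k, w x ∂ν :=
    lintegral_iUnion (fun k => hA.inter (dsh_meas hw k))
      (fun i j h => (dsh_disj w h).mono inter_subset_right inter_subset_right) _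
  calc _ ≤ ∑' k : ℤ, 2 * ∫⁻ x in A ∩ dsh w k, w x ∂ν := by
        refine ENNReal.tsum_le_tsum fun k => ?_
        rw [dsh_two, mul_assoc]
        gcongr
        rw [← setLIntegral_const]
        exact setLIntegral_mono' (hA.inter (dsh_meas hw k)) (fun x hx => hx.2.1)
    _ = 2 * ∫⁻ x in ⋃ k, (A ∩ dsh w k), w x ∂ν := by rw [ENNReal.tsum_mul_left, h1]
    _ ≤ _ := by
      gcongr
      exact iUnion_subset fun k => inter_subset_left

theorem le_dsh_sum {Y : Type*} [MeasurableSpace Y] {w : Y → EN} (hw : Measurable w)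
    (hw' : ∀ x, w x ≠ ⊤) (ν : Measure Y) {A : Set Y} (hA : MeasurableSet A) :
    ∫⁻ x in A, w x ∂ν ≤ ∑' k : ℤ, (2:EN) ^ (k + 1) * ν (A ∩ dsh w k) := by
  have : ∀ k : ℤ, (2:EN) ^ (k + 1) * ν (A ∩ dsh w k) =
      ∫⁻ x, (A ∩ dsh w k).indicator (fun _ => (2:EN) ^ (k + 1)) x ∂ν := fun k => by
    rw [lintegral_indicator_const (hA.inter (dsh_meas hw k))]
  simp_rw [this]
  rw [← lintegral_tsum (fun k => (measurable_const.indicator (hA.inter (dsh_meas hw k))).aemeasurable),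
    ← lintegral_indicator hA]
  refine lintegral_mono fun x => ?_
  by_cases hx : x ∈ A
  · rw [indicator_of_mem hx]
    by_cases h0 : w x = 0
    · rw [h0]; exact zero_le
    obtain ⟨k, hk⟩ := dsh_exists h0 (hw' x)
    refine le_trans ?_ (ENNReal.le_tsum k)
    rw [indicator_of_mem (show x ∈ A ∩ dsh w k from ⟨hx, hk⟩)]
    exact hk.2.le
  · rw [indicator_of_notMem hx]; exact zero_le

theorem sw_weighted (n : ℕ) : ∃ C : ℝ≥0, ∀ (h : EE n) (A : Set (EE n)) (w : EE n → EN), h ≠ 0 →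
    MeasurableSet A → Measurable w → (∀ x, w x ≠ ⊤) →
    ∃ F : EE n → EN, Measurable F ∧ (∀ p ∈ A, ∀ s ∈ Icc (0:ℝ) 1, w p ≤ F (p + s • h)) ∧
      ∫⁻ x, F x ≤ C * ofReal ‖h‖ * ∫⁻ x in A, w x ∂μH[n] := by
  obtain ⟨C, hC⟩ := sw_vol n
  refine ⟨2 * C, fun h A w hh hA hw hw' => ?_⟩
  set T : ℤ → Set (EE n) := fun k => toMeasurable volume (sw h (A ∩ dsh w k))
  have hT : ∀ k, MeasurableSet (T k) := fun k => measurableSet_toMeasurable _ _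
  refine ⟨fun x => ∑' k : ℤ, (T k).indicator (fun _ => (2:EN) ^ (k + 1)) x, ?_, ?_, ?_⟩
  · exact Measurable.tsum fun k => measurable_const.indicator (hT k)
  · intro p hp s hs
    by_cases h0 : w p = 0
    · rw [h0]; exact zero_le
    obtain ⟨k, hk⟩ := dsh_exists h0 (hw' p)
    refine le_trans ?_ (ENNReal.le_tsum k)
    rw [indicator_of_mem]
    · exact hk.2.le
    · exact subset_toMeasurable _ _ ⟨p, ⟨hp, hk⟩, s, hs, rfl⟩
  · rw [lintegral_tsum (fun k => (measurable_const.indicator (hT k)).aemeasurable)]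
    calc _ ≤ ∑' k : ℤ, (C * ofReal ‖h‖) * ((2:EN) ^ (k + 1) * μH[n] (A ∩ dsh w k)) := by
          refine ENNReal.tsum_le_tsum fun k => ?_
          rw [lintegral_indicator_const (hT k), measure_toMeasurable, mul_left_comm]
          gcongr
          exact hC h _ hh
      _ ≤ C * ofReal ‖h‖ * (2 * ∫⁻ x in A, w x ∂μH[n]) := by
        rw [ENNReal.tsum_mul_left]; gcongr; exact dsh_sum_le hw _ hA
      _ = _ := by push_cast; ring

theorem slice_lip (n : ℕ) : ∃ C : ℝ≥0, ∀ (u : EE n → ℝ) (_ : LipschitzWith 1 u) (A : Set (EE n)),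
    ∃ G : ℝ → EN, Measurable G ∧ (∀ r, μH[n] (A ∩ u ⁻¹' {r}) ≤ G r) ∧
      ∫⁻ r, G r ≤ C * volume A := by
  obtain ⟨c, hc, hcv⟩ := vol_eq_haus n
  refine ⟨c, fun u hu A => ?_⟩
  by_cases hA : volume A = ⊤
  · refine ⟨fun _ => ⊤, measurable_const, fun _ => le_top, ?_⟩
    rw [hA, ENNReal.mul_top (by simpa using hc.ne')]; exact le_top
  have hHA : μH[(n + 1 : ℕ)] A = c * volume A := by rw [hcv]; simp
  have hHA' : μH[(n + 1 : ℕ)] A ≠ ⊤ := by rw [hHA]; finiteness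
  have hpos : ∀ k : ℕ, (0:EN) < ((k : EN) + 1)⁻¹ := fun k => by
    rw [ENNReal.inv_pos]; finiteness
  have hlim : Tendsto (fun k : ℕ => ((k : EN) + 1)⁻¹) atTop (𝓝 0) := by
    have := (tendsto_add_atTop_iff_nat 1).2 ENNReal.tendsto_inv_nat_nhds_zero
    simpa using this
  choose t ht1 ht2 ht3 using fun k : ℕ => haus_cover (n + 1 : ℕ) A hHA' ((k : EN) + 1)⁻¹ (hpos k)
    ((k : EN) + 1)⁻¹ (hpos k).ne'
  set J : ℕ → ℕ → Set ℝ := fun k i => toMeasurable volume (u '' t k i)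
  have hJ : ∀ k i, MeasurableSet (J k i) := fun k i => measurableSet_toMeasurable _ _
  set g : ℕ → ℝ → EN := fun k r => ∑' i, (J k i).indicator (fun _ => ediam (t k i) ^ (n:ℝ)) r
  have hg : ∀ k, Measurable (g k) := fun k =>
    Measurable.tsum fun i => measurable_const.indicator (hJ k i)
  refine ⟨fun r => liminf (fun k => g k r) atTop, Measurable.liminf hg, fun r => ?_, ?_⟩
  · have h1 := Measure.hausdorffMeasure_le_liminf_tsum (ι := fun k => {i : ℕ // (t k i ∩ u ⁻¹' {r}).Nonempty})
      n (A ∩ u ⁻¹' {r}) (l := atTop) (fun k : ℕ => ((k : EN) + 1)⁻¹) hlim (fun k i => t k i.1)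
      (Eventually.of_forall fun k i => ht2 k i.1)
      (Eventually.of_forall fun k p hp => by
        obtain ⟨i, hi⟩ := mem_iUnion.1 (ht1 k hp.1)
        exact mem_iUnion.2 ⟨⟨i, ⟨p, hi, hp.2⟩⟩, hi⟩)
    refine h1.trans (liminf_le_liminf (Eventually.of_forall fun k => ?_))
    have := tsum_subtype {i : ℕ | (t k i ∩ u ⁻¹' {r}).Nonempty} (fun i => ediam (t k i) ^ (n:ℝ))
    refine (le_of_eq this).trans (ENNReal.tsum_le_tsum fun i => ?_)
    by_cases hi : (t k i ∩ u ⁻¹' {r}).Nonempty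
    · obtain ⟨p, hp1, hp2⟩ := hi
      rw [indicator_of_mem (show i ∈ {i : ℕ | (t k i ∩ u ⁻¹' {r}).Nonempty} from ⟨p, hp1, hp2⟩),
        indicator_of_mem]
      exact subset_toMeasurable _ _ ⟨p, hp1, hp2⟩
    · rw [indicator_of_notMem (by exact hi)]; exact zero_le
  · refine (lintegral_liminf_le hg).trans ?_
    have h2 : ∀ k, ∫⁻ r, g k r ≤ c * volume A + ((k : EN) + 1)⁻¹ := by
      intro k
      rw [← hHA]
      refine le_trans ?_ (ht3 k)
      rw [lintegral_tsum (fun i => (measurable_const.indicator (hJ k i)).aemeasurable)]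
      refine ENNReal.tsum_le_tsum fun i => ?_
      rw [lintegral_indicator_const (hJ k i), measure_toMeasurable]
      rcases (t k i).eq_empty_or_nonempty with h0 | hne
      · simp [h0]
      rw [ciSup_pos hne, ENNReal.rpow_natCast, ENNReal.rpow_natCast, pow_succ]
      gcongr
      refine (Real.volume_le_diam _).trans ?_
      have := hu.ediam_image_le (t k i)
      simpa using this
    refine (liminf_le_liminf (Eventually.of_forall h2)).trans (le_of_eq ?_)
    apply Tendsto.liminf_eq
    simpa using (tendsto_const_nhds (x := (c:EN) * volume A)).add hlim

theorem slice_unw (n : ℕ) : ∃ C : ℝ≥0, ∀ (x : EE n) (A : Set (EE n)),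
    ∃ G : ℝ → EN, Measurable G ∧ (∀ r, μH[n] (A ∩ sphere x r) ≤ G r) ∧
      ∫⁻ r, G r ≤ C * volume A := by
  obtain ⟨C, hC⟩ := slice_lip n
  exact ⟨C, fun x A => hC (fun p => dist p x) (LipschitzWith.dist_left x) A⟩

theorem slice_weighted (n : ℕ) : ∃ C : ℝ≥0, ∀ (x : EE n) (A : Set (EE n)) (w : EE n → EN),
    MeasurableSet A → Measurable w → (∀ x, w x ≠ ⊤) →
    ∃ G : ℝ → EN, Measurable G ∧ (∀ r, ∫⁻ y in A ∩ sphere x r, w y ∂μH[n] ≤ G r) ∧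
      ∫⁻ r, G r ≤ C * ∫⁻ y in A, w y := by
  obtain ⟨C, hC⟩ := slice_unw n
  refine ⟨2 * C, fun x A w hA hw hw' => ?_⟩
  choose G hG1 hG2 hG3 using fun k : ℤ => hC x (A ∩ dsh w k)
  refine ⟨fun r => ∑' k : ℤ, 2 ^ (k + 1) * G k r, ?_, fun r => ?_, ?_⟩
  · exact Measurable.tsum fun k => (hG1 k).const_mul _
  · refine (le_dsh_sum hw hw' _ (hA.inter isClosed_sphere.measurableSet)).trans ?_
    refine ENNReal.tsum_le_tsum fun k => ?_
    gcongr
    refine le_trans (measure_mono ?_) (hG2 k r)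
    rintro y ⟨⟨h1, h2⟩, h3⟩; exact ⟨⟨h1, h3⟩, h2⟩
  · rw [lintegral_tsum (fun k => ((hG1 k).const_mul _).aemeasurable)]
    calc _ ≤ ∑' k : ℤ, C * ((2:EN) ^ (k + 1) * volume (A ∩ dsh w k)) := by
          refine ENNReal.tsum_le_tsum fun k => ?_
          rw [lintegral_const_mul _ (hG1 k), mul_left_comm]
          gcongr
          exact hG3 k
      _ ≤ C * (2 * ∫⁻ y in A, w y) := by
        rw [ENNReal.tsum_mul_left]; gcongr; exact dsh_sum_le hw _ hA
      _ = _ := by push_cast; ring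

theorem seg_frontier {Y : Type*} [NormedAddCommGroup Y] [NormedSpace ℝ Y] {U : Set Y}
    (hU : IsOpen U) {x h : Y} (hx : x ∈ U) (hy : x + h ∉ U) :
    ∃ s ∈ Icc (0:ℝ) 1, x + s • h ∈ frontier U := by
  by_contra hcon
  push Not at hcon
  have hpre : IsPreconnected ((fun s : ℝ => x + s • h) '' Icc 0 1) :=
    isPreconnected_Icc.image _ (by fun_prop)
  have hsub : ((fun s : ℝ => x + s • h) '' Icc 0 1) ⊆ U ∪ (closure U)ᶜ := by
    rintro _ ⟨s, hs, rfl⟩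
    by_cases h1 : x + s • h ∈ U
    · exact Or.inl h1
    · right; intro h2
      exact hcon s hs ⟨h2, by rwa [hU.interior_eq]⟩
  obtain ⟨z, _, hz1, hz2⟩ := hpre U (closure U)ᶜ hU isClosed_closure.isOpen_compl hsub
    ⟨x, ⟨0, by simp, by simp⟩, hx⟩
    ⟨x + h, ⟨1, by simp, by simp⟩, by
      rcases hsub ⟨1, by simp, rfl⟩ with h1 | h1
      · simp only [one_smul] at h1; exact absurd h1 hy
      · simpa using h1⟩
  exact hz2 (subset_closure hz1)

theorem le_lint_Icc {g : ℝ → EN} {c : EN} (a : ℝ) (h : ∀ t ∈ Icc a (a + 1), c ≤ g t) :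
    c ≤ ∫⁻ t, g t := by
  calc c = ∫⁻ t in Icc a (a + 1), c := by simp
    _ ≤ ∫⁻ t in Icc a (a + 1), g t := setLIntegral_mono' measurableSet_Icc h
    _ ≤ _ := setLIntegral_le_lintegral _ _

theorem norm_le_add_of_inner {Y : Type*} [NormedAddCommGroup Y] [InnerProductSpace ℝ Y] {a b : Y}
    (h : 0 ≤ inner ℝ a b) : ‖a‖ ≤ ‖a + b‖ := by
  have := norm_add_sq_real a b
  exact le_of_sq_le_sq (by nlinarith [sq_nonneg ‖b‖]) (norm_nonneg _)

theorem line_ge {w F : EE n → EN} {G : Set (EE n)} (hG : IsOpen G)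
    (hwm : ∀ x y, ‖x‖ ≤ ‖y‖ → w x ≤ w y) (x e : EE n) (hx : x ∈ G) (hxe : 0 ≤ inner ℝ x e)
    (hF : ∀ p ∈ frontier G, ∀ s ∈ Icc (0:ℝ) 1, w p ≤ F (p + s • e))
    (κ : EN) (hκ : κ ≠ 0) (hF2 : ∀ y ∈ G, κ * w y ≤ F y) :
    w x ≤ ∫⁻ t : ℝ, F (x + t • e) := by
  have hmon : ∀ t : ℝ, 0 ≤ t → w x ≤ w (x + t • e) := fun t ht => hwm _ _ <|
    norm_le_add_of_inner (by rw [inner_smul_right]; positivity)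
  by_cases hex : ∃ τ : ℝ, 0 ≤ τ ∧ x + τ • e ∉ G
  · obtain ⟨τ, hτ, hout⟩ := hex
    obtain ⟨s, hs, hfr⟩ := seg_frontier hG hx hout
    refine le_lint_Icc (s * τ) fun t ht => ?_
    rw [smul_smul] at hfr
    refine (hmon (s * τ) (mul_nonneg hs.1 hτ)).trans ?_
    have := hF _ hfr (t - s * τ) ⟨by linarith [ht.1], by linarith [ht.2]⟩
    rwa [add_assoc, ← add_smul, add_sub_cancel] at this
  · push Not at hex
    by_cases h0 : w x = 0
    · rw [h0]; exact zero_le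
    have : ∫⁻ t in Ici (0:ℝ), κ * w x ≤ ∫⁻ t : ℝ, F (x + t • e) :=
      (setLIntegral_mono' measurableSet_Ici fun t ht =>
        (mul_le_mul' le_rfl (hmon t ht)).trans (hF2 _ (hex t ht))).trans
          (setLIntegral_le_lintegral _ _)
    rw [setLIntegral_const, Real.volume_Ici, ENNReal.mul_top (mul_ne_zero hκ h0)] at this
    exact le_top.trans this

theorem isop_weighted (n : ℕ) (hn : 1 ≤ n) : ∃ C : ℝ≥0, ∀ (w : EE n → EN), Measurable w →
    (∀ x, w x ≠ ⊤) → (∀ x y, ‖x‖ ≤ ‖y‖ → w x ≤ w y) → ∀ G : Set (EE n), IsOpen G →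
    ∫⁻ x in G, w x ≠ ⊤ →
    ∫⁻ x in G, w x ^ (((n:ℝ) + 1) / n) ≤ (C * ∫⁻ x in frontier G, w x ∂μH[n]) ^ (((n:ℝ) + 1) / n) := by
  obtain ⟨C, hC⟩ := sw_weighted n
  refine ⟨2 * (n + 1) * C, fun w hw hw' hwm G hG hfin => ?_⟩
  have hn0 : (0:ℝ) < n := by exact_mod_cast hn
  set p : ℝ := ((n:ℝ) + 1) / n with hp
  have hp0 : 0 < p := by positivity
  set e : Fin (n + 1) → EE n := fun i => EuclideanSpace.single i (1:ℝ) with he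
  have hen : ∀ i, ‖e i‖ = 1 := fun i => by simp [he]
  have hene : ∀ i, e i ≠ 0 := fun i h => by simpa [h] using hen i
  choose F hF1 hF2 hF3 using fun i => hC (e i) (frontier G) w (hene i) isClosed_frontier.measurableSet hw hw'
  choose F' hF1' hF2' hF3' using fun i => hC (-e i) (frontier G) w (neg_ne_zero.2 (hene i))
    isClosed_frontier.measurableSet hw hw'
  set P := ∫⁻ x in frontier G, w x ∂μH[n] with hP
  have main : ∀ κ : EN, κ ≠ 0 → ∫⁻ x in G, w x ^ p ≤
      (((2 * (n + 1) * C : ℝ≥0) : EN) * P + κ * ∫⁻ x in G, w x) ^ p := by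
    intro κ hκ
    set Φ : EE n → EN := fun x => ∑ i, (F i x + F' i x) + G.indicator (fun y => κ * w y) x with hΦ
    have hΦm : Measurable Φ :=
      (Finset.measurable_sum _ fun i _ => (hF1 i).add (hF1' i)).add
        ((hw.const_mul κ).indicator hG.measurableSet)
    have hΦ1 : ∀ i x, F i x ≤ Φ x := fun i x => by
      refine le_trans ?_ le_self_add
      refine le_trans le_self_add (Finset.single_le_sum (f := fun i => F i x + F' i x) (fun _ _ => zero_le) (Finset.mem_univ i))
    have hΦ1' : ∀ i x, F' i x ≤ Φ x := fun i x => by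
      refine le_trans ?_ le_self_add
      refine le_trans le_add_self (Finset.single_le_sum (f := fun i => F i x + F' i x) (fun _ _ => zero_le) (Finset.mem_univ i))
    have hΦ2 : ∀ y ∈ G, κ * w y ≤ Φ y := fun y hy => by
      refine le_trans ?_ le_add_self
      rw [indicator_of_mem hy]
    have hline : ∀ x ∈ G, ∀ i, w x ≤ ∫⁻ t : ℝ, Φ (x + t • e i) := by
      intro x hx i
      rcases le_total 0 (inner ℝ x (e i)) with h | h
      · exact line_ge hG hwm x (e i) hx h (fun q hq s hs => (hF2 i q hq s hs).trans (hΦ1 i _)) κ hκ hΦ2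
      · have := line_ge hG hwm x (-e i) hx (by rw [inner_neg_right]; linarith)
          (fun q hq s hs => (hF2' i q hq s hs).trans (hΦ1' i _)) κ hκ hΦ2
        refine this.trans_eq ?_
        rw [← lintegral_neg_eq_self]
        simp
    have hint : ∫⁻ x, Φ x ≤ ((2 * (n + 1) * C : ℝ≥0) : EN) * P + κ * ∫⁻ x in G, w x := by
      rw [hΦ, lintegral_add_right _ ((hw.const_mul κ).indicator hG.measurableSet),
        lintegral_indicator hG.measurableSet, lintegral_const_mul _ hw,
        lintegral_finsetSum (f := fun i x => F i x + F' i x) _ (fun i _ => (hF1 i).add (hF1' i))]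
      gcongr
      calc _ ≤ ∑ i : Fin (n + 1), (2 * (C * P)) := by
            refine Finset.sum_le_sum fun i _ => ?_
            rw [lintegral_add_left (hF1 i), two_mul]
            have h1 := hF3 i
            have h2 := hF3' i
            simp only [norm_neg, hen, ENNReal.ofReal_one, mul_one] at h1 h2
            exact add_le_add h1 h2
        _ = _ := by simp; ring
    refine le_trans ?_ (ENNReal.rpow_le_rpow hint hp0.le)
    have hconj : Real.HolderConjugate (Fintype.card (Fin (n + 1)) : ℝ) p := by
      rw [Real.holderConjugate_iff]
      refine ⟨by simpa using Nat.pos_of_ne_zero (by omega), ?_⟩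
      simp only [Fintype.card_fin, hp]; push_cast; field_simp; ring
    have hgrid := lintegral_prod_lintegral_pow_le (fun _ : Fin (n + 1) => (volume : Measure ℝ)) hconj
      (f := fun y => Φ (WithLp.toLp 2 y)) (hΦm.comp (WithLp.measurable_toLp 2 _))
    have hvp := PiLp.volume_preserving_toLp (Fin (n + 1))
    rw [← volume_pi, hvp.lintegral_comp hΦm] at hgrid
    refine le_trans ?_ hgrid
    rw [← lintegral_indicator hG.measurableSet]
    have hmm : Measurable (G.indicator fun x => w x ^ p) :=
      (hw.pow_const p).indicator hG.measurableSet
    rw [← hvp.lintegral_comp hmm]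
    refine lintegral_mono fun y => ?_
    by_cases hy : WithLp.toLp 2 y ∈ G
    · rw [indicator_of_mem hy]
      have hi : ∀ i, w (WithLp.toLp 2 y) ≤ ∫⁻ t : ℝ, Φ (WithLp.toLp 2 (Function.update y i t)) := by
        intro i
        refine (hline _ hy i).trans_eq ?_
        rw [← lintegral_add_right_eq_self (fun t => Φ (WithLp.toLp 2 (Function.update y i t))) (y i)]
        refine lintegral_congr fun t => ?_
        congr 1
        ext j
        by_cases hj : j = i
        · subst hj; simp [he]; ring
        · simp [he, hj]
      calc w (WithLp.toLp 2 y) ^ p = ∏ i : Fin (n + 1), w (WithLp.toLp 2 y) ^ ((1:ℝ) / ((Fintype.card (Fin (n + 1)) : ℝ) - 1)) := by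
            rw [Finset.prod_const, ← ENNReal.rpow_natCast, ← ENNReal.rpow_mul]
            congr 1
            simp [hp]; field_simp
        _ ≤ _ := Finset.prod_le_prod' fun i _ => ENNReal.rpow_le_rpow (hi i) (by simp)
    · rw [indicator_of_notMem hy]; exact zero_le
  have hcont : Tendsto (fun k : ℕ => (((2 * (n + 1) * C : ℝ≥0) : EN) * P + (k:EN)⁻¹ * ∫⁻ x in G, w x) ^ p) atTop
      (𝓝 ((((2 * (n + 1) * C : ℝ≥0) : EN) * P) ^ p)) := by
    refine (ENNReal.continuous_rpow_const.tendsto _).comp ?_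
    have := ENNReal.Tendsto.mul_const ENNReal.tendsto_inv_nat_nhds_zero (b := ∫⁻ x in G, w x) (Or.inr hfin)
    simpa using (tendsto_const_nhds (x := ((2 * (n + 1) * C : ℝ≥0) : EN) * P)).add this
  exact ge_of_tendsto hcont (Eventually.of_forall fun k => main _ (by simp))

structure GoodF (f : EE n → ℝ) : Prop where
  cont : Continuous f
  pos : ∀ x, 0 < f x
  mono : ∀ x y, ‖x‖ ≤ ‖y‖ → f x ≤ f y
  tends : Tendsto f (Bornology.cobounded (EE n)) atTop

theorem GoodF.meas (hf : GoodF f) :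
    Measurable (fun x => ofReal (f x)) := hf.cont.measurable.ennreal_ofReal

theorem proj_lip {Y : Type*} [NormedAddCommGroup Y] [InnerProductSpace ℝ Y] {R : ℝ} (hR : 0 < R)
    {x y : Y} (hx : R ≤ ‖x‖) (hy : R ≤ ‖y‖) :
    ‖(R / ‖x‖) • x - (R / ‖y‖) • y‖ ≤ ‖x - y‖ := by
  have ha : 0 < ‖x‖ := hR.trans_le hx
  have hb : 0 < ‖y‖ := hR.trans_le hy
  have hp := real_inner_le_norm x y
  refine le_of_sq_le_sq ?_ (norm_nonneg _)
  rw [@norm_sub_sq_real _ _ _ ((R / ‖x‖) • x), @norm_sub_sq_real _ _ _ x, norm_smul, norm_smul,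
    inner_smul_left, inner_smul_right]
  simp only [Real.norm_eq_abs, abs_of_pos (div_pos hR ha), abs_of_pos (div_pos hR hb),
    conj_trivial, div_mul_cancel₀ _ ha.ne', div_mul_cancel₀ _ hb.ne']
  set a := ‖x‖
  set b := ‖y‖
  set p := inner ℝ x y
  have e : R / a * (R / b * p) = R ^ 2 / (a * b) * p := by field_simp
  rw [e]
  have h1 : R ^ 2 / (a * b) ≤ 1 := by
    rw [div_le_one (by positivity)]; nlinarith
  have h2 : R ^ 2 / (a * b) * (a * b) = R ^ 2 := by field_simp
  nlinarith [sq_nonneg (a - b), mul_nonneg (sub_nonneg.2 hp) (sub_nonneg.2 h1)]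

theorem proj_haus {R : ℝ} (hR : 0 < R) (T : Set (EE n)) (hT : ∀ x ∈ T, R ≤ ‖x‖) :
    Hm ((fun y : EE n => (R / ‖y‖) • y) '' T) ≤ Hm T := by
  have : LipschitzOnWith 1 (fun y : EE n => (R / ‖y‖) • y) T := by
    refine LipschitzOnWith.of_dist_le_mul fun x hx y hy => ?_
    simp only [dist_eq_norm, NNReal.coe_one, one_mul]
    exact proj_lip hR (hT x hx) (hT y hy)
  simpa using this.hausdorffMeasure_image_le (d := n) (by positivity)

theorem trunc_per (hf : GoodF f) {W : Set (EE n)} (hW : IsOpen W)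
    (hv : volume W ≠ ⊤) {R : ℝ} (hR : 0 < R) : wper f (W ∩ ball 0 R) ≤ wper f W := by
  set ρ := fun y : EE n => (R / ‖y‖) • y with hρ
  set T := frontier W \ ball 0 R with hT
  set Ai := {x : EE n | ‖x‖ = R ∧ ∀ l : ℝ, 1 ≤ l → l • x ∈ W} with hAi
  have hρid : ∀ x : EE n, ‖x‖ = R → ∀ l : ℝ, 1 ≤ l → ρ (l • x) = x := by
    intro x hx l hl
    simp only [hρ, norm_smul, hx, Real.norm_eq_abs, abs_of_pos (show 0 < l by linarith), smul_smul]
    rw [show R / (l * R) * l = 1 by field_simp, one_smul]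
  have hTn : ∀ x ∈ T, R ≤ ‖x‖ := by
    intro x hx; have := hx.2; simpa using this
  have hnull : Hm Ai = 0 := by
    obtain ⟨C, hC⟩ := slice_unw n
    obtain ⟨G, hGm, hG, hGi⟩ := hC 0 W
    have h1 : ∀ r, R < r → Hm Ai ≤ G r := by
      intro r hr
      refine le_trans ?_ (hG r)
      refine le_trans (measure_mono ?_) (proj_haus hR (W ∩ sphere 0 r) ?_)
      · rintro x ⟨hx, hx2⟩
        refine ⟨(r / R) • x, ⟨hx2 _ ?_, ?_⟩, hρid x hx _ ?_⟩
        · rw [le_div_iff₀ hR]; linarith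
        · rw [mem_sphere_zero_iff_norm, norm_smul, hx, Real.norm_eq_abs,
            abs_of_pos (div_pos (hR.trans hr) hR)]; field_simp
        · rw [le_div_iff₀ hR]; linarith
      · rintro x ⟨_, hx⟩; rw [mem_sphere_zero_iff_norm] at hx; linarith
    by_contra hne
    have h2 : ∫⁻ r in Ioi R, Hm Ai ≤ ∫⁻ r, G r :=
      (setLIntegral_mono hGm fun r hr => h1 r hr).trans (setLIntegral_le_lintegral _ _)
    rw [setLIntegral_const, Real.volume_Ioi, ENNReal.mul_top hne] at h2
    have h3 := h2.trans hGi
    exact absurd (top_le_iff.1 h3) (ENNReal.mul_ne_top (by simp) hv)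
  have hsub : frontier (W ∩ ball 0 R) ⊆ (frontier W ∩ ball 0 R) ∪ (ρ '' T ∪ Ai) := by
    have key : ∀ x : EE n, x ∈ closure W → ‖x‖ = R → x ∈ ρ '' T ∪ Ai := by
      intro x hx hxR
      by_cases hxW : x ∈ W
      · by_cases hall : ∀ l : ℝ, 1 ≤ l → l • x ∈ W
        · exact Or.inr ⟨hxR, hall⟩
        · push Not at hall
          obtain ⟨l, hl, hlW⟩ := hall
          obtain ⟨s, hs, hsf⟩ := seg_frontier hW (x := x) (h := (l - 1) • x) hxW
            (by rwa [show x + (l - 1) • x = l • x by module])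
          rw [show x + s • (l - 1) • x = (1 + s * (l - 1)) • x by module] at hsf
          have h1 : 1 ≤ 1 + s * (l - 1) := by nlinarith [hs.1]
          refine Or.inl ⟨_, ⟨hsf, ?_⟩, hρid x hxR _ h1⟩
          simp only [mem_ball, dist_zero_right, not_lt, norm_smul, hxR, Real.norm_eq_abs,
            abs_of_pos (show 0 < 1 + s * (l - 1) by linarith)]
          nlinarith
      · refine Or.inl ⟨x, ⟨⟨hx, by rwa [hW.interior_eq]⟩, by simp [hxR]⟩, ?_⟩
        have := hρid x hxR 1 le_rfl
        simpa using this
    intro x hx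
    have h0 := frontier_inter_subset _ _ hx
    have hcl : x ∈ closure W := closure_mono inter_subset_left hx.1
    rcases h0 with h | h
    · have hb : ‖x‖ ≤ R := by
        have := closure_ball_subset_closedBall h.2; simpa using this
      rcases hb.lt_or_eq with hlt | heq
      · exact Or.inl ⟨h.1, by simpa using hlt⟩
      · exact Or.inr (key x hcl heq)
    · refine Or.inr (key x hcl ?_)
      have := frontier_ball_subset_sphere h.2
      simpa using this
  obtain ⟨c, hc⟩ : ∃ c : EN, ∀ x : EE n, (‖x‖ = R → ofReal (f x) = c) ∧
      (R ≤ ‖x‖ → c ≤ ofReal (f x)) := by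
    obtain ⟨x0, hx0⟩ : ∃ x0 : EE n, ‖x0‖ = R := by
      obtain ⟨x0, hx0⟩ := NormedSpace.sphere_nonempty (E := EE n) (x := 0) (r := R) |>.2 hR.le
      exact ⟨x0, by simpa using hx0⟩
    refine ⟨ofReal (f x0), fun x => ⟨fun hx => ?_, fun hx => ?_⟩⟩
    · rw [le_antisymm (hf.mono x x0 (by rw [hx, hx0])) (hf.mono x0 x (by rw [hx, hx0]))]
    · exact ENNReal.ofReal_le_ofReal (hf.mono _ _ (by rw [hx0]; exact hx))
  have hρT : ∀ x ∈ ρ '' T, ‖x‖ = R := by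
    rintro _ ⟨y, hy, rfl⟩
    have := hTn y hy
    have h0 : 0 < ‖y‖ := hR.trans_le this
    simp only [hρ, norm_smul, Real.norm_eq_abs, abs_of_pos (div_pos hR h0)]
    field_simp
  unfold wper
  calc ∫⁻ x in frontier (W ∩ ball 0 R), ofReal (f x) ∂Hm
      ≤ ∫⁻ x in (frontier W ∩ ball 0 R) ∪ (ρ '' T ∪ Ai), ofReal (f x) ∂Hm :=
        lintegral_mono_set hsub
    _ ≤ ∫⁻ x in (frontier W ∩ ball 0 R), ofReal (f x) ∂Hm
        + (∫⁻ x in ρ '' T, ofReal (f x) ∂Hm + ∫⁻ x in Ai, ofReal (f x) ∂Hm) :=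
        (lintegral_union_le _ _ _).trans (add_le_add le_rfl (lintegral_union_le _ _ _))
    _ ≤ ∫⁻ x in (frontier W ∩ ball 0 R), ofReal (f x) ∂Hm
        + (∫⁻ x in T, ofReal (f x) ∂Hm + 0) := by
        refine add_le_add le_rfl (add_le_add ?_ ?_)
        · calc ∫⁻ x in ρ '' T, ofReal (f x) ∂Hm
              ≤ ∫⁻ x in ρ '' T, c ∂Hm :=
                setLIntegral_mono measurable_const fun x hx => ((hc x).1 (hρT x hx)).le
            _ = c * Hm (ρ '' T) := setLIntegral_const _ _
            _ ≤ c * Hm T := mul_le_mul' le_rfl (proj_haus hR T hTn)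
            _ = ∫⁻ x in T, c ∂Hm := (setLIntegral_const _ _).symm
            _ ≤ _ := setLIntegral_mono hf.meas fun x hx => (hc x).2 (hTn x hx)
        · rw [setLIntegral_measure_zero _ _ hnull]
    _ = _ := by rw [add_zero, hT, lintegral_inter_add_sdiff _ _ measurableSet_ball]

theorem wvol_mono {A B : Set (EE n)} (h : A ⊆ B) : wvol f A ≤ wvol f B :=
  lintegral_mono_set h

theorem vol_le_wvol (hf : GoodF f) (A : Set (EE n)) :
    ofReal (f 0) * volume A ≤ wvol f A := by
  unfold wvol
  rw [← setLIntegral_const]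
  exact setLIntegral_mono hf.meas fun x _ => ENNReal.ofReal_le_ofReal (hf.mono _ _ (by simp))

theorem vol_ne_top (hf : GoodF f) {A : Set (EE n)} (h : wvol f A ≠ ⊤) :
    volume A ≠ ⊤ := by
  intro hA
  have := vol_le_wvol hf A
  rw [hA, ENNReal.mul_top (by simpa using hf.pos 0)] at this
  exact h (top_le_iff.1 this)

theorem haus_le_wper (hf : GoodF f) (A : Set (EE n)) :
    ofReal (f 0) * Hm (frontier A) ≤ wper f A := by
  unfold wper
  rw [← setLIntegral_const]
  exact setLIntegral_mono hf.meas fun x _ => ENNReal.ofReal_le_ofReal (hf.mono _ _ (by simp))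

theorem haus_ne_top (hf : GoodF f) {A : Set (EE n)} (h : wper f A ≠ ⊤) :
    Hm (frontier A) ≠ ⊤ := by
  intro hA
  have := haus_le_wper hf A
  rw [hA, ENNReal.mul_top (by simpa using hf.pos 0)] at this
  exact h (top_le_iff.1 this)

theorem exists_radius (ν : Measure (EE n)) [IsFiniteMeasure ν]
    (hs : ∀ r : ℝ, 0 < r → ν (sphere 0 r) = 0) (hs0 : ν {0} = 0) {V : EN} (hV : 0 < V)
    (hV2 : V < ν univ) : ∃ R : ℝ, 0 < R ∧ ν (ball 0 R) = V := by
  set S := {r : ℝ | V ≤ ν (closedBall 0 r)} with hS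
  have hcb : ∀ r, 0 ≤ r → ν (closedBall 0 r) = ν (ball 0 r) := by
    intro r hr
    rcases hr.lt_or_eq with h | h
    · refine le_antisymm ?_ (measure_mono ball_subset_closedBall)
      rw [← ball_union_sphere]
      refine (measure_union_le _ _).trans ?_
      rw [hs r h, add_zero]
    · subst h; simp [hs0]
  have hne : S.Nonempty := by
    have h1 : Tendsto (fun k : ℕ => ν (closedBall 0 (k : ℝ))) atTop (𝓝 (ν (⋃ k : ℕ, closedBall (0 : EE n) (k:ℝ)))) :=
      tendsto_measure_iUnion_atTop fun a b hab => closedBall_subset_closedBall (by exact_mod_cast hab)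
    rw [iUnion_closedBall_nat] at h1
    obtain ⟨k, hk⟩ := (h1.eventually (lt_mem_nhds hV2)).exists
    exact ⟨k, hk.le⟩
  have hpos : ∀ r ∈ S, 0 < r := by
    intro r hr
    by_contra h
    have h2 : ν (closedBall 0 r) = 0 := measure_mono_null (by
      refine (closedBall_subset_closedBall (not_lt.1 h)).trans ?_; simp) hs0
    rw [hS, mem_ofPred_eq, h2] at hr
    exact absurd hr (not_le.2 hV)
  have hbdd : BddBelow S := ⟨0, fun r hr => (hpos r hr).le⟩
  set R := sInf S with hR
  have hRS : R ∈ S := by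
    have hcl : ∀ k : ℕ, V ≤ ν (closedBall 0 (R + 1 / ((k:ℝ) + 1))) := by
      intro k
      obtain ⟨r, hr, hlt⟩ := exists_lt_of_csInf_lt hne
        (show sInf S < R + 1 / ((k:ℝ) + 1) by rw [← hR]; simp; positivity)
      exact le_trans (show V ≤ _ from hr) (measure_mono (closedBall_subset_closedBall hlt.le))
    have ht : Tendsto (fun k : ℕ => ν (closedBall 0 (R + 1 / ((k:ℝ) + 1)))) atTop
        (𝓝 (ν (⋂ k : ℕ, closedBall (0 : EE n) (R + 1 / ((k:ℝ) + 1))))) := by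
      refine tendsto_measure_iInter_atTop (fun k => measurableSet_closedBall.nullMeasurableSet)
        (fun a b hab => closedBall_subset_closedBall ?_) ⟨0, measure_ne_top _ _⟩
      gcongr
    have heq : (⋂ k : ℕ, closedBall (0 : EE n) (R + 1 / ((k:ℝ) + 1))) = closedBall 0 R := by
      refine subset_antisymm (fun x hx => ?_) (subset_iInter fun k => closedBall_subset_closedBall (by
        have : 0 < 1 / ((k:ℝ) + 1) := by positivity
        linarith))
      rw [mem_closedBall_zero_iff]
      · have h2 : Tendsto (fun k : ℕ => R + 1 / ((k:ℝ) + 1)) atTop (𝓝 (R + 0)) :=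
          tendsto_const_nhds.add tendsto_one_div_add_atTop_nhds_zero_nat
        rw [add_zero] at h2
        exact ge_of_tendsto' h2 fun k => by simpa using mem_iInter.1 hx k
    rw [heq] at ht
    exact ge_of_tendsto' ht hcl
  have hR0 := hpos R hRS
  refine ⟨R, hR0, le_antisymm ?_ ?_⟩
  · have h1 : Tendsto (fun k : ℕ => ν (closedBall 0 (R - 1 / ((k:ℝ) + 1)))) atTop
        (𝓝 (ν (⋃ k : ℕ, closedBall (0 : EE n) (R - 1 / ((k:ℝ) + 1))))) :=
      tendsto_measure_iUnion_atTop fun a b hab => closedBall_subset_closedBall (by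
        gcongr)
    have heq : ball 0 R ⊆ (⋃ k : ℕ, closedBall (0 : EE n) (R - 1 / ((k:ℝ) + 1))) := by
      intro x hx
      rw [mem_ball_zero_iff] at hx
      obtain ⟨k, hk⟩ := exists_nat_one_div_lt (sub_pos.2 hx)
      exact mem_iUnion.2 ⟨k, by rw [mem_closedBall_zero_iff]; linarith⟩
    refine (measure_mono heq).trans (le_of_tendsto' h1 fun k => ?_)
    by_contra hlt
    have : R - 1 / ((k:ℝ) + 1) ∈ S := (not_le.1 hlt).le
    have h3 := csInf_le hbdd this
    have : 0 < 1 / ((k:ℝ) + 1) := by positivity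
    linarith
  · rw [← hcb R hR0.le]; exact hRS

theorem shrink_vol (hf : GoodF f) {W : Set (EE n)} (hW : IsOpen W)
    (hv : wvol f W ≠ ⊤) {V : EN} (hV : 0 < V) (hle : V ≤ wvol f W) :
    ∃ U, IsOpen U ∧ wvol f U = V ∧ wper f U ≤ wper f W := by
  rcases hle.lt_or_eq with hlt | heq
  · set ν := (volume.restrict W).withDensity (fun x => ofReal (f x)) with hν
    have hνm : ∀ A, MeasurableSet A → ν A = wvol f (A ∩ W) := by
      intro A hA
      rw [hν, withDensity_apply _ hA, Measure.restrict_restrict hA]; rfl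
    have : IsFiniteMeasure ν := ⟨by
      rw [hνm _ MeasurableSet.univ, univ_inter]; exact hv.lt_top⟩
    have hac : ν ≪ volume := (withDensity_absolutelyContinuous _ _).trans
      Measure.absolutelyContinuous_restrict
    obtain ⟨R, hR, hRV⟩ := exists_radius ν (fun r _ => hac (Measure.addHaar_sphere _ _ _))
      (hac (measure_singleton _)) hV (by rw [hνm _ MeasurableSet.univ, univ_inter]; exact hlt)
    rw [hνm _ measurableSet_ball, inter_comm] at hRV
    exact ⟨W ∩ ball 0 R, hW.inter isOpen_ball, hRV, trunc_per hf hW (vol_ne_top hf hv) hR⟩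
  · exact ⟨W, hW, heq.symm, le_rfl⟩

theorem sphere_haus (n : ℕ) : ∃ C : ℝ≥0, ∀ (x : EE n) (r : ℝ), 0 ≤ r →
    μH[n] (sphere x r) ≤ C * ofReal r ^ n := by
  obtain ⟨C, hC⟩ := slice_unw n
  obtain ⟨G, hGm, hG, hGi⟩ := hC 0 (ball 0 2)
  have hfin : ∫⁻ r, G r ≠ ⊤ :=
    ne_top_of_le_ne_top (ENNReal.mul_ne_top (by simp) measure_ball_lt_top.ne) hGi
  obtain ⟨r1, hr1, hr1f⟩ : ∃ r1 : ℝ, r1 ∈ Ioo (1:ℝ) 2 ∧ G r1 < ⊤ := by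
    have h1 := ae_lt_top hGm hfin
    have h2 : (ae (volume.restrict (Ioo (1:ℝ) 2))).NeBot := by
      rw [ae_neBot]; simp
    obtain ⟨r, hr, hr2⟩ := ((ae_restrict_of_ae (s := Ioo (1:ℝ) 2) h1).and (ae_restrict_mem measurableSet_Ioo)).exists
    exact ⟨r, hr2, hr⟩
  have hs1 : μH[n] (sphere (0 : EE n) r1) ≠ ⊤ := by
    refine ne_top_of_le_ne_top hr1f.ne ((measure_mono ?_).trans (hG r1))
    intro y hy
    refine ⟨?_, hy⟩
    rw [mem_sphere_zero_iff_norm] at hy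
    rw [mem_ball_zero_iff, hy]; exact hr1.2
  refine ⟨(μH[n] (sphere (0 : EE n) r1)).toNNReal, fun x r hr => ?_⟩
  rw [ENNReal.coe_toNNReal hs1]
  have hlip : LipschitzWith r.toNNReal (fun y : EE n => x + (r / r1) • y) := by
    refine LipschitzWith.of_dist_le_mul fun y z => ?_
    rw [dist_add_left, dist_smul₀, Real.norm_eq_abs, abs_of_nonneg (div_nonneg hr (by linarith [hr1.1])),
      Real.coe_toNNReal _ hr]
    gcongr
    exact div_le_self hr hr1.1.le
  have hsub : sphere x r ⊆ (fun y : EE n => x + (r / r1) • y) '' sphere 0 r1 := by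
    intro y hy
    have h1 : 0 < r1 := by linarith [hr1.1]
    rw [mem_sphere_iff_norm] at hy
    rcases hr.lt_or_eq with h | h
    · refine ⟨(r1 / r) • (y - x), ?_, ?_⟩
      · rw [mem_sphere_zero_iff_norm, norm_smul, hy, Real.norm_eq_abs, abs_of_pos (by positivity)]
        field_simp
      · simp only [smul_smul]
        rw [show r / r1 * (r1 / r) = 1 by field_simp]; simp
    · rw [← h, norm_eq_zero, sub_eq_zero] at hy
      obtain ⟨z, hz⟩ := NormedSpace.sphere_nonempty (E := EE n) (x := 0) (r := r1) |>.2 h1.le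
      exact ⟨z, hz, by simp [← h, hy]⟩
  refine (measure_mono hsub).trans ((hlip.hausdorffMeasure_image_le (by positivity) _).trans_eq ?_)
  rw [mul_comm, ENNReal.rpow_natCast]; rfl

theorem wvol_ball_ne_top (hf : GoodF f) (x : EE n) (r : ℝ) :
    wvol f (ball x r) ≠ ⊤ := by
  have h1 : IntegrableOn f (closedBall x r) volume :=
    hf.cont.continuousOn.integrableOn_compact (isCompact_closedBall x r)
  refine ne_top_of_le_ne_top h1.lintegral_lt_top.ne (wvol_mono ball_subset_closedBall)

theorem exists_finite_comp (hf : GoodF f) {V : EN} (hV : 0 < V)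
    (hVt : V ≠ ⊤) : ∃ U, IsOpen U ∧ wvol f U = V ∧ wper f U ≠ ⊤ := by
  obtain ⟨R, hR, hRV⟩ : ∃ R : ℝ, 0 < R ∧ V ≤ wvol f (ball 0 R) := by
    have h1 : Tendsto (fun k : ℕ => volume (ball (0 : EE n) (k:ℝ))) atTop
        (𝓝 (volume (⋃ k : ℕ, ball (0 : EE n) (k:ℝ)))) :=
      tendsto_measure_iUnion_atTop fun a b hab => ball_subset_ball (by exact_mod_cast hab)
    rw [iUnion_ball_nat, measure_univ_of_isAddLeftInvariant] at h1
    have hlt : V / ofReal (f 0) < ⊤ :=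
      (ENNReal.div_lt_top hVt (by simpa using hf.pos 0))
    obtain ⟨k, hk, hk0⟩ := ((h1.eventually (lt_mem_nhds hlt)).and (eventually_gt_atTop 0)).exists
    refine ⟨k, by exact_mod_cast hk0, le_trans ?_ (vol_le_wvol hf _)⟩
    rw [mul_comm]
    exact (ENNReal.div_le_iff (by simpa using hf.pos 0) (by simp)).1 hk.le
  obtain ⟨U, hU, hUV, hUp⟩ := shrink_vol hf isOpen_ball (wvol_ball_ne_top hf 0 R) hV hRV
  refine ⟨U, hU, hUV, ne_top_of_le_ne_top ?_ hUp⟩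
  unfold wper
  obtain ⟨C, hC⟩ := sphere_haus n
  obtain ⟨z, hz⟩ := NormedSpace.sphere_nonempty (E := EE n) (x := 0) (r := R) |>.2 hR.le
  rw [mem_sphere_zero_iff_norm] at hz
  have h2 : ∫⁻ x in frontier (ball 0 R), ofReal (f x) ∂Hm ≤
      ∫⁻ x in sphere (0 : EE n) R, ofReal (f z) ∂Hm :=
    (lintegral_mono_set frontier_ball_subset_sphere).trans
      (setLIntegral_mono measurable_const fun x hx => ENNReal.ofReal_le_ofReal (hf.mono _ _ (by
        rw [mem_sphere_zero_iff_norm] at hx; rw [hx, hz])))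
  rw [setLIntegral_const] at h2
  refine ne_top_of_le_ne_top (ENNReal.mul_ne_top (by simp) ?_) h2
  exact ne_top_of_le_ne_top (ENNReal.mul_ne_top (by simp) (by simp)) (hC 0 R hR.le)

theorem slice_countable {A : Set (EE n)} (hA : Hm A ≠ ⊤) (x : EE n) :
    Set.Countable {r : ℝ | 0 < Hm (A ∩ sphere x r)} := by
  have : IsFiniteMeasure ((Hm : Measure (EE n)).restrict A) :=
    ⟨by rw [Measure.restrict_apply_univ]; exact hA.lt_top⟩
  have h := Measure.countable_meas_level_set_pos (μ := (Hm : Measure (EE n)).restrict A)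
    (g := fun y => dist y x) (by fun_prop)
  refine h.mono fun r hr => ?_
  have : {a | dist a x = r} = sphere x r := rfl
  simp only [mem_ofPred_eq] at hr ⊢
  rw [this, Measure.restrict_apply isClosed_sphere.measurableSet, inter_comm]
  exact hr

theorem good_slice {S : Set ℝ} (hS : S.Countable) {a b : ℝ} (hab : a < b) {G : ℝ → EN}
    (hG : Measurable G) : ∃ r ∈ Ioo a b, r ∉ S ∧ G r ≤ (∫⁻ t, G t) / ofReal (b - a) := by
  have h0 : (volume.restrict (Ioo a b)) ≠ 0 := by
    simp [Measure.restrict_eq_zero, hab]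
  have hN : (volume.restrict (Ioo a b)) (S ∪ (Ioo a b)ᶜ) = 0 := by
    refine measure_union_null ?_ ?_
    · exact Measure.absolutelyContinuous_restrict (hS.measure_zero _)
    · rw [Measure.restrict_apply measurableSet_Ioo.compl]; simp
  obtain ⟨r, hr, hle⟩ := exists_notMem_null_le_laverage h0 hG.aemeasurable hN
  simp only [mem_union, mem_compl_iff, not_or, not_not] at hr
  refine ⟨r, hr.2, hr.1, hle.trans ?_⟩
  rw [laverage_eq, Measure.restrict_apply_univ, Real.volume_Ioo]
  exact ENNReal.div_le_div_right (setLIntegral_le_lintegral _ _) _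

theorem iter_zero (hn : 1 ≤ n) {v : ℝ → EN} {a b A : ℝ} (hab : a < b) (hA : 0 < A)
    (hmono : ∀ s t, s ≤ t → v s ≤ v t)
    (h : ∀ s t, a ≤ s → s < t → t ≤ b → v s ^ n ≤ (ofReal (A / (t - s)) * v t) ^ (n + 1))
    (hb : v b ≤ ofReal (((b - a) / (2 ^ (n + 1) * A)) ^ (n + 1))) : v a = 0 := by
  set L := (b - a) / (2 ^ (n + 1) * A) with hL
  have hba : 0 < b - a := sub_pos.2 hab
  have hLpos : 0 < L := by positivity
  have claim : ∀ k : ℕ, v (a + (b - a) / 2 ^ k) ≤ ofReal ((L / 2 ^ k) ^ (n + 1)) := by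
    intro k
    induction k with
    | zero => simpa using hb
    | succ k ih =>
      have h1 := h (a + (b - a) / 2 ^ (k + 1)) (a + (b - a) / 2 ^ k) (by
        have : 0 < (b - a) / 2 ^ (k + 1) := by positivity
        linarith) (by
        have : (b - a) / 2 ^ (k + 1) < (b - a) / 2 ^ k := by
          gcongr <;> norm_num
        linarith) (by
        have : (b - a) / 2 ^ k ≤ (b - a) := div_le_self hba.le (one_le_pow₀ (by norm_num))
        linarith)
      have e1 : a + (b - a) / 2 ^ k - (a + (b - a) / 2 ^ (k + 1)) = (b - a) / 2 ^ (k + 1) := by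
        field_simp; ring
      rw [e1] at h1
      have h2 : v (a + (b - a) / 2 ^ (k + 1)) ^ n ≤
          (ofReal ((L / 2 ^ (k + 1)) ^ (n + 1))) ^ n := by
        refine h1.trans ?_
        refine (pow_le_pow_left' (mul_le_mul' le_rfl ih) _).trans_eq ?_
        rw [← ENNReal.ofReal_mul (by positivity), ← ENNReal.ofReal_pow (by positivity),
          ← ENNReal.ofReal_pow (by positivity)]
        congr 1
        rw [← pow_mul, mul_comm (n + 1) n, pow_mul]
        congr 1
        have e2 : A / ((b - a) / 2 ^ (k + 1)) = 2 ^ (k + 1) / (L * 2 ^ (n + 1)) := by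
          rw [hL]; field_simp
        rw [e2]
        clear_value L
        rw [div_pow, div_pow, pow_succ (2:ℝ) k, pow_succ (2:ℝ) n, mul_pow]
        have hq : (2:ℝ) ^ k ≠ 0 := by positivity
        generalize (2:ℝ) ^ k = q at hq ⊢
        field_simp
        ring
      exact (ENNReal.pow_le_pow_left_iff (by omega)).1 h2
  have ht : Tendsto (fun k : ℕ => ofReal ((L / 2 ^ k) ^ (n + 1))) atTop (𝓝 0) := by
    have h3 : Tendsto (fun k : ℕ => (L / 2 ^ k) ^ (n + 1)) atTop (𝓝 0) := by
      have h4 : Tendsto (fun k : ℕ => L / (2:ℝ) ^ k) atTop (𝓝 0) :=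
        tendsto_const_nhds.div_atTop (tendsto_pow_atTop_atTop_of_one_lt (by norm_num))
      simpa using h4.pow (n + 1)
    simpa using ENNReal.tendsto_ofReal h3
  have h5 : v a ≤ 0 := ge_of_tendsto' ht fun k => (hmono _ _ (by
    have : 0 < (b - a) / 2 ^ k := by positivity
    linarith)).trans (claim k)
  simpa using h5

theorem isopW (hn : 1 ≤ n) : ∃ C : ℝ≥0, 0 < C ∧ ∀ f : EE n → ℝ, GoodF f → ∀ (G : Set (EE n)) (c : EN),
    IsOpen G → wvol f G ≠ ⊤ → (∀ x ∈ G, c ≤ ofReal (f x)) →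
    c * wvol f G ^ n ≤ (C * wper f G) ^ (n + 1) := by
  obtain ⟨C, hC⟩ := isop_weighted n hn
  refine ⟨C + 1, by positivity, fun f hf G c hG hv hc => ?_⟩
  have hn0 : (0:ℝ) < n := by exact_mod_cast hn
  have h1 := hC (fun x => ofReal (f x)) hf.meas (by simp)
    (fun x y h => ENNReal.ofReal_le_ofReal (hf.mono x y h)) G hG hv
  have h2 : c ^ (1 / (n:ℝ)) * wvol f G ≤ ∫⁻ x in G, ofReal (f x) ^ (((n:ℝ) + 1) / n) := by
    unfold wvol
    rw [← lintegral_const_mul _ hf.meas]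
    refine setLIntegral_mono (hf.meas.pow_const _) fun x hx => ?_
    have hp : 0 < ofReal (f x) := by simpa using hf.pos x
    rw [show ((n:ℝ) + 1) / n = 1 / n + 1 by field_simp; ring, ENNReal.rpow_add _ _ hp.ne' (by simp),
      ENNReal.rpow_one]
    gcongr
    exact hc x hx
  have h3 := pow_le_pow_left' (h2.trans h1) n
  rw [mul_pow, ← ENNReal.rpow_natCast, ← ENNReal.rpow_mul, one_div_mul_cancel hn0.ne',
    ENNReal.rpow_one, ← ENNReal.rpow_natCast (_ ^ (((n:ℝ) + 1) / n)), ← ENNReal.rpow_mul, div_mul_cancel₀ _ hn0.ne'] at h3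
  refine h3.trans ?_
  rw [← ENNReal.rpow_natCast]
  push_cast
  gcongr
  · simp
  · exact le_rfl

section frontiers
variable {Y : Type*} [NormedAddCommGroup Y]

theorem fr_inter_ball {U : Set Y} (hU : IsOpen U) (x : Y) (r : ℝ) :
    frontier (U ∩ ball x r) ⊆ (frontier U ∩ closedBall x r) ∪ (U ∩ sphere x r) := by
  intro y hy
  rcases frontier_inter_subset _ _ hy with h | h
  · exact Or.inl ⟨h.1, closure_ball_subset_closedBall h.2⟩
  · have hs := frontier_ball_subset_sphere h.2
    by_cases hyU : y ∈ U
    · exact Or.inr ⟨hyU, hs⟩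
    · exact Or.inl ⟨⟨h.1, by rwa [hU.interior_eq]⟩, sphere_subset_closedBall hs⟩

theorem fr_diff_ball {U : Set Y} (hU : IsOpen U) (x : Y) (r : ℝ) :
    frontier (U \ closedBall x r) ⊆ (frontier U \ ball x r) ∪ (U ∩ sphere x r) := by
  intro y hy
  have hc : y ∉ ball x r := by
    have : closure (U \ closedBall x r) ⊆ (ball x r)ᶜ :=
      closure_minimal (fun z hz => fun h => hz.2 (ball_subset_closedBall h)) isOpen_ball.isClosed_compl
    exact this hy.1
  have hcl : y ∈ closure U := closure_mono sdiff_subset hy.1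
  by_cases hyU : y ∈ U
  · refine Or.inr ⟨hyU, ?_⟩
    by_contra hs
    have hout : y ∈ U \ closedBall x r := ⟨hyU, fun h => by
      rcases (mem_closedBall.1 h).lt_or_eq with h1 | h1
      · exact hc h1
      · exact hs h1⟩
    have hop : IsOpen (U \ closedBall x r) := hU.sdiff isClosed_closedBall
    exact hy.2 (by rwa [hop.interior_eq])
  · exact Or.inl ⟨⟨hcl, by rwa [hU.interior_eq]⟩, hc⟩

theorem fr_union_ball {U : Set Y} (hU : IsOpen U) (x : Y) (r : ℝ) :
    frontier (U ∪ ball x r) ⊆ (frontier U \ ball x r) ∪ (sphere x r \ closure U) := by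
  intro y hy
  have hop : IsOpen (U ∪ ball x r) := hU.union isOpen_ball
  have hy2 : y ∉ U ∪ ball x r := by have := hy.2; rwa [hop.interior_eq] at this
  have hb : y ∉ ball x r := fun h => hy2 (Or.inr h)
  have hyU : y ∉ U := fun h => hy2 (Or.inl h)
  by_cases hcl : y ∈ closure U
  · exact Or.inl ⟨⟨hcl, by rwa [hU.interior_eq]⟩, hb⟩
  · refine Or.inr ⟨?_, hcl⟩
    have h1 := hy.1
    rw [closure_union] at h1
    rcases h1 with h1 | h1
    · exact absurd h1 hcl
    · have := closure_ball_subset_closedBall h1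
      rcases (mem_closedBall.1 this).lt_or_eq with h2 | h2
      · exact absurd h2 hb
      · exact h2
end frontiers

theorem vol_ball (x : EE n) {r : ℝ} (hr : 0 ≤ r) :
    volume (ball x r) = ofReal r ^ (n + 1) * volume (ball (0 : EE n) 1) := by
  rw [Measure.addHaar_ball volume x hr, finrank_euclideanSpace_fin, ENNReal.ofReal_pow hr]

theorem wvol_tail {Ω : Set (EE n)} (hv : wvol f Ω ≠ ⊤)
    :
    Tendsto (fun r : ℝ => wvol f (Ω \ closedBall 0 r)) atTop (𝓝 0) := by
  set ν := (volume.restrict Ω).withDensity (fun x => ofReal (f x)) with hν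
  have hνm : ∀ A, MeasurableSet A → ν A = wvol f (A ∩ Ω) := by
    intro A hA
    rw [hν, withDensity_apply _ hA, Measure.restrict_restrict hA]; rfl
  have hfin : IsFiniteMeasure ν := ⟨by
    rw [hνm _ MeasurableSet.univ, univ_inter]; exact hv.lt_top⟩
  have h := tendsto_measure_iInter_atTop (μ := ν) (s := fun r : ℝ => (closedBall (0 : EE n) r)ᶜ)
    (fun r => measurableSet_closedBall.compl.nullMeasurableSet)
    (fun a b hab => compl_subset_compl.2 (closedBall_subset_closedBall hab)) ⟨0, measure_ne_top _ _⟩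
  have he : (⋂ r : ℝ, (closedBall (0 : EE n) r)ᶜ) = ∅ := by
    ext x; simp only [mem_iInter, mem_compl_iff, mem_closedBall_zero_iff, mem_empty_iff_false,
      iff_false, not_forall, not_not]
    exact ⟨‖x‖, le_rfl⟩
  rw [he, measure_empty] at h
  refine h.congr fun r => ?_
  rw [Function.comp_apply, hνm _ measurableSet_closedBall.compl, inter_comm]; rfl

theorem exists_exterior (hf : GoodF f) {Ω : Set (EE n)}
    (hv : wvol f Ω ≠ ⊤) (hp : wper f Ω ≠ ⊤) :
    ∃ (p : EE n) (ρ : ℝ), 0 < ρ ∧ ∀ y ∈ ball p ρ, y ∉ closure Ω := by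
  have h1 : volume (closure Ω) ≠ ⊤ := by
    refine ne_top_of_le_ne_top ?_ (measure_mono (closure_eq_self_union_frontier Ω).subset)
    refine ne_top_of_le_ne_top ?_ (measure_union_le _ _)
    rw [vol_null_of_haus n _ (haus_ne_top hf hp), add_zero]
    exact vol_ne_top hf hv
  have h2 : closure Ω ≠ univ := by
    intro h; rw [h, measure_univ_of_isAddLeftInvariant] at h1; exact h1 rfl
  obtain ⟨p, hpn⟩ := (ne_univ_iff_exists_notMem _).1 h2
  obtain ⟨ρ, hρ, hsub⟩ := Metric.isOpen_iff.1 isClosed_closure.isOpen_compl p hpn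
  exact ⟨p, ρ, hρ, fun y hy => hsub hy⟩

theorem part2_core (hn : 1 ≤ n) (hf : GoodF f) {V : EN} (hV : 0 < V)
    (hVt : V ≠ ⊤) {Ω : Set (EE n)} (hΩ : IsIsopRegion f Ω V) :
    wper f Ω ≠ ⊤ ∧ ∃ (R0 : ℝ) (A : ℝ≥0), ∀ r, R0 ≤ r → Hm (frontier Ω ∩ sphere 0 r) = 0 →
      wvol f (Ω \ closedBall 0 r) ^ n ≤
        (A * ∫⁻ x in Ω ∩ sphere 0 r, ofReal (f x) ∂Hm) ^ (n + 1) := by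
  obtain ⟨hop, hvol, hmin⟩ := hΩ
  have hper : wper f Ω ≠ ⊤ := by
    obtain ⟨U, hU, hUV, hUp⟩ := exists_finite_comp hf hV hVt
    exact ne_top_of_le_ne_top hUp (hmin U hU hUV)
  refine ⟨hper, ?_⟩
  have hvt : wvol f Ω ≠ ⊤ := hvol ▸ hVt
  have hmin2 : ∀ W, IsOpen W → wvol f W ≠ ⊤ → V ≤ wvol f W → wper f Ω ≤ wper f W := by
    intro W hW hWt hle
    obtain ⟨U, hU, hUV, hUp⟩ := shrink_vol hf hW hWt hV hle
    exact (hmin U hU hUV).trans hUp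
  obtain ⟨p, ρ0, hρ0, hext⟩ := exists_exterior hf hvt hper
  obtain ⟨C1, hC1, hisop⟩ := isopW hn
  obtain ⟨C2, hsph⟩ := sphere_haus n
  obtain ⟨F, hF⟩ : ∃ F : ℝ, ∀ y ∈ closedBall p ρ0, f y ≤ F := by
    obtain ⟨F, hF⟩ := (isCompact_closedBall p ρ0).bddAbove_image hf.cont.continuousOn
    exact ⟨F, fun y hy => hF ⟨y, hy, rfl⟩⟩
  set c0 := ofReal (f 0) * volume (ball (0 : EE n) 1) with hc0
  have hc0pos : c0 ≠ 0 := mul_ne_zero (by simpa using hf.pos 0) (measure_ball_pos _ _ one_pos).ne'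
  have hc0t : c0 ≠ ⊤ := ENNReal.mul_ne_top (by simp) measure_ball_lt_top.ne
  set K : EN := ofReal F * C2 with hK
  have hKt : K ≠ ⊤ := ENNReal.mul_ne_top (by simp) (by simp)
  obtain ⟨T, hT1, hT⟩ : ∃ T : ℝ≥0, 1 ≤ T ∧ (2 * C1 * K) ^ (n + 1) < T * c0 ^ n := by
    have h1 : (2 * C1 * K) ^ (n + 1) / c0 ^ n < ⊤ :=
      ENNReal.div_lt_top (ENNReal.pow_ne_top (ENNReal.mul_ne_top (by simp [ENNReal.mul_ne_top]) hKt))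
        (pow_ne_zero _ hc0pos)
    obtain ⟨T, hT, _⟩ := ENNReal.lt_iff_exists_nnreal_btwn.1 h1
    refine ⟨max T 1, le_max_right _ _, ?_⟩
    rw [ENNReal.div_lt_iff (Or.inl (pow_ne_zero _ hc0pos)) (Or.inl (ENNReal.pow_ne_top hc0t))] at hT
    refine hT.trans_le (mul_le_mul' ?_ le_rfl)
    exact_mod_cast le_max_left _ _
  obtain ⟨R1, hR1⟩ : ∃ R1 : ℝ, ∀ x : EE n, R1 < ‖x‖ → (T : ℝ) ≤ f x := by
    have h1 := hf.tends.eventually (eventually_ge_atTop (T : ℝ))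
    obtain ⟨R, -, hR⟩ := (hasBasis_cobounded_norm (E := EE n)).eventually_iff.1 h1
    exact ⟨R, fun x hx => hR (show R ≤ ‖x‖ from hx.le)⟩
  have hbig : ∀ᶠ r in atTop, wvol f (Ω \ closedBall 0 r) ≤ c0 * ofReal ρ0 ^ (n + 1) :=
    (wvol_tail hvt).eventually (Iic_mem_nhds (by
      refine ENNReal.mul_pos hc0pos (pow_ne_zero _ (by simpa using hρ0))))
  obtain ⟨R2, hR2⟩ := eventually_atTop.1 hbig
  refine ⟨max R1 R2, 4 * C1, fun r hr hnull => ?_⟩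
  set g := ∫⁻ x in Ω ∩ sphere 0 r, ofReal (f x) ∂Hm with hg
  set v := wvol f (Ω \ closedBall 0 r) with hvdef
  have hvle := hR2 r ((le_max_right _ _).trans hr)
  rw [← hvdef] at hvle
  by_cases hv0 : v = 0
  · rw [hv0, zero_pow (by omega)]; exact zero_le
  have hvfin : v ≠ ⊤ := ne_top_of_le_ne_top hvt (wvol_mono sdiff_subset)
  have hN0 : ((n:ℝ) + 1) ≠ 0 := by positivity
  obtain ⟨ρ, hρpos, hρle, hρv⟩ : ∃ ρ : ℝ, 0 < ρ ∧ ρ ≤ ρ0 ∧ c0 * ofReal ρ ^ (n + 1) = v := by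
    set q := (v / c0) ^ (1 / ((n:ℝ) + 1)) with hq
    have hq0 : q ≠ 0 := by
      simp only [hq, ne_eq, ENNReal.rpow_eq_zero_iff, not_or, not_and]
      refine ⟨fun h => ?_, fun h => ?_⟩
      · exact absurd h (ENNReal.div_ne_zero.2 ⟨hv0, hc0t⟩)
      · exact absurd h (ENNReal.div_lt_top hvfin hc0pos).ne
    have hqt : q ≠ ⊤ := by
      refine ENNReal.rpow_ne_top_of_nonneg (by positivity) (ENNReal.div_lt_top hvfin hc0pos).ne
    have hqN : q ^ (n + 1) = v / c0 := by
      rw [hq, ← ENNReal.rpow_natCast, ← ENNReal.rpow_mul]; push_cast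
      rw [one_div_mul_cancel hN0, ENNReal.rpow_one]
    have hqv : c0 * q ^ (n + 1) = v := by rw [hqN, ENNReal.mul_div_cancel hc0pos hc0t]
    refine ⟨q.toReal, ENNReal.toReal_pos hq0 hqt, ?_, by rw [ENNReal.ofReal_toReal hqt, hqv]⟩
    refine ENNReal.toReal_le_of_le_ofReal hρ0.le ?_
    rw [← hqv, ENNReal.mul_le_mul_iff_right hc0pos hc0t] at hvle
    exact (ENNReal.pow_le_pow_left_iff (by omega)).1 hvle
  set q := ofReal ρ with hq
  have hdisj : Disjoint (Ω ∩ ball 0 r) (ball p ρ) := by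
    rw [Set.disjoint_left]
    intro y hy hy2
    exact hext y (ball_subset_ball hρle hy2) (subset_closure hy.1)
  have hWv : wvol f ((Ω ∩ ball 0 r) ∪ ball p ρ) = wvol f (Ω ∩ ball 0 r) + wvol f (ball p ρ) :=
    lintegral_union measurableSet_ball hdisj
  have hWge : V ≤ wvol f ((Ω ∩ ball 0 r) ∪ ball p ρ) := by
    rw [hWv, ← hvol]
    have h1 : wvol f Ω ≤ wvol f (Ω ∩ ball 0 r) + (wvol f (sphere 0 r) + v) := by
      refine le_trans (wvol_mono (B := (Ω ∩ ball 0 r) ∪ (sphere 0 r ∪ (Ω \ closedBall 0 r))) ?_)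
        ((lintegral_union_le _ _ _).trans (add_le_add le_rfl (lintegral_union_le _ _ _)))
      intro y hy
      rcases lt_trichotomy (dist y 0) r with h | h | h
      · exact Or.inl ⟨hy, h⟩
      · exact Or.inr (Or.inl h)
      · exact Or.inr (Or.inr ⟨hy, fun h2 => absurd (mem_closedBall.1 h2) (not_le.2 h)⟩)
    have h2 : wvol f (sphere (0 : EE n) r) = 0 :=
      setLIntegral_measure_zero _ _ (Measure.addHaar_sphere _ _ _)
    rw [h2, zero_add] at h1
    refine h1.trans (add_le_add le_rfl ?_)
    rw [← hρv]
    refine le_trans (le_of_eq ?_) (vol_le_wvol hf _)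
    rw [vol_ball p hρpos.le, hc0]; ring
  have hWt : wvol f ((Ω ∩ ball 0 r) ∪ ball p ρ) ≠ ⊤ := by
    rw [hWv]
    exact ENNReal.add_ne_top.2 ⟨ne_top_of_le_ne_top hvt (wvol_mono inter_subset_left),
      wvol_ball_ne_top hf _ _⟩
  have hcmp := hmin2 _ ((hop.inter isOpen_ball).union isOpen_ball) hWt hWge
  have hWper : wper f ((Ω ∩ ball 0 r) ∪ ball p ρ) ≤
      (∫⁻ x in frontier Ω ∩ ball 0 r, ofReal (f x) ∂Hm) + (g + K * q ^ n) := by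
    have hsub : frontier ((Ω ∩ ball 0 r) ∪ ball p ρ) ⊆ (frontier Ω ∩ ball 0 r) ∪
        (((frontier Ω ∩ sphere 0 r) ∪ (Ω ∩ sphere 0 r)) ∪ sphere p ρ) := by
      intro y hy
      rcases fr_union_ball (hop.inter isOpen_ball) p ρ hy with h | h
      · rcases fr_inter_ball hop 0 r h.1 with h2 | h2
        · rcases (mem_closedBall.1 h2.2).lt_or_eq with h3 | h3
          · exact Or.inl ⟨h2.1, h3⟩
          · exact Or.inr (Or.inl (Or.inl ⟨h2.1, h3⟩))
        · exact Or.inr (Or.inl (Or.inr h2))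
      · exact Or.inr (Or.inr h.1)
    refine (lintegral_mono_set hsub).trans ((lintegral_union_le _ _ _).trans
      (add_le_add le_rfl ((lintegral_union_le _ _ _).trans (add_le_add ?_ ?_))))
    · refine (lintegral_union_le _ _ _).trans ?_
      rw [setLIntegral_measure_zero _ _ hnull, zero_add]
    · refine (setLIntegral_mono measurable_const fun x hx => ENNReal.ofReal_le_ofReal (hF x
        (closedBall_subset_closedBall hρle (sphere_subset_closedBall hx)))).trans ?_
      rw [setLIntegral_const, hK, mul_assoc]
      exact mul_le_mul' le_rfl (hsph p ρ hρpos.le)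
  have hsplit : wper f Ω = (∫⁻ x in frontier Ω ∩ ball 0 r, ofReal (f x) ∂Hm) +
      ∫⁻ x in frontier Ω \ ball 0 r, ofReal (f x) ∂Hm :=
    (lintegral_inter_add_sdiff _ _ measurableSet_ball).symm
  have hout : ∫⁻ x in frontier Ω \ ball 0 r, ofReal (f x) ∂Hm ≤ g + K * q ^ n := by
    have h1 := hcmp.trans hWper
    rw [hsplit] at h1
    refine (ENNReal.add_le_add_iff_left ?_).1 h1
    exact ne_top_of_le_ne_top hper (lintegral_mono_set inter_subset_left)
  have hGper : wper f (Ω \ closedBall 0 r) ≤ 2 * g + K * q ^ n := by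
    refine (lintegral_mono_set (fr_diff_ball hop 0 r)).trans ((lintegral_union_le _ _ _).trans ?_)
    refine (add_le_add hout le_rfl).trans_eq ?_
    ring
  have hI := hisop f hf (Ω \ closedBall 0 r) T (hop.sdiff isClosed_closedBall)
    hvfin (fun x hx => by
      have : R1 < ‖x‖ := by
        have := hx.2; rw [mem_closedBall_zero_iff, not_le] at this
        exact ((le_max_left _ _).trans hr).trans_lt this
      rw [← ENNReal.ofReal_coe_nnreal]
      exact ENNReal.ofReal_le_ofReal (hR1 x this))
  rw [← hvdef] at hI
  have hI2 := hI.trans (pow_le_pow_left' (mul_le_mul' le_rfl hGper) _)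
  have hq0 : q ≠ 0 := by simpa [hq] using hρpos
  rcases le_or_gt (2 * g) (K * q ^ n) with hcase | hcase
  · exfalso
    have h1 : T * c0 ^ n * (q ^ (n + 1)) ^ n ≤ (2 * C1 * K) ^ (n + 1) * (q ^ (n + 1)) ^ n := by
      calc T * c0 ^ n * (q ^ (n + 1)) ^ n = T * v ^ n := by rw [← hρv, mul_pow]; ring
        _ ≤ (C1 * (2 * g + K * q ^ n)) ^ (n + 1) := hI2
        _ ≤ (C1 * (K * q ^ n + K * q ^ n)) ^ (n + 1) := by gcongr
        _ = (2 * C1 * K) ^ (n + 1) * (q ^ (n + 1)) ^ n := by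
          rw [← two_mul, ← pow_mul, mul_comm (n + 1) n, pow_mul, ← mul_pow]; congr 1; ring
    rw [ENNReal.mul_le_mul_iff_left (by positivity) (by simp [hq])] at h1
    exact absurd h1 (not_le.2 hT)
  · calc v ^ n = 1 * v ^ n := (one_mul _).symm
      _ ≤ T * v ^ n := mul_le_mul' (by exact_mod_cast hT1) le_rfl
      _ ≤ _ := hI2
      _ ≤ (C1 * (2 * g + 2 * g)) ^ (n + 1) := by gcongr
      _ = _ := by congr 1; push_cast; ring

theorem part2 (hn : 1 ≤ n) (hf : GoodF f) {V : EN} (hV : 0 < V)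
    (hVt : V ≠ ⊤) {Ω : Set (EE n)} (hΩ : IsIsopRegion f Ω V) : Bornology.IsBounded Ω := by
  obtain ⟨hper, R0, A, hA⟩ := part2_core hn hf hV hVt hΩ
  obtain ⟨hop, hvol, -⟩ := hΩ
  have hvt : wvol f Ω ≠ ⊤ := hvol ▸ hVt
  obtain ⟨C, hC⟩ := slice_weighted n
  set B : ℝ := A * C + 1 with hB
  have hBpos : 0 < B := by positivity
  have htail := (wvol_tail hvt).eventually (Iic_mem_nhds (show (0:EN) <
    ofReal ((1 / (2 ^ (n + 1) * B)) ^ (n + 1)) by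
      rw [ENNReal.ofReal_pos]; positivity))
  obtain ⟨R, hR, hRR⟩ := (htail.and (eventually_ge_atTop R0)).exists
  have hz := iter_zero hn (v := fun t => wvol f (Ω \ closedBall 0 (-t))) (a := -(R + 1)) (b := -R)
    (A := B) (by linarith) hBpos
    (fun s t hst => wvol_mono (sdiff_subset_sdiff_right (closedBall_subset_closedBall (by linarith))))
    (by
      intro s t hs hst ht
      obtain ⟨G, hGm, hG, hGi⟩ := hC 0 (Ω \ closedBall 0 (-t)) (fun x => ofReal (f x))
        (hop.measurableSet.diff measurableSet_closedBall) hf.meas (by simp)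
      obtain ⟨r, hr, hrn, hrG⟩ := good_slice (slice_countable (haus_ne_top hf hper) 0)
        (show -t < -s by linarith) hGm
      have h0 : Hm (frontier Ω ∩ sphere 0 r) = 0 := by simpa using hrn
      have h1 := hA r (by linarith [hr.1]) h0
      have h2 : Ω ∩ sphere 0 r = (Ω \ closedBall 0 (-t)) ∩ sphere 0 r := by
        ext y
        simp only [mem_inter_iff, Set.mem_sdiff, mem_sphere_iff_norm, mem_closedBall_zero_iff, sub_zero]
        constructor
        · rintro ⟨h3, h4⟩; exact ⟨⟨h3, by rw [h4]; exact not_le.2 hr.1⟩, h4⟩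
        · rintro ⟨⟨h3, _⟩, h4⟩; exact ⟨h3, h4⟩
      rw [h2] at h1
      refine le_trans (pow_le_pow_left' (wvol_mono (sdiff_subset_sdiff_right
        (closedBall_subset_closedBall hr.2.le))) n) (h1.trans (pow_le_pow_left' ?_ _))
      have hts : 0 < t - s := by linarith
      calc A * ∫⁻ x in (Ω \ closedBall 0 (-t)) ∩ sphere 0 r, ofReal (f x) ∂Hm
          ≤ A * ((C * wvol f (Ω \ closedBall 0 (-t))) / ofReal (-s - -t)) := by
            refine mul_le_mul' le_rfl ((hG r).trans (hrG.trans ?_))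
            exact ENNReal.div_le_div_right hGi _
        _ = (A * C / ofReal (t - s)) * wvol f (Ω \ closedBall 0 (-t)) := by
            rw [show -s - -t = t - s by ring]; simp only [div_eq_mul_inv]; ring
        _ ≤ _ := by
            refine mul_le_mul' ?_ le_rfl
            rw [ENNReal.ofReal_div_of_pos hts]
            refine ENNReal.div_le_div_right ?_ _
            rw [hB, ENNReal.ofReal_add (by positivity) zero_le_one, ENNReal.ofReal_mul (by positivity)]
            simp)
    (by
      simp only [neg_neg]
      rw [show -R - -(R + 1) = 1 by ring]
      exact hR)
  simp only [neg_neg] at hz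
  refine (isBounded_closedBall (x := (0 : EE n)) (r := R + 1)).subset ?_
  have ho : IsOpen (Ω \ closedBall 0 (R + 1)) := hop.sdiff isClosed_closedBall
  have hvz : volume (Ω \ closedBall 0 (R + 1)) = 0 := by
    have := vol_le_wvol hf (Ω \ closedBall 0 (R + 1))
    rw [hz] at this
    rcases mul_eq_zero.1 (le_antisymm this zero_le) with h | h
    · simp at h; exact absurd h (not_le.2 (hf.pos 0))
    · exact h
  rw [ho.measure_eq_zero_iff volume, sdiff_eq_empty] at hvz
  exact hvz

theorem pairs (n : ℕ) : ∃ C : ℝ≥0, ∀ (U Q : Set (EE n)) (d : ℝ), 0 < d → IsOpen U → MeasurableSet Q →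
    Convex ℝ Q → (∀ x ∈ Q, ∀ y ∈ Q, dist x y ≤ d) →
    volume (U ∩ Q) * volume (Q \ U) ≤ C * ofReal d ^ (n + 2) * μH[n] (frontier U ∩ Q) := by
  obtain ⟨C, hC⟩ := sw_vol n
  set c := volume (ball (0 : EE n) 1)
  have hct : c ≠ ⊤ := measure_ball_lt_top.ne
  refine ⟨C * c.toNNReal, fun U Q d hd hU hQ hconv hdiam => ?_⟩
  have hA : MeasurableSet (U ∩ Q) := hU.measurableSet.inter hQ
  have hB : MeasurableSet (Q \ U) := hQ.diff hU.measurableSet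
  have h1 : volume (U ∩ Q) * volume (Q \ U) = ∫⁻ h, volume ((U ∩ Q) ∩ {x | x + h ∈ Q \ U}) := by
    have hm : Measurable (fun p : EE n × EE n => (U ∩ Q).indicator (1 : EE n → EN) p.1 *
        (Q \ U).indicator 1 (p.1 + p.2)) :=
      ((measurable_one.indicator hA).comp measurable_fst).mul
        ((measurable_one.indicator hB).comp (measurable_fst.add measurable_snd))
    have e1 : ∀ h, volume ((U ∩ Q) ∩ {x | x + h ∈ Q \ U}) =
        ∫⁻ x, (U ∩ Q).indicator (1 : EE n → EN) x * (Q \ U).indicator 1 (x + h) := by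
      intro h
      rw [← lintegral_indicator_one (hA.inter (show MeasurableSet {x | x + h ∈ Q \ U} from (measurable_add_const h) hB))]
      refine lintegral_congr fun x => ?_
      generalize U ∩ Q = A
      generalize Q \ U = B
      classical
      rw [Set.indicator_apply, Set.indicator_apply, Set.indicator_apply]
      by_cases h1 : x ∈ A <;> by_cases h2 : x + h ∈ B <;> simp [h1, h2]
    simp_rw [e1]
    rw [lintegral_lintegral_swap (show AEMeasurable (Function.uncurry fun h x => (U ∩ Q).indicator (1 : EE n → EN) x *
      (Q \ U).indicator 1 (x + h)) _ from (hm.comp measurable_swap).aemeasurable)]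
    rw [← lintegral_indicator_one hA, ← lintegral_mul_const _ (measurable_one.indicator hA)]
    refine lintegral_congr fun x => ?_
    rw [lintegral_const_mul _ (show Measurable (fun y => (Q \ U).indicator (1 : EE n → EN) (x + y)) from
        (measurable_one.indicator hB).comp (measurable_const_add x)),
      lintegral_add_left_eq_self (fun y => (Q \ U).indicator (1 : EE n → EN) y) x,
      lintegral_indicator_one hB]
  rw [h1]
  have h2 : ∀ h, volume ((U ∩ Q) ∩ {x | x + h ∈ Q \ U}) ≤
      (closedBall (0 : EE n) d).indicator (fun _ => C * ofReal d * μH[n] (frontier U ∩ Q)) h := by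
    intro h
    by_cases hh : ‖h‖ ≤ d
    · rw [indicator_of_mem (by simpa using hh)]
      rcases eq_or_ne h 0 with rfl | h0
      · rw [show (U ∩ Q) ∩ {x | x + 0 ∈ Q \ U} = ∅ by
          ext x; simp only [add_zero, mem_inter_iff, mem_ofPred_eq, Set.mem_sdiff, mem_empty_iff_false]; tauto]
        simp
      · have : (U ∩ Q) ∩ {x | x + h ∈ Q \ U} ⊆ sw (-h) (frontier U ∩ Q) := by
          rintro x ⟨⟨hxU, hxQ⟩, hx2, hx3⟩
          obtain ⟨s, hs, hs2⟩ := seg_frontier hU hxU hx3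
          refine ⟨x + s • h, ⟨hs2, ?_⟩, s, hs, by simp⟩
          exact hconv.add_smul_mem hxQ hx2 hs
        refine (measure_mono this).trans ((hC (-h) _ (neg_ne_zero.2 h0)).trans ?_)
        rw [norm_neg]
        gcongr
    · rw [indicator_of_notMem (by simpa using hh)]
      rw [show (U ∩ Q) ∩ {x | x + h ∈ Q \ U} = ∅ from ?_]; · simp
      ext x
      simp only [mem_inter_iff, mem_ofPred_eq, Set.mem_sdiff, mem_empty_iff_false, iff_false]
      rintro ⟨⟨_, h1⟩, h2, _⟩
      have := hdiam _ h2 _ h1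
      rw [dist_eq_norm, add_sub_cancel_left] at this
      exact hh this
  refine (lintegral_mono h2).trans ?_
  rw [lintegral_indicator_const isClosed_closedBall.measurableSet,
    Measure.addHaar_closedBall_eq_addHaar_ball, vol_ball _ hd.le]
  apply le_of_eq
  push_cast
  rw [ENNReal.coe_toNNReal hct]
  ring

def gcell (δ : ℝ) (z : Fin (n + 1) → ℤ) : Set (EE n) := {x | ∀ i, ⌊x i / δ⌋ = z i}

theorem gcell_mem {δ : ℝ} (hδ : 0 < δ) {z : Fin (n + 1) → ℤ} {x : EE n} :
    x ∈ gcell δ z ↔ ∀ i, x i ∈ Ico (z i * δ) (z i * δ + δ) := by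
  simp only [gcell, mem_ofPred_eq, Int.floor_eq_iff, mem_Ico, le_div_iff₀ hδ, div_lt_iff₀ hδ, add_mul, one_mul]

theorem gcell_pre {δ : ℝ} (hδ : 0 < δ) (z : Fin (n + 1) → ℤ) :
    gcell δ z = (WithLp.ofLp : EE n → _) ⁻¹' (Set.pi univ fun i => Ico (z i * δ) (z i * δ + δ)) := by
  ext x; rw [gcell_mem hδ]; simp [Set.mem_pi]

theorem gcell_meas {δ : ℝ} (hδ : 0 < δ) (z : Fin (n + 1) → ℤ) : MeasurableSet (gcell δ z) := by
  rw [gcell_pre hδ]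
  exact (PiLp.volume_preserving_ofLp (Fin (n+1))).measurable (MeasurableSet.univ_pi fun i => measurableSet_Ico)

theorem gcell_vol {δ : ℝ} (hδ : 0 < δ) (z : Fin (n + 1) → ℤ) :
    volume (gcell δ z) = ofReal δ ^ (n + 1) := by
  rw [gcell_pre hδ, (PiLp.volume_preserving_ofLp (Fin (n+1))).measure_preimage
    (MeasurableSet.univ_pi fun i => measurableSet_Ico).nullMeasurableSet, Real.volume_pi_Ico]
  simp

theorem gcell_convex {δ : ℝ} (hδ : 0 < δ) (z : Fin (n + 1) → ℤ) : Convex ℝ (gcell δ z) := by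
  intro x hx y hy a b ha hb hab i
  have := fun i => convex_Ico (z i * δ) (z i * δ + δ) ((gcell_mem hδ).1 hx i) ((gcell_mem hδ).1 hy i) ha hb hab
  exact (gcell_mem hδ).2 this i

theorem gcell_dist {δ : ℝ} (hδ : 0 < δ) (z : Fin (n + 1) → ℤ) {x y : EE n}
    (hx : x ∈ gcell δ z) (hy : y ∈ gcell δ z) : dist x y ≤ (n + 1) * δ := by
  rw [EuclideanSpace.dist_eq]
  apply Real.sqrt_le_iff.2 ⟨by positivity, ?_⟩
  have : ∀ i, dist (x i) (y i) ^ 2 ≤ δ ^ 2 := by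
    intro i
    have h1 := (gcell_mem hδ).1 hx i
    have h2 := (gcell_mem hδ).1 hy i
    apply pow_le_pow_left₀ dist_nonneg
    rw [Real.dist_eq, abs_le]; constructor <;> linarith [h1.1, h1.2, h2.1, h2.2]
  calc _ ≤ ∑ i : Fin (n + 1), δ ^ 2 := Finset.sum_le_sum fun i _ => this i
    _ = (n + 1) * δ ^ 2 := by simp
    _ ≤ _ := by
      have : (0:ℝ) ≤ n := by positivity
      have h3 : (0:ℝ) ≤ δ^2 := by positivity
      nlinarith [mul_nonneg (mul_nonneg this this) h3, mul_nonneg this h3]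

theorem gcell_half (n : ℕ) : ∃ C : ℝ≥0, ∀ (U : Set (EE n)) (δ : ℝ) (z : Fin (n + 1) → ℤ), 0 < δ → IsOpen U →
    (volume (gcell δ z) < 2 * volume (U ∩ gcell δ z) →
      volume (gcell δ z \ U) ≤ C * ofReal δ * μH[n] (frontier U ∩ gcell δ z)) ∧
    (¬ volume (gcell δ z) < 2 * volume (U ∩ gcell δ z) →
      volume (U ∩ gcell δ z) ≤ C * ofReal δ * μH[n] (frontier U ∩ gcell δ z)) := by
  obtain ⟨C, hC⟩ := pairs n
  refine ⟨2 * C * (n + 1) ^ (n + 2), fun U δ z hδ hU => ?_⟩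
  have h0 := hC U (gcell δ z) ((n + 1) * δ) (by positivity) hU (gcell_meas hδ z) (gcell_convex hδ z)
    (fun x hx y hy => gcell_dist hδ z hx hy)
  have hq := gcell_vol hδ z
  set q := volume (gcell δ z)
  have hq0 : q ≠ 0 := by rw [hq]; positivity
  have hqt : q ≠ ⊤ := by rw [hq]; finiteness
  have hsum : q = volume (U ∩ gcell δ z) + volume (gcell δ z \ U) := by
    rw [inter_comm]; exact (measure_inter_add_sdiff _ hU.measurableSet).symm
  set A := volume (U ∩ gcell δ z)
  set B := volume (gcell δ z \ U)
  have hδe : ofReal ((n + 1) * δ) = (n + 1) * ofReal δ := by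
    rw [ENNReal.ofReal_mul (by positivity)]
    congr 1
    exact_mod_cast ENNReal.ofReal_natCast (n + 1)
  rw [hδe] at h0
  have key : ∀ X Y : EN, X * Y ≤ A * B → q ≤ 2 * X →
      Y ≤ ((2 * C * (n + 1) ^ (n + 2) : ℝ≥0) : EN) * ofReal δ * μH[n] (frontier U ∩ gcell δ z) := by
    intro X Y h1 h2
    rw [← ENNReal.mul_le_mul_iff_right hq0 hqt]
    calc q * Y ≤ 2 * X * Y := by gcongr
      _ = 2 * (X * Y) := by ring
      _ ≤ 2 * (A * B) := by gcongr
      _ ≤ 2 * (C * ((n + 1) * ofReal δ) ^ (n + 2) * μH[n] (frontier U ∩ gcell δ z)) := by gcongr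
      _ = _ := by rw [hq, mul_pow]; push_cast; ring
  refine ⟨fun h => key A B le_rfl h.le, fun h => key B A (mul_comm _ _).le ?_⟩
  push Not at h
  have hA : A ≠ ⊤ := fun h' => hqt (by rw [hsum, h']; simp)
  have : A ≤ B := by
    rw [hsum, two_mul] at h
    exact (ENNReal.add_le_add_iff_left hA).1 h
  calc q = A + B := hsum
    _ ≤ B + B := by gcongr
    _ = 2 * B := (two_mul _).symm

theorem grid_close (n : ℕ) : ∃ C : ℝ≥0, ∀ (U U' : Set (EE n)) (δ : ℝ) (Z : Finset (Fin (n + 1) → ℤ)), 0 < δ →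
    IsOpen U → IsOpen U' → (∀ z ∈ Z, volume (gcell δ z) < 2 * volume (U ∩ gcell δ z) ↔
      volume (gcell δ z) < 2 * volume (U' ∩ gcell δ z)) →
    volume (symmDiff U U' ∩ ⋃ z ∈ Z, gcell δ z) ≤
      C * ofReal δ * (μH[n] (frontier U) + μH[n] (frontier U')) := by
  obtain ⟨C, hC⟩ := gcell_half n
  refine ⟨C, fun U U' δ Z hδ hU hU' hpat => ?_⟩
  have hdisj : (Z : Set (Fin (n + 1) → ℤ)).PairwiseDisjoint (gcell δ : _ → Set (EE n)) := by
    intro z _ z' _ hne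
    refine Set.disjoint_left.2 fun x hx hx' => hne ?_
    ext i; rw [← hx i, hx' i]
  have hsum : ∀ A : Set (EE n), ∑ z ∈ Z, μH[n] (A ∩ gcell δ z) ≤ μH[n] A := by
    intro A
    have : ∀ z, μH[n] (A ∩ gcell δ z) = (μH[n] : Measure (EE n)).restrict A (gcell δ z) := fun z => by
      rw [Measure.restrict_apply (gcell_meas hδ z), inter_comm]
    simp_rw [this]
    rw [← measure_biUnion_finset hdisj (fun z _ => gcell_meas hδ z)]
    exact (measure_mono (subset_univ _)).trans (Measure.restrict_apply_univ _).le
  rw [inter_iUnion₂]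
  refine (measure_biUnion_finset_le Z _).trans ?_
  calc ∑ z ∈ Z, volume (symmDiff U U' ∩ gcell δ z)
      ≤ ∑ z ∈ Z, (C * ofReal δ * μH[n] (frontier U ∩ gcell δ z) +
        C * ofReal δ * μH[n] (frontier U' ∩ gcell δ z)) := by
        refine Finset.sum_le_sum fun z hz => ?_
        have h1 := hC U δ z hδ hU
        have h2 := hC U' δ z hδ hU'
        by_cases hp : volume (gcell δ z) < 2 * volume (U ∩ gcell δ z)
        · refine le_trans ?_ (add_le_add (h1.1 hp) (h2.1 ((hpat z hz).1 hp)))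
          refine (measure_mono ?_).trans (measure_union_le _ _)
          rintro x ⟨hx | hx, hx2⟩
          · exact Or.inr ⟨hx2, hx.2⟩
          · exact Or.inl ⟨hx2, hx.2⟩
        · refine le_trans ?_ (add_le_add (h1.2 hp) (h2.2 (fun h => hp ((hpat z hz).2 h))))
          refine (measure_mono ?_).trans (measure_union_le _ _)
          rintro x ⟨hx | hx, hx2⟩
          · exact Or.inl ⟨hx.1, hx2⟩
          · exact Or.inr ⟨hx.1, hx2⟩
    _ = C * ofReal δ * (∑ z ∈ Z, μH[n] (frontier U ∩ gcell δ z) + ∑ z ∈ Z, μH[n] (frontier U' ∩ gcell δ z)) := by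
        rw [Finset.sum_add_distrib, ← Finset.mul_sum, ← Finset.mul_sum, mul_add]
    _ ≤ _ := by
        gcongr
        · exact hsum _
        · exact hsum _

theorem grid_cover {δ : ℝ} (hδ : 0 < δ) (R : ℝ) : ∃ Z : Finset (Fin (n + 1) → ℤ),
    closedBall (0 : EE n) R ⊆ ⋃ z ∈ Z, gcell δ z := by
  refine ⟨Fintype.piFinset fun _ => Finset.Icc ⌊-R / δ⌋ ⌊R / δ⌋, fun x hx => ?_⟩
  refine mem_iUnion₂.2 ⟨fun i => ⌊x i / δ⌋, ?_, fun i => rfl⟩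
  rw [Fintype.mem_piFinset]
  intro i
  have h1 : |x i| ≤ R := by
    have := EuclideanSpace.norm_eq x ▸ (mem_closedBall_zero_iff.1 hx)
    have h2 := PiLp.norm_apply_le x i
    rw [Real.norm_eq_abs] at h2
    exact h2.trans (mem_closedBall_zero_iff.1 hx)
  rw [abs_le] at h1
  rw [Finset.mem_Icc]
  constructor <;> apply Int.floor_le_floor <;> gcongr
  · exact h1.1
  · exact h1.2

theorem tight (hn : 1 ≤ n) (hf : GoodF f) {V P ε : EN} (hV : V ≠ ⊤) (hP : P ≠ ⊤)
    (hε : ε ≠ 0) : ∃ R : ℝ, ∀ U : Set (EE n), IsOpen U → wvol f U ≤ V → wper f U ≤ P →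
      wvol f (U \ closedBall 0 R) ≤ ε := by
  obtain ⟨C, -, hC⟩ := isopW hn
  obtain ⟨C2, hC2⟩ := slice_weighted n
  wlog hεt : ε ≠ ⊤ generalizing ε
  · push Not at hεt
    exact ⟨0, fun U _ _ _ => by rw [hεt]; exact le_top⟩
  set K := (C * (P + C2 * V)) ^ (n + 1)
  have hK : K ≠ ⊤ := by finiteness
  obtain ⟨T, hT⟩ := ENNReal.exists_nat_mul_gt (pow_ne_zero n hε) hK
  obtain ⟨R, -, hR⟩ := (hasBasis_cobounded_norm.eventually_iff).1 (hf.tends.eventually_ge_atTop (T : ℝ))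
  refine ⟨R + 1, fun U hU h1 h2 => ?_⟩
  obtain ⟨G, hG1, hG2, hG3⟩ := hC2 0 U (fun x => ofReal (f x)) hU.measurableSet hf.meas (by simp)
  obtain ⟨r, hr, -, hr2⟩ := good_slice countable_empty (show R < R + 1 by linarith) hG1
  rw [add_sub_cancel_left, ENNReal.ofReal_one, div_one] at hr2
  have h3 : wper f (U \ closedBall 0 r) ≤ P + C2 * V := by
    refine (lintegral_mono_set (fr_diff_ball hU 0 r)).trans ((lintegral_union_le _ _ _).trans (add_le_add ?_ ?_))
    · exact (lintegral_mono_set sdiff_subset).trans h2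
    · exact (hG2 r).trans (hr2.trans (hG3.trans (mul_le_mul' le_rfl h1)))
  have h4 := hC f hf (U \ closedBall 0 r) T (hU.sdiff isClosed_closedBall)
    (ne_top_of_le_ne_top hV ((wvol_mono sdiff_subset).trans h1)) (by
      intro x hx
      have h5 : r < ‖x‖ := by simpa using hx.2
      have := hR (show R ≤ ‖x‖ by linarith [hr.1])
      rw [← ENNReal.ofReal_natCast]
      exact ENNReal.ofReal_le_ofReal this)
  have h6 : (T : EN) * wvol f (U \ closedBall 0 r) ^ n < T * ε ^ n :=
    (h4.trans (pow_le_pow_left' (mul_le_mul' le_rfl h3) _)).trans_lt hT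
  refine (wvol_mono (sdiff_subset_sdiff_right (closedBall_subset_closedBall hr.2.le))).trans ?_
  by_contra h7
  push Not at h7
  exact absurd h6 (not_lt.2 (mul_le_mul' le_rfl (pow_le_pow_left' h7.le _)))

theorem disc (hn : 1 ≤ n) (hf : GoodF f) {V P ε : EN} (hV : V ≠ ⊤) (hP : P ≠ ⊤)
    (hε : ε ≠ 0) : ∃ (β : Type) (_ : Finite β) (F : Set (EE n) → β), ∀ U U' : Set (EE n), IsOpen U → IsOpen U' →
      wvol f U ≤ V → wper f U ≤ P → wvol f U' ≤ V → wper f U' ≤ P → F U = F U' →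
      wvol f (symmDiff U U') ≤ ε := by
  have hε3 : ε / 3 ≠ 0 := by simp [hε]
  obtain ⟨R, hR⟩ := tight hn hf hV hP hε3
  obtain ⟨C, hC⟩ := grid_close n
  obtain ⟨M, hM⟩ := (isCompact_closedBall (0 : EE n) R).exists_bound_of_continuousOn hf.cont.continuousOn
  set P' := P / ofReal (f 0)
  have hP' : P' ≠ ⊤ := ENNReal.div_ne_top hP (by simpa using hf.pos 0)
  set K : EN := ofReal M * (C * (P' + P'))
  have hK : K ≠ ⊤ := by finiteness
  obtain ⟨δ, hδ, hδK⟩ : ∃ δ : ℝ, 0 < δ ∧ ofReal δ * K ≤ ε / 3 := by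
    obtain ⟨N, hN⟩ := ENNReal.exists_nat_mul_gt hε3 hK
    refine ⟨1 / (N + 1), by positivity, ?_⟩
    rw [one_div, ENNReal.ofReal_inv_of_pos (by positivity), mul_comm, ← ENNReal.div_eq_inv_mul.trans (mul_comm _ _)]
    apply ENNReal.div_le_of_le_mul
    refine hN.le.trans ?_
    rw [mul_comm]
    refine mul_le_mul' le_rfl ?_
    rw [ENNReal.ofReal_add (by positivity) zero_le_one, ENNReal.ofReal_natCast]
    exact le_self_add
  obtain ⟨Z, hZ⟩ := grid_cover (n := n) hδ R
  refine ⟨Set Z, inferInstance, fun U => {z | volume (gcell δ z.1) < 2 * volume (U ∩ gcell δ z.1)}, ?_⟩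
  intro U U' hU hU' hv hp hv' hp' hF
  have h1 := hC U U' δ Z hδ hU hU' (fun z hz => by
    have := Set.ext_iff.1 hF ⟨z, hz⟩
    simpa using this)
  have hfr : ∀ W : Set (EE n), wper f W ≤ P → Hm (frontier W) ≤ P' := by
    intro W hW
    rw [ENNReal.le_div_iff_mul_le (Or.inl (by simpa using hf.pos 0)) (Or.inl (by simp)), mul_comm]
    exact (haus_le_wper hf W).trans hW
  have h2 : wvol f (symmDiff U U' ∩ closedBall 0 R) ≤ ε / 3 := by
    calc wvol f (symmDiff U U' ∩ closedBall 0 R) ≤ ∫⁻ x in symmDiff U U' ∩ closedBall 0 R, ofReal M := by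
          refine setLIntegral_mono measurable_const fun x hx => ENNReal.ofReal_le_ofReal ?_
          exact (le_abs_self _).trans (hM x hx.2)
      _ = ofReal M * volume (symmDiff U U' ∩ closedBall 0 R) := by
          rw [setLIntegral_const]
      _ ≤ ofReal M * (C * ofReal δ * (P' + P')) := by
          refine mul_le_mul' le_rfl (((measure_mono (inter_subset_inter_right _ hZ)).trans h1).trans ?_)
          exact mul_le_mul' le_rfl (add_le_add (hfr U hp) (hfr U' hp'))
      _ = ofReal δ * K := by ring
      _ ≤ _ := hδK
  calc wvol f (symmDiff U U') ≤ wvol f (symmDiff U U' ∩ closedBall 0 R ∪ (U \ closedBall 0 R ∪ U' \ closedBall 0 R)) := by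
        apply wvol_mono
        rintro x (hx | hx) <;> by_cases h : x ∈ closedBall (0 : EE n) R
        · exact Or.inl ⟨Or.inl hx, h⟩
        · exact Or.inr (Or.inl ⟨hx.1, h⟩)
        · exact Or.inl ⟨Or.inr hx, h⟩
        · exact Or.inr (Or.inr ⟨hx.1, h⟩)
    _ ≤ ε / 3 + (ε / 3 + ε / 3) :=
        (lintegral_union_le _ _ _).trans (add_le_add h2 ((lintegral_union_le _ _ _).trans
          (add_le_add (hR U hU hv hp) (hR U' hU' hv' hp'))))
    _ = ε := by rw [← add_assoc, ENNReal.add_thirds]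

theorem compactness (hn : 1 ≤ n) (hf : GoodF f) {V P : EN} (hV : V ≠ ⊤) (hP : P ≠ ⊤)
    (U : ℕ → Set (EE n)) (hU : ∀ k, IsOpen (U k)) (hv : ∀ k, wvol f (U k) ≤ V) (hp : ∀ k, wper f (U k) ≤ P) :
    ∃ (φ : ℕ → ℕ) (E : Set (EE n)), StrictMono φ ∧ MeasurableSet E ∧
      ∀ k, wvol f (symmDiff (U (φ k)) E) ≤ 2 * (2⁻¹) ^ k := by
  have hA : ∀ j : ℕ, ∃ A ∈ hyperfilter ℕ, ∀ k ∈ A, ∀ l ∈ A, wvol f (symmDiff (U k) (U l)) ≤ 2⁻¹ ^ j := by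
    intro j
    obtain ⟨β, _, F, hF⟩ := disc hn hf hV hP (ε := 2⁻¹ ^ j) (by simp)
    obtain ⟨b, hb⟩ : ∃ b, {k | F (U k) = b} ∈ hyperfilter ℕ := by
      have h1 : (⋃ b : β, {k | F (U k) = b}) ∈ hyperfilter ℕ := by
        rw [show (⋃ b : β, {k | F (U k) = b}) = univ by ext k; simp]
        exact Filter.univ_mem
      have := (Ultrafilter.finite_biUnion_mem_iff (f := hyperfilter ℕ) (Set.finite_univ (α := β))
        (s := fun b => {k | F (U k) = b})).1 (by simpa using h1)
      simpa using this
    exact ⟨_, hb, fun k hk l hl => hF _ _ (hU k) (hU l) (hv k) (hp k) (hv l) (hp l) (hk.trans hl.symm)⟩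
  choose A hA1 hA2 using hA
  obtain ⟨φ, hφ, hφA⟩ := extraction_forall_of_frequently (P := fun j k => ∀ i ≤ j, k ∈ A i) (by
    intro j
    have h1 : (⋂ i ∈ Finset.range (j + 1), A i) ∈ (hyperfilter ℕ : Filter ℕ) :=
      (Filter.biInter_finset_mem _).2 fun i _ => hA1 i
    have h2 : ∀ᶠ k in (hyperfilter ℕ : Filter ℕ), ∀ i ≤ j, k ∈ A i := by
      filter_upwards [h1] with k hk i hi
      exact mem_iInter₂.1 hk i (by simpa [Nat.lt_succ_iff] using hi)
    exact h2.frequently.filter_mono (Nat.cofinite_eq_atTop ▸ hyperfilter_le_cofinite))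
  refine ⟨φ, ⋂ m, ⋃ j ≥ m, U (φ j), hφ, ?_, fun k => ?_⟩
  · exact MeasurableSet.iInter fun m => MeasurableSet.iUnion fun j => MeasurableSet.iUnion fun _ => (hU _).measurableSet
  · have hsub : symmDiff (U (φ k)) (⋂ m, ⋃ j ≥ m, U (φ j)) ⊆ ⋃ j, symmDiff (U (φ (k + j))) (U (φ (k + j + 1))) := by
      intro x hx
      by_contra hcon
      simp only [mem_iUnion, not_exists, Set.mem_symmDiff, not_or, not_and, not_not] at hcon
      have h1 : ∀ j, x ∈ U (φ (k + j)) ↔ x ∈ U (φ k) := by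
        intro j
        induction j with
        | zero => rfl
        | succ j ih => rw [← ih]; exact ⟨(hcon j).2, (hcon j).1⟩
      have h2 : x ∈ (⋂ m, ⋃ j ≥ m, U (φ j)) ↔ x ∈ U (φ k) := by
        simp only [mem_iInter, mem_iUnion, exists_prop]
        constructor
        · intro h
          obtain ⟨j, hj, hxj⟩ := h k
          obtain ⟨i, rfl⟩ := Nat.exists_eq_add_of_le hj
          exact (h1 i).1 hxj
        · exact fun h m => ⟨k + m, by omega, (h1 m).2 h⟩
      rcases hx with h | h
      · exact h.2 (h2.2 h.1)
      · exact h.2 (h2.1 h.1)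
    calc wvol f (symmDiff (U (φ k)) (⋂ m, ⋃ j ≥ m, U (φ j)))
        ≤ ∑' j, wvol f (symmDiff (U (φ (k + j))) (U (φ (k + j + 1)))) :=
          (wvol_mono hsub).trans (lintegral_iUnion_le _ _)
      _ ≤ ∑' j : ℕ, 2⁻¹ ^ (k + j) := by
          refine ENNReal.tsum_le_tsum fun j => ?_
          exact hA2 _ _ (hφA _ _ le_rfl) _ (hφA (k + j + 1) _ (by omega))
      _ = 2 * 2⁻¹ ^ k := by
          simp_rw [pow_add]
          rw [ENNReal.tsum_mul_left, ENNReal.tsum_geometric, ENNReal.one_sub_inv_two, inv_inv, mul_comm]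

noncomputable def sg (v : EE n) : EE n ≃ₗᵢ[ℝ] EE n := (Submodule.span ℝ {v})ᗮ.reflection

theorem sg_sg (v x : EE n) : sg v (sg v x) = x := Submodule.reflection_reflection _ _

theorem sg_inner (v x : EE n) : inner ℝ v (sg v x) = - inner ℝ v x := by
  have h1 : sg v v = -v := Submodule.reflection_orthogonalComplement_singleton_eq_neg v
  have h2 : inner ℝ (sg v v) (sg v x) = inner ℝ v x := (sg v).inner_map_map v x
  rw [h1, inner_neg_left] at h2
  linarith

theorem sg_sub (v x : EE n) : ∃ c : ℝ, x - sg v x = c • v ∧ c * ‖v‖ ^ 2 = 2 * inner ℝ v x := by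
  have h0 := Submodule.reflection_singleton_apply (𝕜 := ℝ) v x
  have h1 : sg v x = x - (2 * (inner ℝ v x / ‖v‖ ^ 2)) • v := by
    unfold sg
    rw [Submodule.reflection_orthogonal_apply, h0]
    simp only [two_smul, mul_smul]
    norm_num
  rcases eq_or_ne v 0 with rfl | hv
  · exact ⟨0, by rw [h1]; simp, by simp⟩
  · refine ⟨2 * (inner ℝ v x / ‖v‖ ^ 2), by rw [h1]; abel, ?_⟩
    have : ‖v‖ ≠ 0 := norm_ne_zero_iff.2 hv
    field_simp

theorem sg_fix {v x : EE n} (h : inner ℝ v x = 0) : sg v x = x := by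
  obtain ⟨c, h4, h5⟩ := sg_sub v x
  rw [h, mul_zero] at h5
  have : c • v = 0 := by
    rcases mul_eq_zero.1 h5 with h6 | h6
    · rw [h6, zero_smul]
    · rw [pow_eq_zero_iff two_ne_zero, norm_eq_zero] at h6
      rw [h6, smul_zero]
  rw [this] at h4
  exact (sub_eq_zero.1 h4).symm

theorem fold_le (μ : Measure (EE n)) (v : EE n) (hμ : MeasurePreserving (sg v) μ μ) {g h : EE n → EN}
    (hg : Measurable g) (hh : Measurable h) (hle : ∀ x, g x + g (sg v x) ≤ h x + h (sg v x)) :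
    ∫⁻ x, g x ∂μ ≤ ∫⁻ x, h x ∂μ := by
  have key : ∀ g : EE n → EN, Measurable g → ∫⁻ x, g x + g (sg v x) ∂μ = 2 * ∫⁻ x, g x ∂μ := by
    intro g hg
    rw [lintegral_add_left hg, hμ.lintegral_comp hg, two_mul]
  have := lintegral_mono (μ := μ) hle
  rw [key g hg, key h hh] at this
  exact (ENNReal.mul_le_mul_iff_right (by simp) (by simp)).1 this

theorem sg_vol (v : EE n) : MeasurePreserving (sg v) (volume : Measure (EE n)) volume :=
  (sg v).measurePreserving

theorem sg_haus (v : EE n) : MeasurePreserving (sg v) (Hm : Measure (EE n)) Hm :=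
  (sg v).toIsometryEquiv.measurePreserving_hausdorffMeasure _

def pol (v : EE n) (U : Set (EE n)) : Set (EE n) :=
  ({x | 0 < inner ℝ v x} ∩ (U ∪ sg v ⁻¹' U)) ∪ (U ∩ sg v ⁻¹' U)

theorem pol_open (v : EE n) {U : Set (EE n)} (hU : IsOpen U) : IsOpen (pol v U) := by
  have h1 : IsOpen (sg v ⁻¹' U) := hU.preimage (sg v).continuous
  have h2 : IsOpen {x : EE n | 0 < inner ℝ v x} := isOpen_lt continuous_const (by fun_prop)
  exact (h2.inter (hU.union h1)).union (hU.inter h1)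

theorem f_sg (hf : GoodF f) (v x : EE n) : f (sg v x) = f x :=
  le_antisymm (hf.mono _ _ (by simp)) (hf.mono _ _ (by simp))

theorem pol_wvol_le (hf : GoodF f) (v : EE n) {U : Set (EE n)} (hU : IsOpen U) :
    wvol f (pol v U) = wvol f U := by
  have h1 : ∀ x, (pol v U).indicator (fun x => ofReal (f x)) x +
      (pol v U).indicator (fun x => ofReal (f x)) (sg v x) + 0 =
      U.indicator (fun x => ofReal (f x)) x + U.indicator (fun x => ofReal (f x)) (sg v x) + 0 := by
    intro x
    classical
    have hx := sg_inner v x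
    simp only [Set.indicator_apply, f_sg hf, pol, mem_union, mem_inter_iff, mem_ofPred_eq, mem_preimage, sg_sg, hx]
    rcases lt_trichotomy (inner ℝ v x) 0 with h | h | h
    · have h' : ¬ (0 < inner ℝ v x) := by linarith
      have h'' : 0 < - inner ℝ v x := by linarith
      by_cases a : x ∈ U <;> by_cases b : sg v x ∈ U <;> simp [a, b, h', h'', add_comm]
    · have h3 := sg_fix h
      simp [h3, h]
    · have h'' : ¬ 0 < - inner ℝ v x := by linarith
      by_cases a : x ∈ U <;> by_cases b : sg v x ∈ U <;> simp [a, b, h, h'', add_comm]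
  simp only [add_zero] at h1
  unfold wvol
  rw [← lintegral_indicator (pol_open v hU).measurableSet, ← lintegral_indicator hU.measurableSet]
  apply le_antisymm
  · exact fold_le _ v (sg_vol v) (hf.meas.indicator (pol_open v hU).measurableSet)
      (hf.meas.indicator hU.measurableSet) (fun x => (h1 x).le)
  · exact fold_le _ v (sg_vol v) 
      (hf.meas.indicator hU.measurableSet) (hf.meas.indicator (pol_open v hU).measurableSet) (fun x => (h1 x).ge)

theorem fr_open {X : Type*} [TopologicalSpace X] {U : Set X} (hU : IsOpen U) (x : X) :
    x ∈ frontier U ↔ x ∈ closure U ∧ x ∉ U := by rw [hU.frontier_eq]; rfl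

theorem pol_fr (v : EE n) {U : Set (EE n)} (hU : IsOpen U) (x : EE n) :
    ((0 < inner ℝ v x → x ∈ frontier (pol v U) → x ∈ frontier (U ∪ sg v ⁻¹' U)) ∧
    (inner ℝ v x < 0 → x ∈ frontier (pol v U) → x ∈ frontier (U ∩ sg v ⁻¹' U))) ∧
    (inner ℝ v x = 0 → x ∈ frontier (pol v U) → x ∈ frontier U) := by
  have hU' : IsOpen (sg v ⁻¹' U) := hU.preimage (sg v).continuous
  have h2 : IsOpen {x : EE n | 0 < inner ℝ v x} := isOpen_lt continuous_const (by fun_prop)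
  have h3 : IsOpen {x : EE n | inner ℝ v x < 0} := isOpen_lt (by fun_prop) continuous_const
  rw [fr_open (pol_open v hU), fr_open (hU.union hU'), fr_open (hU.inter hU'), fr_open hU]
  refine ⟨⟨fun h ⟨h4, h5⟩ => ⟨?_, fun h6 => h5 (Or.inl ⟨h, h6⟩)⟩, fun h ⟨h4, h5⟩ => ⟨?_, fun h6 => h5 (Or.inr h6)⟩⟩,
    fun h ⟨h4, h5⟩ => ⟨?_, fun h6 => h5 (Or.inr ⟨h6, ?_⟩)⟩⟩
  · refine closure_mono ?_ (h2.inter_closure ⟨h, h4⟩)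
    rintro y ⟨_, hy | hy⟩
    · exact hy.2
    · exact Or.inl hy.1
  · refine closure_mono ?_ (h3.inter_closure ⟨h, h4⟩)
    rintro y ⟨hy1, hy | hy⟩
    · have h8 : 0 < inner ℝ v y := hy.1
      have h9 : inner ℝ v y < 0 := hy1
      linarith
    · exact hy
  · have : x ∈ closure (U ∪ sg v ⁻¹' U) := by
      refine closure_mono ?_ h4
      rintro y (hy | hy)
      · exact hy.2
      · exact Or.inl hy.1
    rw [closure_union] at this
    rcases this with h7 | h7
    · exact h7
    · have := (sg v).continuous.closure_preimage_subset U h7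
      rwa [mem_preimage, sg_fix h] at this
  · rwa [mem_preimage, sg_fix h]

theorem sg_fr (v : EE n) (U : Set (EE n)) (x : EE n) :
    x ∈ frontier (sg v ⁻¹' U) ↔ sg v x ∈ frontier U := by
  have := (sg v).toHomeomorph.preimage_frontier U
  exact (Set.ext_iff.1 this x).symm

theorem pol_wper_le (hf : GoodF f) (v : EE n) {U : Set (EE n)} (hU : IsOpen U) :
    wper f (pol v U) ≤ wper f U := by
  unfold wper
  rw [← lintegral_indicator isClosed_frontier.measurableSet, ← lintegral_indicator isClosed_frontier.measurableSet]
  refine fold_le _ v (sg_haus v) (hf.meas.indicator isClosed_frontier.measurableSet)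
      (hf.meas.indicator isClosed_frontier.measurableSet) (fun x => ?_)
  have hU' : IsOpen (sg v ⁻¹' U) := hU.preimage (sg v).continuous
  have hor : ∀ y : EE n, (y ∈ frontier (U ∪ sg v ⁻¹' U) ∨ y ∈ frontier (U ∩ sg v ⁻¹' U)) →
      (y ∈ frontier U ∨ sg v y ∈ frontier U) := by
    intro y hy
    rw [← sg_fr]
    rcases hy with hy | hy
    · rcases frontier_union_subset _ _ hy with h | h
      · exact Or.inl h.1
      · exact Or.inr h.2
    · rcases frontier_inter_subset _ _ hy with h | h
      · exact Or.inl h.1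
      · exact Or.inr h.2
  have hand : ∀ y : EE n, y ∈ frontier (U ∪ sg v ⁻¹' U) → y ∈ frontier (U ∩ sg v ⁻¹' U) →
      (y ∈ frontier U ∧ sg v y ∈ frontier U) := by
    intro y h1 h2
    rw [← sg_fr]
    rw [fr_open (hU.union hU')] at h1
    rw [fr_open (hU.inter hU')] at h2
    rw [fr_open hU, fr_open hU']
    exact ⟨⟨closure_mono inter_subset_left h2.1, fun h => h1.2 (Or.inl h)⟩,
      ⟨closure_mono inter_subset_right h2.1, fun h => h1.2 (Or.inr h)⟩⟩
  have hinv : ∀ y, sg v y ∈ frontier (U ∩ sg v ⁻¹' U) → y ∈ frontier (U ∩ sg v ⁻¹' U) := by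
    intro y hy
    rw [← sg_fr] at hy
    convert hy using 2
    ext z
    simp only [mem_inter_iff, mem_preimage, sg_sg]
    exact and_comm
  have main : ∀ y : EE n, 0 < inner ℝ v y → (frontier (pol v U)).indicator (fun x => ofReal (f x)) y +
      (frontier (pol v U)).indicator (fun x => ofReal (f x)) (sg v y) ≤
      (frontier U).indicator (fun x => ofReal (f x)) y +
      (frontier U).indicator (fun x => ofReal (f x)) (sg v y) := by
    intro y hy
    classical
    have h1 := (pol_fr v hU y).1.1 hy
    have h2 := (pol_fr v hU (sg v y)).1.2 (by rw [sg_inner]; linarith)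
    simp only [Set.indicator_apply, f_sg hf]
    have h3 := hor y
    have h4 := hand y
    have h5 := hinv y
    by_cases a : y ∈ frontier (pol v U) <;> by_cases b : sg v y ∈ frontier (pol v U)
    · have := h4 (h1 a) (h5 (h2 b))
      simp [this.1, this.2, a, b]
    · rcases h3 (Or.inl (h1 a)) with h | h <;> simp [h, a, b]
    · rcases h3 (Or.inr (h5 (h2 b))) with h | h <;> simp [h, a, b]
    · simp [a, b]
  rcases lt_trichotomy (inner ℝ v x) 0 with h | h | h
  · have := main (sg v x) (by rw [sg_inner]; linarith)
    rw [sg_sg] at this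
    calc _ = _ := add_comm _ _
      _ ≤ _ := this
      _ = _ := add_comm _ _
  · rw [sg_fix h]
    have h1 := (pol_fr v hU x).2 h
    classical
    simp only [Set.indicator_apply]
    by_cases a : x ∈ frontier (pol v U)
    · simp [a, h1 a]
    · simp [a]
  · exact main x h

noncomputable def phi (e x : EE n) : ℝ := 2 + inner ℝ e x / (1 + ‖x‖)

theorem phi_bd {e : EE n} (he : ‖e‖ = 1) (x : EE n) : 1 ≤ phi e x ∧ phi e x ≤ 3 := by
  have h1 := abs_real_inner_le_norm e x
  rw [he, one_mul, abs_le] at h1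
  have h2 : 0 < 1 + ‖x‖ := by positivity
  unfold phi
  constructor
  · have : -1 ≤ inner ℝ e x / (1 + ‖x‖) := by rw [le_div_iff₀ h2]; linarith
    linarith
  · have : inner ℝ e x / (1 + ‖x‖) ≤ 1 := by rw [div_le_iff₀ h2]; linarith
    linarith

theorem phi_lt {e v x : EE n} (hv : 0 < inner ℝ v e) (hx : 0 < inner ℝ v x) : phi e (sg v x) < phi e x := by
  unfold phi
  obtain ⟨c, h1, h2⟩ := sg_sub v x
  have h3 : 0 < c := by
    by_contra h
    push Not at h
    nlinarith [sq_nonneg ‖v‖]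
  have h4 : inner ℝ e x - inner ℝ e (sg v x) = c * inner ℝ v e := by
    rw [← inner_sub_right, h1, inner_smul_right, real_inner_comm]
  rw [LinearIsometryEquiv.norm_map]
  have : 0 < c * inner ℝ v e := by positivity
  gcongr
  linarith

theorem phi_meas (e : EE n) : Measurable (phi e) := by
  unfold phi
  have : Continuous (fun x : EE n => 2 + inner ℝ e x / (1 + ‖x‖)) := by
    refine continuous_const.add (Continuous.div (by fun_prop) (by fun_prop) fun x => by positivity)
  exact this.measurable

def Bad (v : EE n) (U : Set (EE n)) : Set (EE n) := {x | 0 < inner ℝ v x ∧ x ∉ U ∧ sg v x ∈ U}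

theorem Bad_meas (v : EE n) {U : Set (EE n)} (hU : MeasurableSet U) : MeasurableSet (Bad v U) := by
  have h2 : IsOpen {x : EE n | 0 < inner ℝ v x} := isOpen_lt continuous_const (by fun_prop)
  exact h2.measurableSet.inter (hU.compl.inter ((sg v).continuous.measurable hU))

theorem J_pol (hf : GoodF f) {e v : EE n} (he : ‖e‖ = 1) (hv : 0 < inner ℝ v e)
    {U : Set (EE n)} (hU : IsOpen U) :
    (∫⁻ x in U, ofReal (phi e x * f x)) + ∫⁻ x in Bad v U, ofReal ((phi e x - phi e (sg v x)) * f x)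
     ≤ ∫⁻ x in pol v U, ofReal (phi e x * f x) := by
  have hm1 : Measurable fun x => ofReal (phi e x * f x) :=
    ((phi_meas e).mul hf.cont.measurable).ennreal_ofReal
  have hm2 : Measurable fun x => ofReal ((phi e x - phi e (sg v x)) * f x) :=
    ((((phi_meas e).sub ((phi_meas e).comp (sg v).continuous.measurable))).mul hf.cont.measurable).ennreal_ofReal
  rw [← lintegral_indicator (pol_open v hU).measurableSet, ← lintegral_indicator hU.measurableSet,
    ← lintegral_indicator (Bad_meas v hU.measurableSet), ← lintegral_add_left (hm1.indicator hU.measurableSet)]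
  refine fold_le _ v (sg_vol v) ((hm1.indicator hU.measurableSet).add (hm2.indicator (Bad_meas v hU.measurableSet)))
    (hm1.indicator (pol_open v hU).measurableSet) fun x => ?_
  have main : ∀ y, 0 < inner ℝ v y → U.indicator (fun x => ofReal (phi e x * f x)) y +
      (Bad v U).indicator (fun x => ofReal ((phi e x - phi e (sg v x)) * f x)) y +
      (U.indicator (fun x => ofReal (phi e x * f x)) (sg v y) +
      (Bad v U).indicator (fun x => ofReal ((phi e x - phi e (sg v x)) * f x)) (sg v y)) ≤
      (pol v U).indicator (fun x => ofReal (phi e x * f x)) y +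
      (pol v U).indicator (fun x => ofReal (phi e x * f x)) (sg v y) := by
    intro y hy
    classical
    have hx := sg_inner v y
    have hy' : ¬ 0 < - inner ℝ v y := by linarith
    have hlt := phi_lt hv hy
    simp only [Set.indicator_apply, f_sg hf, pol, Bad, mem_union, mem_inter_iff, mem_ofPred_eq, mem_preimage, sg_sg, hx]
    by_cases a : y ∈ U <;> by_cases b : sg v y ∈ U <;> simp only [a, b, hy, hy', true_and, false_and, and_true,
      and_false, if_true, if_false, or_true, true_or, or_false, false_or, not_true_eq_false, not_false_eq_true,
      add_zero, zero_add, le_refl]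
    rw [← ENNReal.ofReal_add]
    · apply le_of_eq; congr 1; ring
    · have := hf.pos y
      nlinarith
    · have := hf.pos y
      nlinarith [(phi_bd he (sg v y)).1]
  rcases lt_trichotomy (inner ℝ v x) 0 with h | h | h
  · have := main (sg v x) (by rw [sg_inner]; linarith)
    simp only [sg_sg] at this ⊢
    calc _ = _ := add_comm _ _
      _ ≤ _ := this
      _ = _ := add_comm _ _
  · rw [sg_fix h]
    classical
    simp [Set.indicator_apply, pol, Bad, sg_fix h, h]
  · exact main x h

theorem min_seq (hn : 1 ≤ n) (hf : GoodF f) {e : EE n} (he : ‖e‖ = 1) {V m : EN}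
    (hV : V ≠ ⊤) (hm : m = sInf {p | ∃ W : Set (EE n), IsOpen W ∧ wvol f W = V ∧ wper f W = p}) (hmt : m ≠ ⊤) :
    ∃ (U : ℕ → Set (EE n)) (E : Set (EE n)), (∀ k, IsOpen (U k)) ∧ (∀ k, wvol f (U k) = V) ∧
      (∀ k, wper f (U k) ≤ m + ((k : EN) + 1)⁻¹) ∧ MeasurableSet E ∧
      (∀ k, wvol f (symmDiff (U k) E) ≤ 2 * (2⁻¹) ^ k) ∧
      ∀ v, 0 < inner ℝ v e → volume (Bad v E) = 0 := by
  set J : Set (EE n) → EN := fun U => ∫⁻ x in U, ofReal (phi e x * f x) with hJ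
  have hJle : ∀ A : Set (EE n), J A ≤ 3 * wvol f A := by
    intro A
    unfold wvol
    rw [← lintegral_const_mul _ hf.meas]
    refine lintegral_mono fun x => ?_
    rw [show (3 : EN) = ofReal 3 by simp, ← ENNReal.ofReal_mul (by norm_num)]
    exact ENNReal.ofReal_le_ofReal (mul_le_mul_of_nonneg_right (phi_bd he x).2 (hf.pos x).le)
  have hpos : ∀ k : ℕ, ((k : EN) + 1)⁻¹ ≠ 0 := fun k => ENNReal.inv_ne_zero.2 (by finiteness)
  have hstep : ∀ k : ℕ, ∃ U : Set (EE n), IsOpen U ∧ wvol f U = V ∧ wper f U ≤ m + ((k : EN) + 1)⁻¹ ∧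
      ∀ W : Set (EE n), IsOpen W → wvol f W = V → wper f W ≤ m + ((k : EN) + 1)⁻¹ →
        J W ≤ J U + ((k : EN) + 1)⁻¹ := by
    intro k
    set T := {j | ∃ W : Set (EE n), (IsOpen W ∧ wvol f W = V ∧ wper f W ≤ m + ((k : EN) + 1)⁻¹) ∧ J W = j}
    have hne : T.Nonempty := by
      have : sInf {p | ∃ W : Set (EE n), IsOpen W ∧ wvol f W = V ∧ wper f W = p} < m + ((k : EN) + 1)⁻¹ := by
        rw [← hm]; exact ENNReal.lt_add_right hmt (hpos k)
      obtain ⟨p, ⟨W, h1, h2, h3⟩, h4⟩ := sInf_lt_iff.1 this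
      exact ⟨_, W, ⟨h1, h2, by rw [h3]; exact h4.le⟩, rfl⟩
    have hTt : sSup T ≠ ⊤ := by
      refine ne_top_of_le_ne_top (show 3 * V ≠ ⊤ by finiteness) (sSup_le ?_)
      rintro j ⟨W, ⟨_, h, _⟩, rfl⟩
      exact (hJle W).trans (by rw [h])
    rcases eq_or_ne (sSup T) 0 with h0 | h0
    · obtain ⟨j, W, hW, -⟩ := hne
      refine ⟨W, hW.1, hW.2.1, hW.2.2, fun W' h1 h2 h3 => ?_⟩
      have : J W' ≤ sSup T := le_sSup ⟨W', ⟨h1, h2, h3⟩, rfl⟩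
      rw [h0] at this
      exact this.trans zero_le
    · obtain ⟨j, ⟨W, hW, rfl⟩, hj⟩ := lt_sSup_iff.1 (ENNReal.sub_lt_self hTt h0 (hpos k))
      refine ⟨W, hW.1, hW.2.1, hW.2.2, fun W' h1 h2 h3 => ?_⟩
      have : J W' ≤ sSup T := le_sSup ⟨W', ⟨h1, h2, h3⟩, rfl⟩
      exact this.trans (tsub_le_iff_right.1 hj.le)
  choose U hU1 hU2 hU3 hU4 using hstep
  obtain ⟨φ, E, hφ, hE, hφE⟩ := compactness hn hf hV (P := m + 1) (by finiteness) U hU1 (fun k => (hU2 k).le)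
    (fun k => (hU3 k).trans (add_le_add le_rfl (by
      rw [ENNReal.inv_le_one]; exact le_add_self)))
  have hinv : ∀ k, ((φ k : EN) + 1)⁻¹ ≤ ((k : EN) + 1)⁻¹ := fun k => by
    rw [ENNReal.inv_le_inv]
    have := hφ.id_le k
    gcongr
    exact this
  refine ⟨fun k => U (φ k), E, fun k => hU1 _, fun k => hU2 _, fun k => (hU3 _).trans (add_le_add le_rfl (hinv k)),
    hE, hφE, fun v hv => ?_⟩
  set ψ : EE n → EN := fun x => ofReal ((phi e x - phi e (sg v x)) * f x)
  have hψm : Measurable ψ :=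
    ((((phi_meas e).sub ((phi_meas e).comp (sg v).continuous.measurable))).mul hf.cont.measurable).ennreal_ofReal
  have h1 : ∀ k, ∫⁻ x in Bad v (U (φ k)), ψ x ≤ ((k : EN) + 1)⁻¹ := by
    intro k
    have h2 := J_pol hf he hv (hU1 (φ k))
    have h3 := hU4 (φ k) (pol v (U (φ k))) (pol_open v (hU1 _)) ((pol_wvol_le hf v (hU1 _)).trans (hU2 _))
      ((pol_wper_le hf v (hU1 _)).trans (hU3 _))
    have h4 : J (U (φ k)) ≠ ⊤ := ne_top_of_le_ne_top (show 3 * V ≠ ⊤ by finiteness) ((hJle _).trans (by rw [hU2]))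
    exact ((ENNReal.add_le_add_iff_left h4).1 (h2.trans h3)).trans (hinv k)
  have hψle : ∀ A : Set (EE n), ∫⁻ x in A, ψ x ≤ 2 * wvol f A := by
    intro A
    unfold wvol
    rw [← lintegral_const_mul _ hf.meas]
    refine lintegral_mono fun x => ?_
    rw [show (2 : EN) = ofReal 2 by simp, ← ENNReal.ofReal_mul (by norm_num)]
    refine ENNReal.ofReal_le_ofReal (mul_le_mul_of_nonneg_right ?_ (hf.pos x).le)
    linarith [(phi_bd he x).2, (phi_bd he (sg v x)).1]
  have hsgv : ∀ A : Set (EE n), MeasurableSet A → wvol f (sg v ⁻¹' A) = wvol f A := by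
    intro A hA
    unfold wvol
    rw [← (sg_vol v).setLIntegral_comp_preimage hA hf.meas]
    simp only [f_sg hf]
  have h5 : ∫⁻ x in Bad v E, ψ x = 0 := by
    have h6 : ∀ k : ℕ, ∫⁻ x in Bad v E, ψ x ≤ ((k : EN) + 1)⁻¹ + 4 * (2 * 2⁻¹ ^ k) := by
      intro k
      set D := symmDiff (U (φ k)) E
      have hD : MeasurableSet D := (hU1 _).measurableSet.symmDiff hE
      have hsub : Bad v E ⊆ Bad v (U (φ k)) ∪ (D ∪ sg v ⁻¹' D) := by
        rintro x ⟨hx1, hx2, hx3⟩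
        by_cases a : x ∈ U (φ k)
        · exact Or.inr (Or.inl (Or.inl ⟨a, hx2⟩))
        · by_cases b : sg v x ∈ U (φ k)
          · exact Or.inl ⟨hx1, a, b⟩
          · exact Or.inr (Or.inr (Or.inr ⟨hx3, b⟩))
      calc _ ≤ ∫⁻ x in Bad v (U (φ k)) ∪ (D ∪ sg v ⁻¹' D), ψ x := lintegral_mono_set hsub
        _ ≤ ((k : EN) + 1)⁻¹ + (2 * (2 * 2⁻¹ ^ k) + 2 * (2 * 2⁻¹ ^ k)) := by
          refine (lintegral_union_le _ _ _).trans (add_le_add (h1 k) ((lintegral_union_le _ _ _).trans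
            (add_le_add ((hψle _).trans ?_) ((hψle _).trans ?_))))
          · exact mul_le_mul' le_rfl (hφE k)
          · rw [hsgv _ hD]; exact mul_le_mul' le_rfl (hφE k)
        _ = _ := by ring
    have h7 : Tendsto (fun k : ℕ => ((k : EN) + 1)⁻¹ + 4 * (2 * 2⁻¹ ^ k)) atTop (𝓝 (0 + 4 * (2 * 0))) := by
      refine Tendsto.add ?_ (ENNReal.Tendsto.const_mul (ENNReal.Tendsto.const_mul ?_ (by simp)) (by simp))
      · have := ENNReal.tendsto_inv_nat_nhds_zero.comp (tendsto_add_atTop_nat 1)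
        refine this.congr fun k => by simp
      · exact ENNReal.tendsto_pow_atTop_nhds_zero_of_lt_one (by simp)
    have := ge_of_tendsto' h7 h6
    simpa using this
  rw [setLIntegral_eq_zero_iff (Bad_meas v hE) hψm] at h5
  have h8 : ∀ᵐ x, x ∉ Bad v E := by
    filter_upwards [h5] with x hx hb
    have h9 := hx hb
    have h10 := phi_lt hv hb.1
    have h11 := hf.pos x
    have : 0 < (phi e x - phi e (sg v x)) * f x := mul_pos (by linarith) h11
    have h12 : ofReal ((phi e x - phi e (sg v x)) * f x) = 0 := h9
    rw [ENNReal.ofReal_eq_zero] at h12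
    linarith
  simpa [ae_iff] using h8

def DP (E : Set (EE n)) : Set (EE n) :=
  {x | ∀ ε : EN, 0 < ε → ∀ᶠ r in 𝓝[>] (0 : ℝ), volume (closedBall x r \ E) ≤ ε * volume (closedBall x r)}

theorem cb_pos (x : EE n) {r : ℝ} (hr : 0 < r) : volume (closedBall x r) ≠ 0 :=
  (measure_closedBall_pos volume x hr).ne'

theorem DP_ae {E : Set (EE n)} (hE : MeasurableSet E) : DP E =ᵐ[volume] E := by
  have h := Besicovitch.ae_tendsto_measure_inter_div_of_measurableSet (volume : Measure (EE n)) hE.compl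
  filter_upwards [h] with x hx
  have hset : ∀ r, Eᶜ ∩ closedBall x r = closedBall x r \ E := fun r => by rw [inter_comm]; rfl
  simp only [hset] at hx
  have key : x ∈ DP E ↔ x ∈ E := by
    constructor
    · intro h1
      by_contra h2
      rw [Set.indicator_of_mem (show x ∈ Eᶜ from h2)] at hx
      have h3 : ∀ᶠ r in 𝓝[>] (0 : ℝ), volume (closedBall x r \ E) / volume (closedBall x r) ≤ 2⁻¹ := by
        filter_upwards [h1 2⁻¹ (by simp)] with r hr
        exact ENNReal.div_le_of_le_mul hr
      have h4 := le_of_tendsto hx h3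
      simp at h4
    · intro h1 ε hε
      rw [Set.indicator_of_notMem (show x ∉ Eᶜ from fun h => h h1)] at hx
      filter_upwards [hx.eventually (ge_mem_nhds hε), self_mem_nhdsWithin] with r hr hr0
      rwa [ENNReal.div_le_iff (cb_pos x hr0) measure_closedBall_lt_top.ne] at hr
  exact propext key

theorem DP_congr {E F : Set (EE n)} (h : E =ᵐ[volume] F) : DP E = DP F := by
  have : ∀ x r, volume (closedBall x r \ E) = volume (closedBall x r \ F) := fun x r =>
    measure_congr (ae_eq_set_diff (ae_eq_refl _) h)
  unfold DP; simp only [this]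

theorem DP_pol {E : Set (EE n)} {e x y : EE n} (hb : ∀ v, 0 < inner ℝ v e → volume (Bad v E) = 0)
    (hxy : ‖x‖ = ‖y‖) (hlt : inner ℝ y e < inner ℝ x e) (hy : y ∈ DP E) : x ∈ DP E := by
  set v := x - y with hv
  have hv0 : 0 < inner ℝ v e := by rw [hv, inner_sub_left]; linarith
  have hne : x ≠ y := by rintro rfl; exact lt_irrefl _ hlt
  have h1 : sg v x = y := Submodule.reflection_sub hxy
  have h2 : 0 < inner ℝ v x := by
    have h3 : 0 < ‖x - y‖ ^ 2 := by
      have := norm_pos_iff.2 (sub_ne_zero.2 hne); positivity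
    have h4 : ‖x - y‖ ^ 2 = ‖x‖ ^ 2 - 2 * inner ℝ x y + ‖y‖ ^ 2 := norm_sub_sq_real x y
    rw [hv, inner_sub_left, real_inner_self_eq_norm_sq, real_inner_comm x y]
    rw [← hxy] at h4
    linarith
  have hop : IsOpen {z : EE n | 0 < inner ℝ v z} := isOpen_lt continuous_const (by fun_prop)
  obtain ⟨δ, hδ, hball⟩ := Metric.isOpen_iff.1 hop x h2
  intro ε hε
  filter_upwards [hy ε hε, Ioo_mem_nhdsGT hδ] with r hr hrδ
  have hsub : closedBall x r \ E ⊆ Bad v E ∪ sg v ⁻¹' (closedBall y r \ E) := by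
    rintro z ⟨hz1, hz2⟩
    by_cases h : sg v z ∈ E
    · exact Or.inl ⟨hball (closedBall_subset_ball hrδ.2 hz1), hz2, h⟩
    · refine Or.inr ⟨?_, h⟩
      rw [mem_closedBall] at hz1 ⊢
      rw [← h1, (sg v).isometry.dist_eq]; exact hz1
  calc volume (closedBall x r \ E) ≤ volume (Bad v E) + volume (sg v ⁻¹' (closedBall y r \ E)) :=
        (measure_mono hsub).trans (measure_union_le _ _)
    _ = volume (closedBall y r \ E) := by
        rw [hb v hv0, zero_add]
        exact (sg_vol v).measure_preimage_equiv (f := (sg v).toHomeomorph.toMeasurableEquiv) _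
    _ ≤ ε * volume (closedBall x r) := by
        rw [Measure.addHaar_closedBall_center volume x, ← Measure.addHaar_closedBall_center volume y]; exact hr

noncomputable def W (e : EE n) (r θ : ℝ) (ω : EE n) : EE n := (r * Real.cos θ) • e + (r * Real.sin θ) • ω

def Om (e ω : EE n) : Prop := ‖ω‖ = 1 ∧ inner ℝ e ω = 0

theorem W_in {e ω ω' : EE n} (he : ‖e‖ = 1) (h : Om e ω) (h' : Om e ω') (r θ r' θ' : ℝ) :
    inner ℝ (W e r θ ω) (W e r' θ' ω') =
      r * r' * (Real.cos θ * Real.cos θ' + Real.sin θ * Real.sin θ' * inner ℝ ω ω') := by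
  have h1 : inner ℝ ω e = 0 := by rw [real_inner_comm]; exact h.2
  unfold W
  simp only [inner_add_left, inner_add_right, inner_smul_left, inner_smul_right, h1, h'.2,
    real_inner_self_eq_norm_sq, he, conj_trivial]
  ring

theorem W_norm {e ω : EE n} (he : ‖e‖ = 1) (h : Om e ω) {r : ℝ} (hr : 0 ≤ r) (θ : ℝ) :
    ‖W e r θ ω‖ = r := by
  have h1 := W_in he h h r θ r θ
  rw [real_inner_self_eq_norm_sq, real_inner_self_eq_norm_sq, h.1] at h1
  have h2 := Real.sin_sq_add_cos_sq θ
  have h3 : ‖W e r θ ω‖ ^ 2 = r ^ 2 := by rw [h1]; linear_combination r ^ 2 * h2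
  exact (pow_left_inj₀ (norm_nonneg _) hr two_ne_zero).1 h3

theorem W_inner {e ω : EE n} (he : ‖e‖ = 1) (h : Om e ω) (r θ : ℝ) :
    inner ℝ (W e r θ ω) e = r * Real.cos θ := by
  have h1 : inner ℝ ω e = 0 := by rw [real_inner_comm]; exact h.2
  unfold W
  simp [inner_add_left, inner_smul_left, h1, real_inner_self_eq_norm_sq, he]

theorem W_dist {e ω ω' : EE n} (he : ‖e‖ = 1) (h : Om e ω) (h' : Om e ω') (r θ r' θ' : ℝ) :
    dist (W e r θ ω) (W e r' θ' ω') ^ 2 = (r - r') ^ 2 + 2 * (r * r') * (1 - Real.cos (θ - θ')) +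
      r * r' * (Real.sin θ * Real.sin θ') * dist ω ω' ^ 2 := by
  have h3 : ∀ a b : EE n, dist a b ^ 2 = inner ℝ a a - 2 * inner ℝ a b + inner ℝ b b := fun a b => by
    rw [dist_eq_norm, norm_sub_sq_real, real_inner_self_eq_norm_sq, real_inner_self_eq_norm_sq]
  rw [h3, h3 ω ω', W_in he h h', W_in he h h, W_in he h' h', real_inner_self_eq_norm_sq ω,
    real_inner_self_eq_norm_sq ω', h.1, h'.1, Real.cos_sub]
  have h1 := Real.sin_sq_add_cos_sq θ
  have h2 := Real.sin_sq_add_cos_sq θ'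
  linear_combination r ^ 2 * h1 + r' ^ 2 * h2

theorem exists_Om (hn : 1 ≤ n) (e : EE n) : ∃ ω, Om e ω := by
  have h1 : (Submodule.span ℝ {e})ᗮ ≠ ⊥ := by
    intro h
    have h2 := (Submodule.span ℝ {e}).finrank_add_finrank_orthogonal
    rw [h, finrank_bot, finrank_euclideanSpace_fin] at h2
    have h3 := finrank_span_le_card (R := ℝ) ({e} : Set (EE n))
    simp at h3
    omega
  obtain ⟨z, hz, hz0⟩ := Submodule.exists_mem_ne_zero_of_ne_bot h1
  refine ⟨‖z‖⁻¹ • z, ?_, ?_⟩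
  · rw [norm_smul, norm_inv, norm_norm, inv_mul_cancel₀ (norm_ne_zero_iff.2 hz0)]
  · rw [inner_smul_right, (Submodule.mem_orthogonal_singleton_iff_inner_right.1 hz), mul_zero]

theorem exists_W (hn : 1 ≤ n) {e : EE n} (he : ‖e‖ = 1) (w : EE n) :
    ∃ θ ∈ Icc 0 π, ∃ ω, Om e ω ∧ w = W e ‖w‖ θ ω := by
  obtain ⟨ω₀, h0⟩ := exists_Om hn e
  rcases eq_or_ne w 0 with rfl | hw
  · exact ⟨0, ⟨le_rfl, Real.pi_pos.le⟩, ω₀, h0, by simp [W]⟩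
  have hw' : 0 < ‖w‖ := norm_pos_iff.2 hw
  have hc := InnerProductGeometry.cos_angle_mul_norm_mul_norm w e
  set θ := InnerProductGeometry.angle w e
  rw [he, mul_one] at hc
  have hθ : θ ∈ Icc 0 π := ⟨InnerProductGeometry.angle_nonneg _ _, InnerProductGeometry.angle_le_pi _ _⟩
  set z := w - (‖w‖ * Real.cos θ) • e with hz
  have hze : inner ℝ e z = 0 := by
    rw [hz, inner_sub_right, inner_smul_right, real_inner_self_eq_norm_sq, he, real_inner_comm, ← hc]; ring
  have hzn : ‖z‖ = ‖w‖ * Real.sin θ := by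
    have hs := Real.sin_nonneg_of_mem_Icc hθ
    have h2 : ‖w‖ ^ 2 = (‖w‖ * Real.cos θ) ^ 2 + ‖z‖ ^ 2 := by
      have : w = (‖w‖ * Real.cos θ) • e + z := by rw [hz]; abel
      conv_lhs => rw [this]
      rw [norm_add_sq_real, norm_smul, he, inner_smul_left, hze]
      simp
      ring_nf
      simp
    have h3 := Real.sin_sq_add_cos_sq θ
    have h4 : ‖z‖ ^ 2 = (‖w‖ * Real.sin θ) ^ 2 := by
      linear_combination -h2 - ‖w‖ ^ 2 * h3
    exact (pow_left_inj₀ (norm_nonneg _) (by positivity) two_ne_zero).1 h4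
  rcases eq_or_ne z 0 with h | h
  · refine ⟨θ, hθ, ω₀, h0, ?_⟩
    rw [h, norm_zero] at hzn
    unfold W
    rw [← hzn, zero_smul, add_zero]
    rw [hz] at h
    exact sub_eq_zero.1 h
  · refine ⟨θ, hθ, ‖z‖⁻¹ • z, ⟨?_, ?_⟩, ?_⟩
    · rw [norm_smul, norm_inv, norm_norm, inv_mul_cancel₀ (norm_ne_zero_iff.2 h)]
    · rw [inner_smul_right, hze, mul_zero]
    · unfold W
      rw [← hzn, smul_smul, mul_inv_cancel₀ (norm_ne_zero_iff.2 h), one_smul, hz]; abel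

structure Cap (f : EE n → ℝ) (e : EE n) (U : ℕ → Set (EE n)) (E : Set (EE n)) (α : ℝ → ℝ) (V m : EN) :
    Prop where
  he : ‖e‖ = 1
  op : ∀ k, IsOpen (U k)
  vol : ∀ k, wvol f (U k) = V
  per : ∀ k, wper f (U k) ≤ m + ((k : EN) + 1)⁻¹
  dif : ∀ k, wvol f (symmDiff (U k) E) ≤ 2 * (2⁻¹) ^ k
  dp : DP E = E
  nm : NullMeasurableSet E volume
  rng : ∀ r, α r ∈ Icc 0 π
  ins : ∀ r θ ω, 0 < r → 0 ≤ θ → Om e ω → θ < α r → W e r θ ω ∈ E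
  out : ∀ r θ ω, 0 < r → θ ≤ π → Om e ω → α r < θ → W e r θ ω ∉ E

theorem exists_cap (hn : 1 ≤ n) (hf : GoodF f) {V m : EN}
    (hV : V ≠ ⊤) (hm : m = sInf {p | ∃ W : Set (EE n), IsOpen W ∧ wvol f W = V ∧ wper f W = p}) (hmt : m ≠ ⊤) :
    ∃ e U E α, Cap f e U E α V m := by
  set e : EE n := EuclideanSpace.single 0 1
  have he : ‖e‖ = 1 := by simp [e]
  obtain ⟨U, E, h1, h2, h3, h4, h5, h6⟩ := min_seq hn hf he hV hm hmt
  have hae := DP_ae h4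
  set α : ℝ → ℝ := fun r => sSup {θ | θ ∈ Icc 0 π ∧ ∃ ω, Om e ω ∧ W e r θ ω ∈ DP E} with hα
  have hbd : ∀ r, BddAbove {θ | θ ∈ Icc 0 π ∧ ∃ ω, Om e ω ∧ W e r θ ω ∈ DP E} := fun r =>
    ⟨π, fun θ h => h.1.2⟩
  have hrng : ∀ r, α r ∈ Icc 0 π := fun r =>
    ⟨Real.sSup_nonneg fun θ h => h.1.1, Real.sSup_le (fun θ h => h.1.2) Real.pi_pos.le⟩
  refine ⟨e, U, DP E, α, he, h1, h2, h3, fun k => ?_, DP_congr hae, h4.nullMeasurableSet.congr hae.symm, hrng, ?_, ?_⟩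
  · have : wvol f (symmDiff (U k) (DP E)) = wvol f (symmDiff (U k) E) :=
      setLIntegral_congr (ae_eq_set_symmDiff (ae_eq_refl _) hae)
    rw [this]; exact h5 k
  · intro r θ ω hr h0 hω hlt
    have hne : {θ | θ ∈ Icc 0 π ∧ ∃ ω, Om e ω ∧ W e r θ ω ∈ DP E}.Nonempty := by
      by_contra h
      rw [not_nonempty_iff_eq_empty] at h
      rw [hα] at hlt
      simp only [h, Real.sSup_empty] at hlt
      linarith
    obtain ⟨θ', ⟨hθ', ω', hω', hW⟩, hlt'⟩ := exists_lt_of_lt_csSup hne hlt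
    refine DP_pol h6 (y := W e r θ' ω') ?_ ?_ hW
    · rw [W_norm he hω hr.le, W_norm he hω' hr.le]
    · rw [W_inner he hω, W_inner he hω']
      exact mul_lt_mul_of_pos_left (Real.cos_lt_cos_of_nonneg_of_le_pi h0 hθ'.2 hlt') hr
  · intro r θ ω hr h0 hω hlt hW
    exact absurd (le_csSup (hbd r) ⟨⟨(hrng r).1.trans hlt.le, h0⟩, ω, hω, hW⟩) (not_le.2 hlt)

theorem haus_rel {A B : Set (EE n)} (R : EE n → EE n → Prop) (K : ℝ≥0)
    (h1 : ∀ b ∈ B, ∃ a ∈ A, R a b)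
    (h2 : ∀ a b a' b', R a b → R a' b' → dist b b' ≤ K * dist a a') : Hm B ≤ (K : EN) ^ n * Hm A := by
  classical
  set A' := {a ∈ A | ∃ b, R a b}
  have hg : ∃ g : EE n → EE n, ∀ a ∈ A', R a (g a) :=
    ⟨fun a => if h : ∃ b, R a b then h.choose else 0, fun a ha => by
      simp only [ha.2, dite_true]; exact ha.2.choose_spec⟩
  obtain ⟨g, hg⟩ := hg
  have hL : LipschitzOnWith K g A' := LipschitzOnWith.of_dist_le_mul fun a ha a' ha' => h2 _ _ _ _ (hg a ha) (hg a' ha')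
  have hsub : B ⊆ g '' A' := fun b hb => by
    obtain ⟨a, ha, hab⟩ := h1 b hb
    refine ⟨a, ⟨ha, b, hab⟩, ?_⟩
    have := h2 _ _ _ _ (hg a ⟨ha, b, hab⟩) hab
    rw [dist_self, mul_zero] at this
    exact dist_le_zero.1 this
  have h3 := hL.hausdorffMeasure_image_le (d := n) (by positivity)
  rw [ENNReal.rpow_natCast] at h3
  exact (measure_mono hsub).trans (h3.trans (mul_le_mul' le_rfl (measure_mono (sep_subset _ _))))

theorem slice_good {A : ℕ → Set (EE n)} {C : EN} (hC : C ≠ ⊤) (hA : ∀ k, volume (A k) ≤ C * 2⁻¹ ^ k)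
    {u : EE n → ℝ} (hu : LipschitzWith 1 u) :
    ∀ᵐ c, Tendsto (fun k => Hm (A k ∩ u ⁻¹' {c})) atTop (𝓝 0) := by
  obtain ⟨C', hC'⟩ := slice_lip n
  choose G hG1 hG2 hG3 using fun k => hC' u hu (A k)
  have h1 : ∫⁻ r, ∑' k, G k r ≠ ⊤ := by
    rw [lintegral_tsum fun k => (hG1 k).aemeasurable]
    refine ne_top_of_le_ne_top ?_ (ENNReal.tsum_le_tsum fun k => (hG3 k).trans (mul_le_mul' le_rfl (hA k)))
    rw [ENNReal.tsum_mul_left, ENNReal.tsum_mul_left, ENNReal.tsum_geometric]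
    have : (1 - 2⁻¹ : EN) ≠ 0 := by simp
    finiteness
  filter_upwards [ae_lt_top (Measurable.tsum hG1) h1] with c hc
  exact tendsto_of_tendsto_of_tendsto_of_le_of_le tendsto_const_nhds
    (ENNReal.tendsto_atTop_zero_of_tsum_ne_top hc.ne) (fun _ => zero_le) fun k => hG2 k c

theorem norm_null {A : Set ℝ} (hA : volume A = 0) : volume {w : EE n | ‖w‖ ∈ A} = 0 := by
  set B := toMeasurable volume A
  have hB : MeasurableSet B := measurableSet_toMeasurable _ _
  have hB0 : volume B = 0 := by rw [measure_toMeasurable, hA]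
  refine measure_mono_null (t := {w : EE n | ‖w‖ ∈ B}) (fun w hw => subset_toMeasurable _ _ hw) ?_
  have hmB : MeasurableSet {w : EE n | ‖w‖ ∈ B} := measurable_norm hB
  have h0 : (fun y : ℝ => y ^ (Module.finrank ℝ (EE n) - 1) • B.indicator (fun _ => (1 : ℝ)) y) =ᵐ[volume.restrict (Ioi 0)] 0 := by
    refine ae_restrict_of_ae ?_
    have : ∀ᵐ y, y ∉ B := measure_eq_zero_iff_ae_notMem.1 hB0
    filter_upwards [this] with y hy
    simp [hy]
  have h1 : Integrable (fun w : EE n => B.indicator (fun _ => (1 : ℝ)) ‖w‖) volume := by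
    rw [integrable_fun_norm_addHaar]
    exact (integrable_zero _ _ _).congr h0.symm
  have h2 := integral_fun_norm_addHaar (volume : Measure (EE n)) (B.indicator (fun _ => (1 : ℝ)))
  rw [integral_congr_ae h0] at h2
  simp only [Pi.zero_apply, integral_zero, smul_zero] at h2
  have h3 : (fun w : EE n => B.indicator (fun _ => (1 : ℝ)) ‖w‖) = {w : EE n | ‖w‖ ∈ B}.indicator (fun _ => 1) := by
    classical
    ext w; simp [Set.indicator_apply]
  rw [h3] at h1 h2
  have h4 : volume {w : EE n | ‖w‖ ∈ B} < ⊤ := by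
    have := (integrable_indicator_iff hmB).1 h1
    rw [integrableOn_const_iff (by simp)] at this
    simpa using this
  rw [integral_indicator hmB] at h2
  rw [setIntegral_const, smul_eq_mul, mul_one, Measure.real] at h2
  exact ((ENNReal.toReal_eq_zero_iff _).1 h2).resolve_right h4.ne

theorem posi {O : Set (EE n)} (hO : IsOpen O) {z : EE n} (hz : z ∈ O) (hz0 : z ≠ 0) :
    0 < Hm (O ∩ sphere 0 ‖z‖) := by
  obtain ⟨C, hC⟩ := sw_vol n
  obtain ⟨δ, hδ, hball⟩ := Metric.isOpen_iff.1 hO z hz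
  set p := ‖z‖ with hp
  have hp0 : 0 < p := norm_pos_iff.2 hz0
  set ε := min δ p / 3 with hε
  have hε0 : 0 < ε := by have := lt_min hδ hp0; positivity
  have hεδ : 3 * ε ≤ δ := by rw [hε]; linarith [min_le_left δ p]
  have hεp : 3 * ε ≤ p := by rw [hε]; linarith [min_le_right δ p]
  set h : EE n := (2 * ε / p) • z with hh
  have hhn : ‖h‖ = 2 * ε := by
    rw [hh, norm_smul, Real.norm_of_nonneg (by positivity), ← hp]; field_simp
  have hsub : ball (z - (ε / p) • z) (ε / 2) ⊆ sw (-h) (O ∩ sphere 0 p) := by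
    intro x hx
    rw [mem_ball, dist_eq_norm] at hx
    have ha : ‖x‖ < p := by
      have h1 : x = (x - (z - (ε / p) • z)) + (1 - ε / p) • z := by module
      have h2 : ‖(1 - ε / p) • z‖ = p - ε := by
        have : ε / p ≤ 1 := by rw [div_le_one hp0]; linarith
        rw [norm_smul, Real.norm_of_nonneg (by linarith), ← hp]; field_simp
      rw [h1]; refine (norm_add_le _ _).trans_lt ?_; rw [h2]; linarith
    have hb : p < ‖x + h‖ := by
      have h1 : (1 + ε / p) • z = (x + h) - (x - (z - (ε / p) • z)) := by rw [hh]; module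
      have h2 : ‖(1 + ε / p) • z‖ = p + ε := by
        rw [norm_smul, Real.norm_of_nonneg (by positivity), ← hp]; field_simp
      have h3 := norm_sub_le (x + h) (x - (z - (ε / p) • z))
      rw [← h1, h2] at h3; linarith
    have hcont : Continuous fun s : ℝ => ‖x + s • h‖ := by fun_prop
    obtain ⟨s, hs, hsp⟩ := intermediate_value_Icc (zero_le_one' ℝ) hcont.continuousOn
      (show p ∈ Icc ‖x + (0 : ℝ) • h‖ ‖x + (1 : ℝ) • h‖ by
        rw [zero_smul, one_smul, add_zero]; exact ⟨ha.le, hb.le⟩)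
    refine ⟨x + s • h, ⟨hball ?_, by simpa using hsp⟩, s, hs, by module⟩
    rw [mem_ball, dist_eq_norm]
    have h1 : x + s • h - z = (x - (z - (ε / p) • z)) + ((2 * s - 1) * (ε / p)) • z := by rw [hh]; module
    have h2 : ‖((2 * s - 1) * (ε / p)) • z‖ ≤ ε := by
      rw [norm_smul, ← hp, Real.norm_eq_abs, abs_mul, abs_of_pos (by positivity : 0 < ε / p)]
      have : |2 * s - 1| ≤ 1 := abs_le.2 ⟨by linarith [hs.1], by linarith [hs.2]⟩
      calc |2 * s - 1| * (ε / p) * p ≤ 1 * (ε / p) * p := by gcongr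
        _ = ε := by field_simp
    rw [h1]; refine (norm_add_le _ _).trans_lt ?_; linarith
  have hne : -h ≠ 0 := by
    rw [neg_ne_zero, ← norm_ne_zero_iff, hhn]; positivity
  have h1 := (measure_mono hsub).trans (hC (-h) (O ∩ sphere 0 p) hne)
  rw [pos_iff_ne_zero]
  intro h0
  rw [h0, mul_zero, nonpos_iff_eq_zero] at h1
  exact (measure_ball_pos volume _ (by positivity)).ne' h1

def Zc (e : EE n) (ρ : ℝ) (A : Set ℝ) : Set (EE n) := {b | ∃ s ∈ A, ∃ ω, Om e ω ∧ b = s • e + ρ • ω}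

theorem Zc_dist {e ω ω' : EE n} (he : ‖e‖ = 1) (h : Om e ω) (h' : Om e ω') (s s' ρ : ℝ) :
    dist (s • e + ρ • ω) (s' • e + ρ • ω') ^ 2 = (s - s') ^ 2 + ρ ^ 2 * dist ω ω' ^ 2 := by
  rw [dist_eq_norm, dist_eq_norm, show s • e + ρ • ω - (s' • e + ρ • ω') = (s - s') • e + ρ • (ω - ω') by module,
    norm_add_sq_real, inner_smul_left, inner_smul_right, inner_sub_right, h.2, h'.2, norm_smul, norm_smul, he]
  simp [mul_pow]

theorem Zc_inner {e ω : EE n} (he : ‖e‖ = 1) (h : Om e ω) (s ρ : ℝ) :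
    inner ℝ e (s • e + ρ • ω) = s := by
  rw [inner_add_right, inner_smul_right, inner_smul_right, h.2, real_inner_self_eq_norm_sq, he]; simp

theorem Zc_eq {e : EE n} (he : ‖e‖ = 1) {ρ : ℝ} (A : Set ℝ) :
    Zc e ρ A = (fun w : EE n => inner ℝ e w) ⁻¹' A ∩ Zc e ρ univ := by
  ext b; constructor
  · rintro ⟨s, hs, ω, hω, rfl⟩
    exact ⟨by simpa only [mem_preimage, Zc_inner he hω] using hs, s, trivial, ω, hω, rfl⟩
  · rintro ⟨h1, s, -, ω, hω, rfl⟩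
    exact ⟨s, by simpa only [mem_preimage, Zc_inner he hω] using h1, ω, hω, rfl⟩

theorem Zc_haar {e : EE n} (he : ‖e‖ = 1) {ρ : ℝ} {a b : ℝ} (hab : a < b)
    (h0 : Hm (Zc e ρ (Ioo a b)) ≠ 0) (ht : Hm (Zc e ρ (Ioo a b)) ≠ ⊤) :
    ∃ c : ℝ≥0, 0 < c ∧ ∀ A : Set ℝ, MeasurableSet A → Hm (Zc e ρ A) = c * volume A := by
  have hcont : Continuous (fun w : EE n => (inner ℝ e w : ℝ)) := by fun_prop
  set lam : Measure ℝ := (μH[n].restrict (Zc e ρ univ)).map (fun w : EE n => inner ℝ e w) with hlam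
  have hap : ∀ A : Set ℝ, MeasurableSet A → lam A = Hm (Zc e ρ A) := fun A hA => by
    rw [hlam, Measure.map_apply hcont.measurable hA, Measure.restrict_apply (hcont.measurable hA), ← Zc_eq he]
  have htr : ∀ (t : ℝ) (A : Set ℝ), Hm (Zc e ρ ((fun s => t + s) ⁻¹' A)) = Hm (Zc e ρ A) := by
    intro t A
    have : Zc e ρ ((fun s => t + s) ⁻¹' A) = (IsometryEquiv.addLeft (t • e)) ⁻¹' (Zc e ρ A) := by
      ext b; constructor
      · rintro ⟨s, hs, ω, hω, rfl⟩
        exact ⟨t + s, hs, ω, hω, by simp; module⟩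
      · rintro ⟨s, hs, ω, hω, h⟩
        refine ⟨s - t, by simpa using hs, ω, hω, ?_⟩
        have h' : t • e + b = s • e + ρ • ω := h
        rw [sub_smul, eq_sub_of_add_eq' h']; abel
    rw [this, IsometryEquiv.hausdorffMeasure_preimage]
  have hinv : lam.IsAddLeftInvariant := ⟨fun t => by
    ext A hA
    rw [Measure.map_apply (measurable_const_add t) hA, hap _ (measurable_const_add t hA), hap _ hA, htr]⟩
  have hfin : IsLocallyFiniteMeasure lam := ⟨fun x => by
    refine ⟨(fun s => (a + b) / 2 - x + s) ⁻¹' (Ioo a b), (isOpen_Ioo.preimage (by fun_prop)).mem_nhds ?_, ?_⟩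
    · simp; constructor <;> linarith
    · rw [hap _ (measurable_const_add _ measurableSet_Ioo), htr]; exact ht.lt_top⟩
  have heq := Measure.isAddLeftInvariant_eq_smul lam volume
  set c := lam.addHaarScalarFactor volume
  refine ⟨c, ?_, fun A hA => ?_⟩
  · rw [pos_iff_ne_zero]
    intro hc
    rw [hc, zero_smul] at heq
    rw [← hap _ measurableSet_Ioo, heq] at h0
    simp at h0
  · rw [← hap A hA, heq]; rfl

set_option maxHeartbeats 1000000 in
theorem loc1 {e : EE n} (he : ‖e‖ = 1) {p a K : ℝ} (hp : 0 < p) (ha : a ∈ Ioo 0 π) (hK : 1 < K) :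
    ∃ δ η c ρ : ℝ, 0 < δ ∧ 0 < η ∧ 0 < c ∧ 0 < ρ ∧ 0 < a - η ∧ a + η < π ∧
      ∀ r r' θ θ' ω ω', r ∈ Icc p (p + δ) → r' ∈ Icc p (p + δ) → θ ∈ Icc (a - η) (a + η) → θ' ∈ Icc (a - η) (a + η) →
        Om e ω → Om e ω' →
        (r - r') ^ 2 + (c * (θ - θ')) ^ 2 + ρ ^ 2 * dist ω ω' ^ 2 ≤ dist (W e r θ ω) (W e r' θ' ω') ^ 2 ∧
        dist (W e r θ ω) (W e r' θ' ω') ^ 2 ≤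
          K ^ 2 * ((r - r') ^ 2 + (c * (θ - θ')) ^ 2 + ρ ^ 2 * dist ω ω' ^ 2) := by
  obtain ⟨κ, hκ0, hκ1, hκK⟩ : ∃ κ : ℝ, 0 < κ ∧ κ < 1 ∧ 1 ≤ K * κ ^ 3 := by
    have h1 : 0 < 1 - 1 / K := by
      rw [sub_pos, div_lt_one (by linarith)]; exact hK
    have h2 : 0 < 1 / K := by positivity
    refine ⟨1 - (1 - 1 / K) / 3, by linarith, by linarith, ?_⟩
    have h3 := one_add_mul_le_pow (a := -((1 - 1 / K) / 3)) (by linarith) 3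
    have h4 : 1 / K ≤ (1 - (1 - 1 / K) / 3) ^ 3 := by
      push_cast at h3; rw [← sub_eq_add_neg] at h3; linarith
    calc 1 = K * (1 / K) := by field_simp
      _ ≤ _ := by gcongr
  have hs : 0 < Real.sin a := Real.sin_pos_of_mem_Ioo ha
  set s := Real.sin a
  have hev : ∀ᶠ θ in 𝓝 a, (κ * s < Real.sin θ ∧ Real.sin θ < κ⁻¹ * s) ∧ θ ∈ Ioo 0 π := by
    refine Eventually.and (Eventually.and ?_ ?_) (Ioo_mem_nhds ha.1 ha.2)
    · exact Real.continuous_sin.continuousAt.eventually (lt_mem_nhds (by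
        change κ * s < s; nlinarith))
    · refine Real.continuous_sin.continuousAt.eventually (gt_mem_nhds ?_)
      change s < κ⁻¹ * s
      have := (one_lt_inv₀ hκ0).2 hκ1
      nlinarith
  obtain ⟨ε, hε, hball⟩ := Metric.eventually_nhds_iff.1 hev
  have hκ2 : 0 < 1 - κ ^ 2 := by nlinarith
  set η := min (ε / 2) ((1 - κ ^ 2) / 4) with hη
  have hη0 : 0 < η := lt_min (by linarith) (by linarith)
  have hη1 : η < ε := (min_le_left _ _).trans_lt (by linarith)
  have hη2 : η ≤ (1 - κ ^ 2) / 4 := min_le_right _ _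
  have hin : ∀ θ ∈ Icc (a - η) (a + η), (κ * s < Real.sin θ ∧ Real.sin θ < κ⁻¹ * s) ∧ θ ∈ Ioo 0 π := by
    intro θ hθ
    refine hball ?_
    rw [Real.dist_eq, abs_lt]; constructor <;> linarith [hθ.1, hθ.2]
  have hκi : 1 < κ⁻¹ := (one_lt_inv₀ hκ0).2 hκ1
  refine ⟨p * (κ⁻¹ - 1), η, κ * p, κ * p * s, mul_pos hp (by linarith), hη0, by positivity, by positivity,
    (hin (a - η) ⟨le_rfl, by linarith⟩).2.1, (hin (a + η) ⟨by linarith, le_rfl⟩).2.2, ?_⟩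
  intro r r' θ θ' ω ω' hr hr' hθ hθ' hω hω'
  rw [W_dist he hω hω']
  have e1 : p * p ≤ r * r' := mul_le_mul hr.1 hr'.1 hp.le (by linarith [hr.1])
  have e2 : κ ^ 2 * (r * r') ≤ p ^ 2 := by
    have h1 : κ * r ≤ p := by
      calc κ * r ≤ κ * (p + p * (κ⁻¹ - 1)) := by gcongr; exact hr.2
        _ = p := by field_simp; ring
    have h2 : κ * r' ≤ p := by
      calc κ * r' ≤ κ * (p + p * (κ⁻¹ - 1)) := by gcongr; exact hr'.2
        _ = p := by field_simp; ring
    have : (κ * r) * (κ * r') ≤ p * p := mul_le_mul h1 h2 (mul_nonneg hκ0.le (hp.le.trans hr'.1)) hp.le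
    nlinarith
  obtain ⟨⟨s1, s2⟩, -⟩ := hin θ hθ
  obtain ⟨⟨s1', s2'⟩, -⟩ := hin θ' hθ'
  have hp1 : 0 < κ * s := by positivity
  have e3 : (κ * s) * (κ * s) ≤ Real.sin θ * Real.sin θ' := mul_le_mul s1.le s1'.le hp1.le (by linarith)
  have e4 : κ ^ 2 * (Real.sin θ * Real.sin θ') ≤ s ^ 2 := by
    have h1 : κ * Real.sin θ ≤ s := by
      calc κ * Real.sin θ ≤ κ * (κ⁻¹ * s) := by gcongr
        _ = s := by field_simp
    have h2 : κ * Real.sin θ' ≤ s := by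
      calc κ * Real.sin θ' ≤ κ * (κ⁻¹ * s) := by gcongr
        _ = s := by field_simp
    have : (κ * Real.sin θ) * (κ * Real.sin θ') ≤ s * s := mul_le_mul h1 h2 (by
      have : 0 < Real.sin θ' := by linarith
      positivity) hs.le
    nlinarith
  have e5 : 2 * (1 - Real.cos (θ - θ')) ≤ (θ - θ') ^ 2 := by
    linarith [Real.one_sub_sq_div_two_le_cos (x := θ - θ')]
  have hΔ : |θ - θ'| ≤ 2 * η := abs_le.2 ⟨by linarith [hθ.1, hθ'.2], by linarith [hθ.2, hθ'.1]⟩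
  have e6 : κ ^ 2 * (θ - θ') ^ 2 ≤ 2 * (1 - Real.cos (θ - θ')) := by
    have hΔ1 : |θ - θ'| ≤ 1 := by nlinarith [sq_nonneg κ]
    have h1 := (abs_le.1 (Real.cos_bound hΔ1)).2
    have h2 : |θ - θ'| ^ 4 = (θ - θ') ^ 2 * (θ - θ') ^ 2 := by
      rw [← sq_abs]; ring
    have h3 : (θ - θ') ^ 2 ≤ 1 - κ ^ 2 := by
      rw [← sq_abs]; nlinarith [abs_nonneg (θ - θ'), sq_nonneg κ]
    have h4 := mul_le_mul_of_nonneg_left h3 (sq_nonneg (θ - θ'))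
    rw [h2] at h1
    nlinarith [mul_nonneg (sq_nonneg (θ - θ')) (sq_nonneg (θ - θ'))]
  have hD : 0 ≤ dist ω ω' ^ 2 := sq_nonneg _
  have hrr : 0 < r * r' := by nlinarith
  have hss : 0 < Real.sin θ * Real.sin θ' := by nlinarith
  have hq : 0 ≤ 2 * (1 - Real.cos (θ - θ')) := le_trans (by positivity) e6
  have hK6 : 1 ≤ K ^ 2 * κ ^ 6 := by
    calc 1 ≤ (K * κ ^ 3) ^ 2 := one_le_pow₀ hκK
      _ = _ := by ring
  constructor
  · have g1 : (κ * p * (θ - θ')) ^ 2 ≤ 2 * (r * r') * (1 - Real.cos (θ - θ')) := by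
      calc (κ * p * (θ - θ')) ^ 2 = (p * p) * (κ ^ 2 * (θ - θ') ^ 2) := by ring
        _ ≤ (r * r') * (2 * (1 - Real.cos (θ - θ'))) := mul_le_mul e1 e6 (by positivity) hrr.le
        _ = _ := by ring
    have g2 : (κ * p * s) ^ 2 ≤ r * r' * (Real.sin θ * Real.sin θ') := by
      calc (κ * p * s) ^ 2 = (p * p) * ((κ * s) * (κ * s)) := by ring
        _ ≤ _ := mul_le_mul e1 e3 (by positivity) hrr.le
    have g3 := mul_le_mul_of_nonneg_right g2 hD
    linarith
  · have g0 : (r - r') ^ 2 ≤ K ^ 2 * (r - r') ^ 2 := by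
      exact le_mul_of_one_le_left (sq_nonneg _) (one_le_pow₀ hK.le)
    have g1 : 2 * (r * r') * (1 - Real.cos (θ - θ')) ≤ K ^ 2 * (κ * p * (θ - θ')) ^ 2 := by
      have h1 : κ ^ 2 * (r * r') * (2 * (1 - Real.cos (θ - θ'))) ≤ p ^ 2 * (θ - θ') ^ 2 :=
        mul_le_mul e2 e5 hq (by positivity)
      have h2 : 0 ≤ 2 * (r * r') * (1 - Real.cos (θ - θ')) := by nlinarith
      have h3 : K ^ 2 * κ ^ 6 ≤ K ^ 2 * κ ^ 4 := by
        have : κ ^ 6 ≤ κ ^ 4 := pow_le_pow_of_le_one hκ0.le hκ1.le (by norm_num)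
        gcongr
      calc 2 * (r * r') * (1 - Real.cos (θ - θ')) ≤ (K ^ 2 * κ ^ 4) * (2 * (r * r') * (1 - Real.cos (θ - θ'))) :=
            le_mul_of_one_le_left h2 (hK6.trans h3)
        _ = K ^ 2 * κ ^ 2 * (κ ^ 2 * (r * r') * (2 * (1 - Real.cos (θ - θ')))) := by ring
        _ ≤ K ^ 2 * κ ^ 2 * (p ^ 2 * (θ - θ') ^ 2) := by gcongr
        _ = _ := by ring
    have g2 : r * r' * (Real.sin θ * Real.sin θ') ≤ K ^ 2 * (κ * p * s) ^ 2 := by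
      have h1 : κ ^ 2 * (r * r') * (κ ^ 2 * (Real.sin θ * Real.sin θ')) ≤ p ^ 2 * s ^ 2 :=
        mul_le_mul e2 e4 (by positivity) (by positivity)
      calc r * r' * (Real.sin θ * Real.sin θ') ≤ (K ^ 2 * κ ^ 6) * (r * r' * (Real.sin θ * Real.sin θ')) :=
            le_mul_of_one_le_left (by positivity) hK6
        _ = K ^ 2 * κ ^ 2 * (κ ^ 2 * (r * r') * (κ ^ 2 * (Real.sin θ * Real.sin θ'))) := by ring
        _ ≤ K ^ 2 * κ ^ 2 * (p ^ 2 * s ^ 2) := by gcongr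
        _ = _ := by ring
    have g3 := mul_le_mul_of_nonneg_right g2 hD
    rw [mul_add, mul_add, ← mul_assoc (K ^ 2) ((κ * p * s) ^ 2)]
    linarith

theorem W_cos_mem (hn : 1 ≤ n) {e : EE n} (he : ‖e‖ = 1) {t1 t2 : ℝ} (h1 : t1 ≤ π) (h2 : 0 ≤ t2)
    {w : EE n} (hw : w ≠ 0) (ha : ‖w‖ * Real.cos t2 < inner ℝ w e) (hb : inner ℝ w e < ‖w‖ * Real.cos t1) :
    ∃ θ ∈ Ioo t1 t2, ∃ ω, Om e ω ∧ w = W e ‖w‖ θ ω := by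
  obtain ⟨θ, hθ, ω, hω, hW⟩ := exists_W hn he w
  have h3 := W_inner he hω ‖w‖ θ
  rw [← hW] at h3
  have h4 : 0 < ‖w‖ := norm_pos_iff.2 hw
  rw [h3] at ha hb
  have ha' := lt_of_mul_lt_mul_left ha h4.le
  have hb' := lt_of_mul_lt_mul_left hb h4.le
  refine ⟨θ, ⟨?_, ?_⟩, ω, hω, hW⟩
  · by_contra h
    push Not at h
    exact absurd (Real.cos_le_cos_of_nonneg_of_le_pi hθ.1 h1 h) (not_le.2 hb')
  · by_contra h
    push Not at h
    exact absurd (Real.cos_le_cos_of_nonneg_of_le_pi h2 hθ.2 h) (not_le.2 ha')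

theorem posi_band (hn : 1 ≤ n) {e : EE n} (he : ‖e‖ = 1) {r t1 t2 : ℝ} (hr : 0 < r) (h1 : 0 ≤ t1)
    (h12 : t1 < t2) (h2 : t2 ≤ π) :
    0 < Hm {w : EE n | ∃ θ ∈ Ioo t1 t2, ∃ ω, Om e ω ∧ w = W e r θ ω} := by
  obtain ⟨ω, hω⟩ := exists_Om hn e
  set t := (t1 + t2) / 2 with ht
  set z := W e r t ω
  have hz : ‖z‖ = r := W_norm he hω hr.le _
  have hi : inner ℝ z e = r * Real.cos t := W_inner he hω r t
  set O : Set (EE n) := {w | ‖w‖ * Real.cos t2 < inner ℝ w e} ∩ {w | inner ℝ w e < ‖w‖ * Real.cos t1}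
  have hO : IsOpen O := (isOpen_lt (by fun_prop) (by fun_prop)).inter (isOpen_lt (by fun_prop) (by fun_prop))
  have hzO : z ∈ O := by
    constructor
    · change ‖z‖ * Real.cos t2 < inner ℝ z e
      rw [hz, hi]
      exact mul_lt_mul_of_pos_left (Real.cos_lt_cos_of_nonneg_of_le_pi (by linarith) h2 (by linarith)) hr
    · change inner ℝ z e < ‖z‖ * Real.cos t1
      rw [hz, hi]
      exact mul_lt_mul_of_pos_left (Real.cos_lt_cos_of_nonneg_of_le_pi h1 (by linarith) (by linarith)) hr
  have hz0 : z ≠ 0 := norm_ne_zero_iff.1 (by rw [hz]; exact hr.ne')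
  refine (posi hO hzO hz0).trans_le (measure_mono ?_)
  rintro w ⟨⟨ha, hb⟩, hw⟩
  have hwr : ‖w‖ = r := by simpa [hz] using hw
  have hw0 : w ≠ 0 := norm_ne_zero_iff.1 (by rw [hwr]; exact hr.ne')
  obtain ⟨θ, hθ, ω, hω, hW⟩ := W_cos_mem hn he (by linarith) (by linarith) hw0 ha hb
  exact ⟨θ, hθ, ω, hω, by rw [← hwr]; exact hW⟩

theorem loc (hn : 1 ≤ n) {e : EE n} (he : ‖e‖ = 1) {p a K : ℝ} (hp : 0 < p) (ha : a ∈ Ioo 0 π) (hK : 1 < K) :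
    ∃ δ η c ρ : ℝ, 0 < δ ∧ 0 < η ∧ 0 < c ∧ 0 < ρ ∧ 0 < a - η ∧ a + η < π ∧
      (∀ r r' θ θ' ω ω', r ∈ Icc p (p + δ) → r' ∈ Icc p (p + δ) → θ ∈ Icc (a - η) (a + η) → θ' ∈ Icc (a - η) (a + η) →
        Om e ω → Om e ω' →
        (r - r') ^ 2 + (c * (θ - θ')) ^ 2 + ρ ^ 2 * dist ω ω' ^ 2 ≤ dist (W e r θ ω) (W e r' θ' ω') ^ 2 ∧
        dist (W e r θ ω) (W e r' θ' ω') ^ 2 ≤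
          K ^ 2 * ((r - r') ^ 2 + (c * (θ - θ')) ^ 2 + ρ ^ 2 * dist ω ω' ^ 2)) ∧
      ∃ l : ℝ≥0, 0 < l ∧ ∀ A : Set ℝ, MeasurableSet A → Hm (Zc e ρ A) = l * volume A := by
  obtain ⟨δ, η, c, ρ, hδ, hη, hc, hρ, h1, h2, h3⟩ := loc1 he hp ha hK
  refine ⟨δ, η, c, ρ, hδ, hη, hc, hρ, h1, h2, h3, ?_⟩
  set B := {w : EE n | ∃ θ ∈ Ioo (a - η) (a + η), ∃ ω, Om e ω ∧ w = W e p θ ω} with hB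
  have hB0 : 0 < Hm B := posi_band hn he hp h1.le (by linarith) h2.le
  have hBt : Hm B ≠ ⊤ := by
    obtain ⟨C, hC⟩ := sphere_haus n
    refine ne_top_of_le_ne_top (show (C : EN) * ofReal p ^ n ≠ ⊤ by finiteness) (le_trans (measure_mono ?_) (hC 0 p hp.le))
    rintro w ⟨θ, hθ, ω, hω, rfl⟩
    simp [W_norm he hω hp.le]
  set R : EE n → EE n → Prop := fun x b => ∃ θ ∈ Ioo (a - η) (a + η), ∃ ω, Om e ω ∧ x = W e p θ ω ∧ b = (c * θ) • e + ρ • ω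
  have hpp : p ∈ Icc p (p + δ) := ⟨le_rfl, by linarith⟩
  have hd : ∀ θ θ' ω ω', Om e ω → Om e ω' → dist ((c * θ) • e + ρ • ω) ((c * θ') • e + ρ • ω') ^ 2 =
      (p - p) ^ 2 + (c * (θ - θ')) ^ 2 + ρ ^ 2 * dist ω ω' ^ 2 := fun θ θ' ω ω' hω hω' => by
    rw [Zc_dist he hω hω']; ring
  have q1 : Hm (Zc e ρ (Ioo (c * (a - η)) (c * (a + η)))) ≤ ((1 : ℝ≥0) : EN) ^ n * Hm B := by
    refine haus_rel R 1 ?_ ?_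
    · rintro b ⟨s, hs, ω, hω, rfl⟩
      have hs' : s / c ∈ Ioo (a - η) (a + η) := ⟨by rw [lt_div_iff₀ hc]; linarith [hs.1], by rw [div_lt_iff₀ hc]; linarith [hs.2]⟩
      exact ⟨_, ⟨s / c, hs', ω, hω, rfl⟩, s / c, hs', ω, hω, rfl, by rw [mul_div_cancel₀ _ hc.ne']⟩
    · rintro _ _ _ _ ⟨θ, hθ, ω, hω, rfl, rfl⟩ ⟨θ', hθ', ω', hω', rfl, rfl⟩
      rw [NNReal.coe_one, one_mul]
      refine abs_le_of_sq_le_sq' ?_ dist_nonneg |>.2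
      rw [hd _ _ _ _ hω hω']
      exact (h3 _ _ _ _ _ _ hpp hpp (Ioo_subset_Icc_self hθ) (Ioo_subset_Icc_self hθ') hω hω').1
  have q2 : Hm B ≤ ((Real.toNNReal K : ℝ≥0) : EN) ^ n * Hm (Zc e ρ (Ioo (c * (a - η)) (c * (a + η)))) := by
    refine haus_rel (fun x y => R y x) _ ?_ ?_
    · rintro _ ⟨θ, hθ, ω, hω, rfl⟩
      exact ⟨_, ⟨c * θ, ⟨by gcongr; exact hθ.1, by gcongr; exact hθ.2⟩, ω, hω, rfl⟩, θ, hθ, ω, hω, rfl, rfl⟩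
    · rintro _ _ _ _ ⟨θ, hθ, ω, hω, rfl, rfl⟩ ⟨θ', hθ', ω', hω', rfl, rfl⟩
      rw [Real.coe_toNNReal _ (by linarith)]
      refine abs_le_of_sq_le_sq' ?_ (by positivity) |>.2
      rw [mul_pow, hd _ _ _ _ hω hω']
      exact (h3 _ _ _ _ _ _ hpp hpp (Ioo_subset_Icc_self hθ) (Ioo_subset_Icc_self hθ') hω hω').2
  refine Zc_haar he (a := c * (a - η)) (b := c * (a + η)) (by gcongr; linarith) ?_ ?_
  · intro h0
    rw [h0, mul_zero, nonpos_iff_eq_zero] at q2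
    exact hB0.ne' q2
  · rw [ENNReal.coe_one, one_pow, one_mul] at q1
    exact ne_top_of_le_ne_top hBt q1

theorem circle_null (hn : 1 ≤ n) {e : EE n} (he : ‖e‖ = 1) {p a : ℝ} (hp : 0 < p) (ha : a ∈ Ioo 0 π) :
    Hm {w : EE n | ∃ ω, Om e ω ∧ w = W e p a ω} = 0 := by
  obtain ⟨δ, η, c, ρ, hδ, hη, hc, hρ, h1, h2, h3, l, hl, hl2⟩ := loc hn he hp ha (show (1 : ℝ) < 2 by norm_num)
  have := haus_rel (n := n) (A := Zc e ρ {0}) (B := {w : EE n | ∃ ω, Om e ω ∧ w = W e p a ω})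
    (fun x w => ∃ ω, Om e ω ∧ x = (0 : ℝ) • e + ρ • ω ∧ w = W e p a ω) 2
    (by
      rintro _ ⟨ω, hω, rfl⟩
      exact ⟨_, ⟨0, rfl, ω, hω, rfl⟩, ω, hω, rfl, rfl⟩) (by
      rintro _ _ _ _ ⟨ω, hω, rfl, rfl⟩ ⟨ω', hω', rfl, rfl⟩
      refine abs_le_of_sq_le_sq' ?_ (by positivity) |>.2
      have hpp : p ∈ Icc p (p + δ) := ⟨le_rfl, by linarith⟩
      have haa : a ∈ Icc (a - η) (a + η) := ⟨by linarith, by linarith⟩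
      have := (h3 _ _ _ _ _ _ hpp hpp haa haa hω hω').2
      rw [mul_pow, Zc_dist he hω hω']
      simpa using this)
  rw [hl2 _ (measurableSet_singleton 0)] at this
  simpa using this

structure Prf (f : EE n → ℝ) (e : EE n) (U : ℕ → Set (EE n)) (E : Set (EE n)) (α : ℝ → ℝ) (V m : EN)
    (N : ℝ → ℝ) (Gd : Set ℝ) : Prop extends Cap f e U E α V m where
  gpos : ∀ r ∈ Gd, 0 < r
  gae : ∀ᵐ r, 0 < r → r ∈ Gd
  gfr : ∀ r ∈ Gd, ∀ k, Hm (frontier (U k) ∩ sphere 0 r) = 0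
  gsl : ∀ r ∈ Gd, Tendsto (fun k => Hm (symmDiff (U k) E ∩ sphere 0 r)) atTop (𝓝 0)
  nlim : ∀ r, Tendsto (fun k => (∫⁻ w in frontier (U k) ∩ ball 0 r, ofReal (f w) ∂Hm).toReal)
    (hyperfilter ℕ) (𝓝 (N r))
  mono : Monotone N
  n0 : ∀ r, 0 ≤ N r
  nm' : ∀ r, ofReal (N r) ≤ m
  cone : ∀ t1 t2 x0, 0 ≤ t1 → t1 < t2 → t2 ≤ π → 0 < x0 → ∃ T ∈ Ioo t1 t2,
    Tendsto (fun k => Hm ((symmDiff (U k) E ∪ {w | 0 < ‖w‖ ∧ ‖w‖ ∉ Gd}) ∩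
      {w | x0 ≤ ‖w‖ ∧ inner ℝ w e = ‖w‖ * Real.cos T})) atTop (𝓝 0)

variable {e : EE n} {U : ℕ → Set (EE n)} {E : Set (EE n)} {α : ℝ → ℝ} {V m : EN} {N : ℝ → ℝ} {Gd : Set ℝ}
local notation "Pf" => Prf f e U E α V m N Gd

theorem cone_slice {e : EE n} (he : ‖e‖ = 1) {A : ℕ → Set (EE n)} {C : EN} (hC : C ≠ ⊤)
    (hA : ∀ k, volume (A k) ≤ C * 2⁻¹ ^ k) {t1 t2 x0 : ℝ} (h1 : 0 ≤ t1) (h12 : t1 < t2) (h2 : t2 ≤ π) (hx : 0 < x0) :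
    ∃ T ∈ Ioo t1 t2, Tendsto (fun k => Hm (A k ∩
      {w | x0 ≤ ‖w‖ ∧ inner ℝ w e = ‖w‖ * Real.cos T})) atTop (𝓝 0) := by
  have hL : LipschitzOnWith 1 (fun w : EE n => (inner ℝ ((x0 / ‖w‖) • w) e : ℝ)) {w | x0 ≤ ‖w‖} := by
    refine LipschitzOnWith.of_dist_le_mul fun w hw w' hw' => ?_
    rw [NNReal.coe_one, one_mul, Real.dist_eq, ← inner_sub_left, dist_eq_norm]
    refine (abs_real_inner_le_norm _ _).trans ?_
    rw [he, mul_one]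
    exact proj_lip hx hw hw'
  obtain ⟨u, hu, huE⟩ := hL.extend_real
  have hg := slice_good hC hA hu
  have hlt : x0 * Real.cos t2 < x0 * Real.cos t1 :=
    mul_lt_mul_of_pos_left (Real.cos_lt_cos_of_nonneg_of_le_pi h1 h2 h12) hx
  obtain ⟨c, hc, hc2⟩ : ∃ c ∈ Ioo (x0 * Real.cos t2) (x0 * Real.cos t1),
      Tendsto (fun k => Hm (A k ∩ u ⁻¹' {c})) atTop (𝓝 0) := by
    by_contra hcon
    push Not at hcon
    have h0 : volume (Ioo (x0 * Real.cos t2) (x0 * Real.cos t1)) = 0 :=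
      measure_mono_null (fun c hc => hcon c hc) hg
    rw [Real.volume_Ioo, ENNReal.ofReal_eq_zero] at h0
    linarith
  have c1 : Real.cos t2 < c / x0 := by rw [lt_div_iff₀ hx]; linarith [hc.1]
  have c2 : c / x0 < Real.cos t1 := by rw [div_lt_iff₀ hx]; linarith [hc.2]
  have hcos : Real.cos (Real.arccos (c / x0)) = c / x0 :=
    Real.cos_arccos (by linarith [Real.neg_one_le_cos t2]) (by linarith [Real.cos_le_one t1])
  refine ⟨Real.arccos (c / x0), ⟨?_, ?_⟩, ?_⟩
  · by_contra h
    push Not at h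
    have := Real.cos_le_cos_of_nonneg_of_le_pi (Real.arccos_nonneg _) (by linarith) h
    rw [hcos] at this; linarith
  · by_contra h
    push Not at h
    have := Real.cos_le_cos_of_nonneg_of_le_pi (by linarith) (Real.arccos_le_pi _) h
    rw [hcos] at this; linarith
  · refine tendsto_of_tendsto_of_tendsto_of_le_of_le tendsto_const_nhds hc2 (fun _ => zero_le) fun k => measure_mono ?_
    rintro w ⟨hw, hw1, hw2⟩
    refine ⟨hw, ?_⟩
    have hw0 : 0 < ‖w‖ := hx.trans_le hw1
    rw [mem_preimage, mem_singleton_iff, ← huE hw1]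
    change inner ℝ ((x0 / ‖w‖) • w) e = c
    rw [real_inner_smul_left, hw2, hcos]
    field_simp

theorem exists_prf (hn : 1 ≤ n) (hf : GoodF f) {V m : EN}
    (hV : V ≠ ⊤) (hm : m = sInf {p | ∃ W : Set (EE n), IsOpen W ∧ wvol f W = V ∧ wper f W = p}) (hmt : m ≠ ⊤) :
    ∃ e U E α N Gd, Prf f e U E α V m N Gd := by
  obtain ⟨e, U, E, α, h⟩ := exists_cap hn hf hV hm hmt
  have hf0 : ofReal (f 0) ≠ 0 := by simpa using hf.pos 0
  have hvol : ∀ k, volume (symmDiff (U k) E) ≤ ((ofReal (f 0))⁻¹ * 2) * 2⁻¹ ^ k := fun k => by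
    rw [mul_assoc, mul_comm _⁻¹, ← div_eq_mul_inv, ENNReal.le_div_iff_mul_le (Or.inl hf0) (Or.inl (by simp)), mul_comm]
    exact (vol_le_wvol hf _).trans (h.dif k)
  have hCt : (ofReal (f 0))⁻¹ * 2 ≠ ⊤ := by finiteness
  have hpt : ∀ k, wper f (U k) ≠ ⊤ := fun k => ne_top_of_le_ne_top (by
    have : ((k : EN) + 1) ≠ 0 := by simp
    finiteness) (h.per k)
  set Gd : Set ℝ := {r | 0 < r ∧ (∀ k, Hm (frontier (U k) ∩ sphere 0 r) = 0) ∧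
    Tendsto (fun k => Hm (symmDiff (U k) E ∩ sphere 0 r)) atTop (𝓝 0)} with hGd
  have gae : ∀ᵐ r, 0 < r → r ∈ Gd := by
    have h1 := slice_good hCt hvol (lipschitzWith_one_norm (E := EE n))
    have h2 : ∀ᵐ r : ℝ, ∀ k, Hm (frontier (U k) ∩ sphere 0 r) = 0 := by
      rw [ae_all_iff]
      intro k
      have := (slice_countable (haus_ne_top hf (hpt k)) 0).measure_zero volume
      have := measure_eq_zero_iff_ae_notMem.1 this
      filter_upwards [this] with r hr
      simpa using hr
    filter_upwards [h1, h2] with r h1 h2 h3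
    refine ⟨h3, h2, ?_⟩
    convert h1 using 5
    ext w; simp
  set q : ℕ → ℝ → ℝ := fun k r => (∫⁻ w in frontier (U k) ∩ ball 0 r, ofReal (f w) ∂Hm).toReal with hq
  have hqle : ∀ k r, ∫⁻ w in frontier (U k) ∩ ball 0 r, ofReal (f w) ∂Hm ≤ wper f (U k) := fun k r =>
    lintegral_mono_set inter_subset_left
  have hqn : ∀ k r, ∫⁻ w in frontier (U k) ∩ ball 0 r, ofReal (f w) ∂Hm ≠ ⊤ := fun k r =>
    ne_top_of_le_ne_top (hpt k) (hqle k r)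
  have hqm : ∀ k, Monotone (q k) := fun k r r' hr =>
    ENNReal.toReal_mono (hqn k r') (lintegral_mono_set (inter_subset_inter_right _ (ball_subset_ball hr)))
  have hqb : ∀ k r, q k r ≤ m.toReal + ((k : ℝ) + 1)⁻¹ := fun k r => by
    have h1 : ((k : EN) + 1) ≠ 0 := by simp
    refine (ENNReal.toReal_mono (by finiteness) ((hqle k r).trans (h.per k))).trans_eq ?_
    rw [ENNReal.toReal_add hmt (by finiteness), ENNReal.toReal_inv, ENNReal.toReal_add (by simp) (by simp)]
    simp
  have hex : ∀ r, ∃ x, Tendsto (fun k => q k r) (hyperfilter ℕ) (𝓝 x) := fun r => by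
    obtain ⟨x, -, hx⟩ := (isCompact_Icc (a := (0 : ℝ)) (b := m.toReal + 1)).ultrafilter_le_nhds
      ((hyperfilter ℕ).map (fun k => q k r)) (by
        rw [le_principal_iff]
        refine Filter.mem_map.2 (Filter.univ_mem' fun k => ?_)
        refine ⟨ENNReal.toReal_nonneg, (hqb k r).trans ?_⟩
        have : ((k : ℝ) + 1)⁻¹ ≤ 1 := inv_le_one_of_one_le₀ (by linarith [Nat.cast_nonneg (α := ℝ) k])
        linarith)
    exact ⟨x, hx⟩
  choose N hN using hex
  refine ⟨e, U, E, α, N, Gd, { h with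
    gpos := fun r hr => hr.1
    gae := gae
    gfr := fun r hr => hr.2.1
    gsl := fun r hr => hr.2.2
    nlim := hN
    mono := fun r r' hr => le_of_tendsto_of_tendsto' (hN r) (hN r') fun k => hqm k hr
    n0 := fun r => ge_of_tendsto' (hN r) fun k => ENNReal.toReal_nonneg
    nm' := fun r => ?_
    cone := fun t1 t2 x0 h1 h12 h2 hx => cone_slice h.he hCt (fun k => ?_) h1 h12 h2 hx }⟩
  · refine ENNReal.ofReal_le_of_le_toReal ?_
    have h1 : Tendsto (fun k : ℕ => m.toReal + ((k : ℝ) + 1)⁻¹) (hyperfilter ℕ) (𝓝 (m.toReal + 0)) := by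
      have := (tendsto_one_div_add_atTop_nhds_zero_nat (𝕜 := ℝ)).const_add m.toReal
      simp only [one_div] at this
      refine this.mono_left ?_
      rw [← Nat.cofinite_eq_atTop]; exact hyperfilter_le_cofinite
    have := le_of_tendsto_of_tendsto' (hN r) h1 fun k => hqb k r
    simpa using this
  · refine (measure_union_le _ _).trans ?_
    have h0 : volume {w : EE n | 0 < ‖w‖ ∧ ‖w‖ ∉ Gd} = 0 := by
      refine norm_null (A := {r | 0 < r ∧ r ∉ Gd}) ?_
      rw [measure_eq_zero_iff_ae_notMem]
      filter_upwards [gae] with r hr hr2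
      exact hr2.2 (hr hr2.1)
    rw [h0, add_zero]
    exact hvol k

theorem Prf.lim (hf : GoodF f) (h : Pf) (hmt : m ≠ ⊤)
    {x y : ℝ} (hy : y ∈ Gd) (hxy : x < y) {B : Set (EE n)} {c : EN}
    (hc : c ≠ ⊤) (hcf : ∀ w : EE n, x ≤ ‖w‖ → c ≤ ofReal (f w)) {err : ℕ → EN} (he : Tendsto err atTop (𝓝 0))
    (hB : ∀ k, Hm B ≤ Hm (frontier (U k) ∩ (closedBall 0 y \ ball 0 x)) + err k) :
    c * Hm B ≤ ofReal (N y - N x) := by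
  have hpt : ∀ k, wper f (U k) ≠ ⊤ := fun k => ne_top_of_le_ne_top (by
    have : ((k : EN) + 1) ≠ 0 := by simp
    finiteness) (h.per k)
  have hqn : ∀ k r, ∫⁻ w in frontier (U k) ∩ ball 0 r, ofReal (f w) ∂Hm ≠ ⊤ := fun k r =>
    ne_top_of_le_ne_top (hpt k) (lintegral_mono_set inter_subset_left)
  have key : ∀ k, c * Hm B ≤ ofReal ((∫⁻ w in frontier (U k) ∩ ball 0 y, ofReal (f w) ∂Hm).toReal -
      (∫⁻ w in frontier (U k) ∩ ball 0 x, ofReal (f w) ∂Hm).toReal) + c * err k := by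
    intro k
    rw [ENNReal.ofReal_sub _ ENNReal.toReal_nonneg, ENNReal.ofReal_toReal (hqn k y), ENNReal.ofReal_toReal (hqn k x)]
    refine (mul_le_mul' le_rfl (hB k)).trans ?_
    rw [mul_add]
    refine add_le_add_left ?_ _
    refine ENNReal.le_sub_of_add_le_left (hqn k x) ?_
    have hsp : Hm (frontier (U k) ∩ (closedBall 0 y \ ball 0 x)) ≤ Hm (frontier (U k) ∩ (ball 0 y \ ball 0 x)) := by
      calc _ ≤ Hm ((frontier (U k) ∩ (ball 0 y \ ball 0 x)) ∪ (frontier (U k) ∩ sphere 0 y)) := by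
            refine measure_mono ?_
            rintro w ⟨h1, h2, h3⟩
            rcases (mem_closedBall.1 h2).lt_or_eq with h4 | h4
            · exact Or.inl ⟨h1, h4, h3⟩
            · exact Or.inr ⟨h1, h4⟩
        _ ≤ _ := by
            refine (measure_union_le _ _).trans ?_
            rw [h.gfr y hy k, add_zero]
    have hmeas : MeasurableSet (frontier (U k) ∩ (ball 0 y \ ball 0 x)) :=
      isClosed_frontier.measurableSet.inter (measurableSet_ball.diff measurableSet_ball)
    have h1 : c * Hm (frontier (U k) ∩ (ball 0 y \ ball 0 x)) ≤
        ∫⁻ w in frontier (U k) ∩ (ball 0 y \ ball 0 x), ofReal (f w) ∂Hm := by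
      rw [← setLIntegral_const]
      refine setLIntegral_mono hf.meas fun w hw => hcf w ?_
      have := hw.2.2
      simpa using this
    refine (add_le_add_right ((mul_le_mul' le_rfl hsp).trans h1) _).trans ?_
    rw [← lintegral_union hmeas]
    · refine lintegral_mono_set ?_
      rintro w (⟨h1, h2⟩ | ⟨h1, h2⟩)
      · exact ⟨h1, ball_subset_ball hxy.le h2⟩
      · exact ⟨h1, h2.1⟩
    · rw [Set.disjoint_left]
      rintro w ⟨h1, h2⟩ ⟨h3, h4⟩
      exact h4.2 h2
  have hhy : ((hyperfilter ℕ : Ultrafilter ℕ) : Filter ℕ) ≤ atTop := by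
    rw [← Nat.cofinite_eq_atTop]; exact hyperfilter_le_cofinite
  have hlim := (ENNReal.tendsto_ofReal ((h.nlim y).sub (h.nlim x))).add
    ((ENNReal.Tendsto.const_mul he (Or.inr hc)).mono_left hhy)
  rw [mul_zero, add_zero] at hlim
  exact ge_of_tendsto' hlim key

def Bd (e : EE n) (r t1 t2 : ℝ) : Set (EE n) := {w | ∃ θ ∈ Ioo t1 t2, ∃ ω, Om e ω ∧ w = W e r θ ω}

theorem W_scale (e ω : EE n) {x : ℝ} (hx : x ≠ 0) (y θ : ℝ) : W e y θ ω = (y / x) • W e x θ ω := by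
  unfold W
  rw [smul_add, smul_smul, smul_smul]
  congr 2 <;> field_simp

theorem Bd_mono {e : EE n} (he : ‖e‖ = 1) {x y : ℝ} (hx : 0 < x) (hxy : x ≤ y) (t1 t2 : ℝ) :
    Hm (Bd e x t1 t2) ≤ Hm (Bd e y t1 t2) := by
  have hy : 0 < y := hx.trans_le hxy
  refine le_trans (measure_mono ?_) (proj_haus hx (Bd e y t1 t2) ?_)
  · rintro _ ⟨θ, hθ, ω, hω, rfl⟩
    refine ⟨W e y θ ω, ⟨θ, hθ, ω, hω, rfl⟩, ?_⟩
    simp only [W_norm he hω hy.le]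
    exact (W_scale e ω hy.ne' x θ).symm
  · rintro _ ⟨θ, hθ, ω, hω, rfl⟩
    rw [W_norm he hω hy.le]; exact hxy

theorem Prf.RL (hf : GoodF f) (h : Pf) (hmt : m ≠ ⊤)
    {x y : ℝ} (hx : x ∈ Gd) (hy : y ∈ Gd) (hxy : x < y) {c : EN}
    (hc : c ≠ ⊤) (hcf : ∀ w : EE n, x ≤ ‖w‖ → c ≤ ofReal (f w)) {t1 t2 : ℝ} (h1 : 0 ≤ t1) (h2 : t2 ≤ π)
    (hα : (α x ≤ t1 ∧ t2 ≤ α y) ∨ (α y ≤ t1 ∧ t2 ≤ α x)) :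
    c * Hm (Bd e x t1 t2) ≤ ofReal (N y - N x) := by
  have hx0 := h.gpos x hx
  have hy0 := h.gpos y hy
  refine h.lim hf hmt hy hxy hc hcf (err := fun k => Hm (symmDiff (U k) E ∩ sphere 0 x) +
    Hm (symmDiff (U k) E ∩ sphere 0 y)) (by simpa using (h.gsl x hx).add (h.gsl y hy)) fun k => ?_
  set pr : EE n → EE n := fun w => (x / ‖w‖) • w
  have hsub : Bd e x t1 t2 ⊆ (pr '' (frontier (U k) ∩ (closedBall 0 y \ ball 0 x))) ∪
      ((symmDiff (U k) E ∩ sphere 0 x) ∪ pr '' (symmDiff (U k) E ∩ sphere 0 y)) := by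
    rintro _ ⟨θ, hθ, ω, hω, rfl⟩
    set z := W e x θ ω with hz
    have hzn : ‖z‖ = x := W_norm h.he hω hx0.le _
    set z' := W e y θ ω with hz'
    have hzn' : ‖z'‖ = y := W_norm h.he hω hy0.le _
    have hzz : z' = (y / x) • z := W_scale e ω hx0.ne' y θ
    by_cases hb1 : z ∈ symmDiff (U k) E
    · exact Or.inr (Or.inl ⟨hb1, by simpa using hzn⟩)
    by_cases hb2 : z' ∈ symmDiff (U k) E
    · refine Or.inr (Or.inr ⟨z', ⟨hb2, by simpa using hzn'⟩, ?_⟩)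
      change (x / ‖z'‖) • z' = z
      rw [hzn', hzz, smul_smul]
      rw [show x / y * (y / x) = 1 by field_simp, one_smul]
    left
    have hU : (z ∈ U k ∧ z' ∉ U k) ∨ (z' ∈ U k ∧ z ∉ U k) := by
      rw [mem_symmDiff] at hb1 hb2
      have hout := fun r (hr : 0 < r) (ha : α r ≤ t1) => h.out r θ ω hr (by linarith [hθ.2]) hω (by linarith [hθ.1])
      have hins := fun r (hr : 0 < r) (ha : t2 ≤ α r) => h.ins r θ ω hr (by linarith [hθ.1]) hω (by linarith [hθ.2])
      rcases hα with ⟨ha1, ha2⟩ | ⟨ha1, ha2⟩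
      · have := hout x hx0 ha1; have := hins y hy0 ha2; tauto
      · have := hout y hy0 ha1; have := hins x hx0 ha2; tauto
    have hfr : ∃ s ∈ Icc (1 : ℝ) (y / x), s • z ∈ frontier (U k) := by
      have hyx : 1 < y / x := by rw [one_lt_div hx0]; exact hxy
      rcases hU with ⟨ha, hb⟩ | ⟨ha, hb⟩
      · obtain ⟨s, hs, hs2⟩ := seg_frontier (h.op k) (x := z) (h := z' - z) ha (by simpa using hb)
        refine ⟨1 + s * (y / x - 1), ⟨?_, ?_⟩, ?_⟩
        · nlinarith [hs.1]
        · nlinarith [hs.2]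
        · rw [hzz] at hs2; convert hs2 using 1; module
      · obtain ⟨s, hs, hs2⟩ := seg_frontier (h.op k) (x := z') (h := z - z') ha (by simpa using hb)
        refine ⟨y / x + s * (1 - y / x), ⟨?_, ?_⟩, ?_⟩
        · nlinarith [hs.2]
        · nlinarith [hs.1]
        · rw [hzz] at hs2; convert hs2 using 1; module
    obtain ⟨s, hs, hs2⟩ := hfr
    have hs0 : 0 < s := by linarith [hs.1]
    have hsn : ‖s • z‖ = s * x := by rw [norm_smul, hzn, Real.norm_of_nonneg hs0.le]
    refine ⟨s • z, ⟨hs2, ?_, ?_⟩, ?_⟩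
    · rw [mem_closedBall_zero_iff, hsn]
      have := hs.2; rwa [le_div_iff₀ hx0] at this
    · rw [mem_ball_zero_iff, hsn]; nlinarith [hs.1]
    · change (x / ‖s • z‖) • s • z = z
      rw [hsn, smul_smul, show x / (s * x) * s = 1 by field_simp, one_smul]
  refine (measure_mono hsub).trans ((measure_union_le _ _).trans (add_le_add ?_ ((measure_union_le _ _).trans (add_le_add le_rfl ?_))))
  · refine proj_haus hx0 _ ?_
    rintro w ⟨-, -, hw⟩
    simpa using hw
  · refine proj_haus hx0 _ ?_
    rintro w ⟨-, hw⟩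
    have : ‖w‖ = y := by simpa using hw
    rw [this]; exact hxy.le

theorem Prf.alim (hn : 1 ≤ n) (hf : GoodF f) (h : Pf) (hmt : m ≠ ⊤)
    {p : ℝ} (hp : 0 < p) {F : Filter ℝ} (hF : F ≤ 𝓝 p) {l : ℝ} (hl : Tendsto N F (𝓝 l)) :
    ∃ a, Tendsto α (F ⊓ 𝓟 Gd) (𝓝 a) := by
  refine tendsto_of_no_upcrossings dense_univ ?_ ?_ ?_
  · rintro t1 - t2 - h12 ⟨hf1, hf2⟩
    have ht1 : 0 ≤ t1 := by
      obtain ⟨x, hx⟩ := hf1.exists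
      linarith [(h.rng x).1]
    have ht2 : t2 ≤ π := by
      obtain ⟨x, hx⟩ := hf2.exists
      linarith [(h.rng x).2]
    have hf0 : 0 < ofReal (f 0) := by simpa using hf.pos 0
    have hK : 0 < ofReal (f 0) * Hm (Bd e (p / 2) t1 t2) :=
      ENNReal.mul_pos hf0.ne' (posi_band hn h.he (by linarith) ht1 h12 ht2).ne'
    obtain ⟨ε, hε, hεK⟩ := ENNReal.lt_iff_exists_nnreal_btwn.1 hK
    have hε0 : (0 : ℝ) < ε := by exact_mod_cast hε
    have hev : ∀ᶠ r in F ⊓ 𝓟 Gd, (|N r - l| < ε / 2 ∧ p / 2 < r) ∧ r ∈ Gd := by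
      refine Eventually.and (Filter.Eventually.filter_mono inf_le_left ?_) (Filter.Eventually.filter_mono inf_le_right (mem_principal_self _))
      refine Eventually.and ?_ (hF (lt_mem_nhds (by linarith)))
      have := Metric.tendsto_nhds.1 hl (ε / 2) (by linarith)
      simpa [Real.dist_eq] using this
    have hmain : ∀ x y, x < y → x ∈ Gd → y ∈ Gd → p / 2 < x → |N x - l| < ε / 2 → |N y - l| < ε / 2 →
        ((α x ≤ t1 ∧ t2 ≤ α y) ∨ (α y ≤ t1 ∧ t2 ≤ α x)) → False := by
      intro x y hxy hx hy hpx hNx hNy hα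
      have h1 := h.RL hf hmt hx hy hxy (c := ofReal (f 0)) (by simp)
        (fun w _ => ENNReal.ofReal_le_ofReal (hf.mono _ _ (by simp))) ht1 ht2 hα
      have h2 := (mul_le_mul' le_rfl (Bd_mono h.he (by linarith) hpx.le t1 t2)).trans h1
      have h3 := hεK.trans_le h2
      rw [← ENNReal.ofReal_coe_nnreal, ENNReal.ofReal_lt_ofReal_iff_of_nonneg hε0.le] at h3
      rw [abs_lt] at hNx hNy
      linarith
    obtain ⟨x, hx, ⟨hx1, hx2⟩, hx3⟩ := (hf1.and_eventually hev).exists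
    obtain ⟨y, hy, ⟨hy1, hy2⟩, hy3⟩ := (hf2.and_eventually hev).exists
    rcases lt_trichotomy x y with hxy | hxy | hxy
    · exact hmain x y hxy hx3 hy3 hx2 hx1 hy1 (Or.inl ⟨hx.le, hy.le⟩)
    · rw [hxy] at hx; linarith
    · exact hmain y x hxy hy3 hx3 hy2 hy1 hx1 (Or.inr ⟨hx.le, hy.le⟩)
  · exact isBoundedUnder_of ⟨π, fun x => (h.rng x).2⟩
  · exact isBoundedUnder_of ⟨0, fun x => (h.rng x).1⟩

def Sb (E : Set (EE n)) : Set (EE n) := {x | ∀ r > 0, 0 < volume (ball x r ∩ E) ∧ 0 < volume (ball x r \ E)}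

theorem Prf.bad_null (h : Pf) (p : ℝ) :
    volume {w : EE n | 0 < ‖w‖ ∧ (‖w‖ = p ∨ ‖w‖ ∉ Gd)} = 0 := by
  refine norm_null (A := {r | 0 < r ∧ (r = p ∨ r ∉ Gd)}) ?_
  rw [measure_eq_zero_iff_ae_notMem]
  have : ∀ᵐ r : ℝ, r ≠ p := by
    rw [ae_iff]; simp
  filter_upwards [h.gae, this] with r hr hr3 hr2
  rcases hr2.2 with h1 | h1
  · exact hr3 h1
  · exact h1 (hr hr2.1)

theorem Prf.S_lt (hn : 1 ≤ n) (h : Pf) {p θ b : ℝ} (hp : 0 < p)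
    {ω : EE n} (hω : Om e ω) (hθ : θ ≤ π) (hb : 0 ≤ b) (hbθ : b < θ)
    (hev : ∀ᶠ r in 𝓝[≠] p ⊓ 𝓟 Gd, α r < b) : W e p θ ω ∉ Sb E := by
  intro hS
  rw [eventually_inf_principal, eventually_nhdsWithin_iff] at hev
  have hz : ‖W e p θ ω‖ = p := W_norm h.he hω hp.le _
  have hev2 : ∀ᶠ w in 𝓝 (W e p θ ω), ((‖w‖ ≠ p → ‖w‖ ∈ Gd → α ‖w‖ < b) ∧ 0 < ‖w‖) ∧ inner ℝ w e < ‖w‖ * Real.cos b := by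
    refine Eventually.and (Eventually.and ?_ ?_) ?_
    · have hc : ContinuousAt (fun w : EE n => ‖w‖) (W e p θ ω) := by fun_prop
      have := hc.tendsto
      rw [hz] at this
      exact this.eventually hev
    · exact continuous_norm.continuousAt.eventually (lt_mem_nhds (by beta_reduce; rw [hz]; exact hp))
    · refine (isOpen_lt (f := fun w : EE n => (inner ℝ w e : ℝ)) (g := fun w => ‖w‖ * Real.cos b) (by fun_prop) (by fun_prop)).mem_nhds ?_
      change inner ℝ (W e p θ ω) e < ‖W e p θ ω‖ * Real.cos b
      rw [hz, W_inner h.he hω]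
      exact mul_lt_mul_of_pos_left (Real.cos_lt_cos_of_nonneg_of_le_pi hb hθ hbθ) hp
  obtain ⟨r, hr, hball⟩ := Metric.eventually_nhds_iff_ball.1 hev2
  refine (hS r hr).1.ne' (measure_mono_null ?_ (h.bad_null p))
  rintro w ⟨hw, hwE⟩
  obtain ⟨⟨h1, h2⟩, h3⟩ := hball w hw
  refine ⟨h2, ?_⟩
  by_contra hcon
  push Not at hcon
  obtain ⟨θ', hθ', ω', hω', hW⟩ := exists_W hn h.he w
  have h4 := W_inner h.he hω' ‖w‖ θ'
  rw [← hW] at h4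
  rw [h4] at h3
  have h5 := lt_of_mul_lt_mul_left h3 h2.le
  have h6 : b < θ' := by
    by_contra h7
    push Not at h7
    linarith [Real.cos_le_cos_of_nonneg_of_le_pi hθ'.1 (by linarith) h7]
  refine h.out ‖w‖ θ' ω' h2 hθ'.2 hω' ((h1 hcon.1 hcon.2).trans h6) ?_
  rw [← hW]; exact hwE

theorem Prf.S_gt (hn : 1 ≤ n) (h : Pf) {p θ b : ℝ} (hp : 0 < p)
    {ω : EE n} (hω : Om e ω) (hθ : 0 ≤ θ) (hb : b ≤ π) (hbθ : θ < b)
    (hev : ∀ᶠ r in 𝓝[≠] p ⊓ 𝓟 Gd, b < α r) : W e p θ ω ∉ Sb E := by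
  intro hS
  rw [eventually_inf_principal, eventually_nhdsWithin_iff] at hev
  have hz : ‖W e p θ ω‖ = p := W_norm h.he hω hp.le _
  have hev2 : ∀ᶠ w in 𝓝 (W e p θ ω), ((‖w‖ ≠ p → ‖w‖ ∈ Gd → b < α ‖w‖) ∧ 0 < ‖w‖) ∧ ‖w‖ * Real.cos b < inner ℝ w e := by
    refine Eventually.and (Eventually.and ?_ ?_) ?_
    · have hc : ContinuousAt (fun w : EE n => ‖w‖) (W e p θ ω) := by fun_prop
      have := hc.tendsto
      rw [hz] at this
      exact this.eventually hev
    · exact continuous_norm.continuousAt.eventually (lt_mem_nhds (by beta_reduce; rw [hz]; exact hp))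
    · refine (isOpen_lt (f := fun w => ‖w‖ * Real.cos b) (g := fun w : EE n => (inner ℝ w e : ℝ)) (by fun_prop) (by fun_prop)).mem_nhds ?_
      change ‖W e p θ ω‖ * Real.cos b < inner ℝ (W e p θ ω) e
      rw [hz, W_inner h.he hω]
      exact mul_lt_mul_of_pos_left (Real.cos_lt_cos_of_nonneg_of_le_pi hθ hb hbθ) hp
  obtain ⟨r, hr, hball⟩ := Metric.eventually_nhds_iff_ball.1 hev2
  refine (hS r hr).2.ne' (measure_mono_null ?_ (h.bad_null p))
  rintro w ⟨hw, hwE⟩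
  obtain ⟨⟨h1, h2⟩, h3⟩ := hball w hw
  refine ⟨h2, ?_⟩
  by_contra hcon
  push Not at hcon
  obtain ⟨θ', hθ', ω', hω', hW⟩ := exists_W hn h.he w
  have h4 := W_inner h.he hω' ‖w‖ θ'
  rw [← hW] at h4
  rw [h4] at h3
  have h5 := lt_of_mul_lt_mul_left h3 h2.le
  have h6 : θ' < b := by
    by_contra h7
    push Not at h7
    linarith [Real.cos_le_cos_of_nonneg_of_le_pi (hθ.trans hbθ.le) hθ'.2 h7]
  refine hwE ?_
  rw [hW]
  exact h.ins ‖w‖ θ' ω' h2 hθ'.1 hω' (h6.trans (h1 hcon.1 hcon.2))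

theorem Prf.gex (h : Pf) {a b : ℝ} (ha : 0 ≤ a) (hab : a < b) :
    ∃ x ∈ Gd, x ∈ Ioo a b := by
  by_contra hcon
  push Not at hcon
  have h0 : volume (Ioo a b) = 0 := by
    rw [measure_eq_zero_iff_ae_notMem]
    filter_upwards [h.gae] with r hr hr2
    exact hcon r (hr (ha.trans_lt hr2.1)) hr2
  rw [Real.volume_Ioo, ENNReal.ofReal_eq_zero] at h0
  linarith

theorem Prf.gR (h : Pf) {p : ℝ} (hp : 0 < p) :
    (𝓝[>] p ⊓ 𝓟 Gd).NeBot := by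
  rw [(nhdsGT_basis p).inf_principal_neBot_iff]
  intro b hb
  obtain ⟨x, hx, hx2⟩ := h.gex hp.le hb
  exact ⟨x, hx2, hx⟩

theorem Prf.gL (h : Pf) {p : ℝ} (hp : 0 < p) :
    (𝓝[<] p ⊓ 𝓟 Gd).NeBot := by
  rw [(nhdsLT_basis p).inf_principal_neBot_iff]
  intro b hb
  obtain ⟨x, hx, hx2⟩ := h.gex (le_max_right b 0) (max_lt hb hp)
  exact ⟨x, ⟨(le_max_left _ _).trans_lt hx2.1, hx2.2⟩, hx⟩

theorem Bd_scale {e : EE n} {x y : ℝ} (hx : 0 < x) (hy : 0 < y) (t1 t2 : ℝ) :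
    Hm (Bd e y t1 t2) ≤ ofReal (y / x) ^ n * Hm (Bd e x t1 t2) := by
  refine haus_rel (fun a b => b = (y / x) • a) (Real.toNNReal (y / x)) ?_ ?_
  · rintro _ ⟨θ, hθ, ω, hω, rfl⟩
    exact ⟨W e x θ ω, ⟨θ, hθ, ω, hω, rfl⟩, W_scale e ω hx.ne' y θ⟩
  · rintro a _ a' _ rfl rfl
    rw [dist_smul₀, Real.norm_of_nonneg (by positivity), Real.coe_toNNReal _ (by positivity)]

theorem Prf.JC1 (hf : GoodF f) (h : Pf) (hmt : m ≠ ⊤)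
    {p a1 a2 L1 L2 t1 t2 : ℝ} (hp : 0 < p) (ha1 : Tendsto α (𝓝[<] p ⊓ 𝓟 Gd) (𝓝 a1)) (ha2 : Tendsto α (𝓝[>] p ⊓ 𝓟 Gd) (𝓝 a2))
    (hL1 : Tendsto N (𝓝[<] p) (𝓝 L1)) (hL2 : Tendsto N (𝓝[>] p) (𝓝 L2)) (h1 : 0 ≤ t1) (h2 : t2 ≤ π) (h12 : t1 < t2)
    (hc1 : min a1 a2 < t1) (hc2 : t2 < max a1 a2) :
    ofReal (f (p • e)) * Hm (Bd e p t1 t2) ≤ ofReal (L2 - L1) := by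
  have := h.gL hp
  have := h.gR hp
  have hα : ∀ᶠ q : ℝ × ℝ in (𝓝[<] p ⊓ 𝓟 Gd) ×ˢ (𝓝[>] p ⊓ 𝓟 Gd),
      (α q.1 ≤ t1 ∧ t2 ≤ α q.2) ∨ (α q.2 ≤ t1 ∧ t2 ≤ α q.1) := by
    rcases le_total a1 a2 with hle | hle
    · rw [min_eq_left hle] at hc1; rw [max_eq_right hle] at hc2
      filter_upwards [(ha1.eventually (gt_mem_nhds hc1)).prod_mk (ha2.eventually (lt_mem_nhds hc2))] with q hq
      exact Or.inl ⟨hq.1.le, hq.2.le⟩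
    · rw [min_eq_right hle] at hc1; rw [max_eq_left hle] at hc2
      filter_upwards [(ha1.eventually (lt_mem_nhds hc2)).prod_mk (ha2.eventually (gt_mem_nhds hc1))] with q hq
      exact Or.inr ⟨hq.2.le, hq.1.le⟩
  have hg1 : ∀ᶠ x in 𝓝[<] p ⊓ 𝓟 Gd, x < p ∧ x ∈ Gd := by
    rw [eventually_inf_principal]
    filter_upwards [self_mem_nhdsWithin] with x hx hg using ⟨hx, hg⟩
  have hg2 : ∀ᶠ x in 𝓝[>] p ⊓ 𝓟 Gd, p < x ∧ x ∈ Gd := by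
    rw [eventually_inf_principal]
    filter_upwards [self_mem_nhdsWithin] with x hx hg using ⟨hx, hg⟩
  have key : ∀ᶠ q : ℝ × ℝ in (𝓝[<] p ⊓ 𝓟 Gd) ×ˢ (𝓝[>] p ⊓ 𝓟 Gd),
      ofReal (f (q.1 • e)) * Hm (Bd e p t1 t2) ≤ ofReal (p / q.1) ^ n * ofReal (N q.2 - N q.1) := by
    filter_upwards [hα, hg1.prod_mk hg2] with ⟨x, y⟩ hα ⟨⟨hxp, hx⟩, ⟨hpy, hy⟩⟩
    have hx0 := h.gpos x hx
    have r1 := h.RL hf hmt hx hy (hxp.trans hpy) (c := ofReal (f (x • e))) (by simp)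
      (fun w hw => ENNReal.ofReal_le_ofReal (hf.mono _ _ (by
        rw [norm_smul, h.he, mul_one, Real.norm_of_nonneg hx0.le]; exact hw))) h1 h2 hα
    calc _ ≤ ofReal (f (x • e)) * (ofReal (p / x) ^ n * Hm (Bd e x t1 t2)) :=
          mul_le_mul' le_rfl (Bd_scale hx0 hp _ _)
      _ = ofReal (p / x) ^ n * (ofReal (f (x • e)) * Hm (Bd e x t1 t2)) := by ring
      _ ≤ _ := mul_le_mul' le_rfl r1
  have hx1 : Tendsto (fun q : ℝ × ℝ => q.1) ((𝓝[<] p ⊓ 𝓟 Gd) ×ˢ (𝓝[>] p ⊓ 𝓟 Gd)) (𝓝 p) :=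
    tendsto_fst.mono_right (inf_le_left.trans nhdsWithin_le_nhds)
  have hBt : Hm (Bd e p t1 t2) ≠ ⊤ := by
    obtain ⟨C, hC⟩ := sphere_haus n
    refine ne_top_of_le_ne_top (show (C : EN) * ofReal p ^ n ≠ ⊤ by finiteness) (le_trans (measure_mono ?_) (hC 0 p hp.le))
    rintro w ⟨θ, hθ, ω, hω, rfl⟩
    simp [W_norm h.he hω hp.le]
  have l1 : Tendsto (fun q : ℝ × ℝ => ofReal (f (q.1 • e)) * Hm (Bd e p t1 t2))
      ((𝓝[<] p ⊓ 𝓟 Gd) ×ˢ (𝓝[>] p ⊓ 𝓟 Gd)) (𝓝 (ofReal (f (p • e)) * Hm (Bd e p t1 t2))) := by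
    refine ENNReal.Tendsto.mul_const ?_ (Or.inr hBt)
    refine ENNReal.tendsto_ofReal ?_
    have : Continuous fun x : ℝ => f (x • e) := hf.cont.comp (by fun_prop)
    exact (this.tendsto p).comp hx1
  have l2 : Tendsto (fun q : ℝ × ℝ => ofReal (p / q.1) ^ n * ofReal (N q.2 - N q.1))
      ((𝓝[<] p ⊓ 𝓟 Gd) ×ˢ (𝓝[>] p ⊓ 𝓟 Gd)) (𝓝 (ofReal (p / p) ^ n * ofReal (L2 - L1))) := by
    refine ENNReal.Tendsto.mul ?_ (Or.inr (by simp)) ?_ (Or.inr (by simp))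
    · exact ENNReal.Tendsto.pow (ENNReal.tendsto_ofReal (Tendsto.div tendsto_const_nhds hx1 hp.ne'))
    · refine ENNReal.tendsto_ofReal (Tendsto.sub ?_ ?_)
      · exact (hL2.mono_left inf_le_left).comp tendsto_snd
      · exact (hL1.mono_left inf_le_left).comp tendsto_fst
  rw [div_self hp.ne', ENNReal.ofReal_one, one_pow, one_mul] at l2
  exact le_of_tendsto_of_tendsto l1 l2 key

theorem Prf.JC2 (hf : GoodF f) (h : Pf) (hmt : m ≠ ⊤)
    {p a1 a2 L1 L2 : ℝ} (hp : 0 < p) (ha1 : Tendsto α (𝓝[<] p ⊓ 𝓟 Gd) (𝓝 a1)) (ha2 : Tendsto α (𝓝[>] p ⊓ 𝓟 Gd) (𝓝 a2))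
    (hL1 : Tendsto N (𝓝[<] p) (𝓝 L1)) (hL2 : Tendsto N (𝓝[>] p) (𝓝 L2)) (h1 : 0 ≤ min a1 a2) (h2 : max a1 a2 ≤ π) :
    ofReal (f (p • e)) * Hm (Bd e p (min a1 a2) (max a1 a2)) ≤ ofReal (L2 - L1) := by
  set s := min a1 a2
  set t := max a1 a2
  have hU : Bd e p s t ⊆ ⋃ j : ℕ, Bd e p (s + 1 / ((j : ℝ) + 1)) (t - 1 / ((j : ℝ) + 1)) := by
    rintro _ ⟨θ, hθ, ω, hω, rfl⟩
    obtain ⟨j, hj⟩ := exists_nat_one_div_lt (show 0 < min (θ - s) (t - θ) from lt_min (by linarith [hθ.1]) (by linarith [hθ.2]))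
    rw [lt_min_iff] at hj
    exact mem_iUnion.2 ⟨j, θ, ⟨by linarith, by linarith⟩, ω, hω, rfl⟩
  have hmo : Monotone fun j : ℕ => Bd e p (s + 1 / ((j : ℝ) + 1)) (t - 1 / ((j : ℝ) + 1)) := by
    rintro i j hij _ ⟨θ, hθ, ω, hω, rfl⟩
    have : 1 / ((j : ℝ) + 1) ≤ 1 / ((i : ℝ) + 1) := by
      have : (i : ℝ) ≤ j := by exact_mod_cast hij
      gcongr
    exact ⟨θ, ⟨by linarith [hθ.1], by linarith [hθ.2]⟩, ω, hω, rfl⟩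
  refine (mul_le_mul' le_rfl (measure_mono hU)).trans ?_
  rw [hmo.measure_iUnion, ENNReal.mul_iSup]
  refine iSup_le fun j => ?_
  have hj : 0 < 1 / ((j : ℝ) + 1) := by positivity
  rcases lt_or_ge (s + 1 / ((j : ℝ) + 1)) (t - 1 / ((j : ℝ) + 1)) with hlt | hge
  · exact h.JC1 hf hmt hp ha1 ha2 hL1 hL2 (by linarith) (by linarith) hlt (by change s < _; linarith) (by change _ < t; linarith)
  · have : Bd e p (s + 1 / ((j : ℝ) + 1)) (t - 1 / ((j : ℝ) + 1)) = ∅ := by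
      rw [eq_empty_iff_forall_notMem]
      rintro _ ⟨θ, hθ, -⟩
      linarith [hθ.1, hθ.2]
    rw [this]; simp

theorem Prf.S_btw (hn : 1 ≤ n) (h : Pf)
    {p a1 a2 θ : ℝ} (hp : 0 < p) (ha1 : Tendsto α (𝓝[<] p ⊓ 𝓟 Gd) (𝓝 a1)) (ha2 : Tendsto α (𝓝[>] p ⊓ 𝓟 Gd) (𝓝 a2))
    {ω : EE n} (hω : Om e ω) (hθ : θ ∈ Icc 0 π) (hS : W e p θ ω ∈ Sb E) : θ ∈ Icc (min a1 a2) (max a1 a2) := by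
  have := h.gL hp
  have := h.gR hp
  have hsplit : 𝓝[≠] p ⊓ 𝓟 Gd = (𝓝[<] p ⊓ 𝓟 Gd) ⊔ (𝓝[>] p ⊓ 𝓟 Gd) := by
    rw [← nhdsLT_sup_nhdsGT, inf_sup_right]
  have r1 : a1 ∈ Icc 0 π := isClosed_Icc.mem_of_tendsto ha1 (Eventually.of_forall h.rng)
  have r2 : a2 ∈ Icc 0 π := isClosed_Icc.mem_of_tendsto ha2 (Eventually.of_forall h.rng)
  constructor
  · by_contra hcon
    push Not at hcon
    obtain ⟨b, hb1, hb2⟩ := exists_between hcon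
    rw [lt_min_iff] at hb2
    refine h.S_gt hn hp hω hθ.1 (by linarith [r1.2]) hb1 ?_ hS
    rw [hsplit, eventually_sup]
    exact ⟨ha1.eventually (lt_mem_nhds hb2.1), ha2.eventually (lt_mem_nhds hb2.2)⟩
  · by_contra hcon
    push Not at hcon
    obtain ⟨b, hb1, hb2⟩ := exists_between hcon
    rw [max_lt_iff] at hb1
    refine h.S_lt hn hp hω hθ.2 (by linarith [r1.1]) hb2 ?_ hS
    rw [hsplit, eventually_sup]
    exact ⟨ha1.eventually (gt_mem_nhds hb1.1), ha2.eventually (gt_mem_nhds hb1.2)⟩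

def OA (e : EE n) : Set (EE n) := {w | |inner ℝ w e| < ‖w‖}

theorem OA_W (hn : 1 ≤ n) {e : EE n} (he : ‖e‖ = 1) {w : EE n} (hw : w ∈ OA e) :
    0 < ‖w‖ ∧ ∃ θ ∈ Ioo 0 π, ∃ ω, Om e ω ∧ w = W e ‖w‖ θ ω := by
  have h0 : 0 < ‖w‖ := lt_of_le_of_lt (abs_nonneg _) hw
  have hw' := abs_lt.1 (show |(inner ℝ w e : ℝ)| < ‖w‖ from hw)
  exact ⟨h0, W_cos_mem hn he Real.pi_pos.le Real.pi_pos.le (norm_pos_iff.1 h0) (by simpa using hw'.1) (by simpa using hw'.2)⟩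

theorem Prf.JC (hn : 1 ≤ n) (hf : GoodF f) (h : Pf) (hmt : m ≠ ⊤)
    {p : ℝ} (hp : 0 < p) :
    ofReal (f (p • e)) * Hm (Sb E ∩ OA e ∩ sphere 0 p) ≤ ofReal (Function.rightLim N p - Function.leftLim N p) := by
  have hL1 := h.mono.tendsto_leftLim p
  have hL2 := h.mono.tendsto_rightLim p
  obtain ⟨a1, ha1⟩ := h.alim hn hf hmt hp nhdsWithin_le_nhds hL1
  obtain ⟨a2, ha2⟩ := h.alim hn hf hmt hp nhdsWithin_le_nhds hL2
  have := h.gL hp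
  have := h.gR hp
  have r1 : a1 ∈ Icc 0 π := isClosed_Icc.mem_of_tendsto ha1 (Eventually.of_forall h.rng)
  have r2 : a2 ∈ Icc 0 π := isClosed_Icc.mem_of_tendsto ha2 (Eventually.of_forall h.rng)
  refine le_trans (mul_le_mul' le_rfl ?_) (h.JC2 hf hmt hp ha1 ha2 hL1 hL2 (le_min r1.1 r2.1) (max_le r1.2 r2.2))
  set Ci : ℝ → Set (EE n) := fun a => {w | a ∈ Ioo 0 π ∧ ∃ ω, Om e ω ∧ w = W e p a ω}
  have hCi : ∀ a, Hm (Ci a) = 0 := fun a => by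
    by_cases ha : a ∈ Ioo 0 π
    · exact measure_mono_null (fun w hw => hw.2) (circle_null hn h.he hp ha)
    · rw [show Ci a = ∅ from eq_empty_iff_forall_notMem.2 fun w hw => ha hw.1]; simp
  have hsub : Sb E ∩ OA e ∩ sphere 0 p ⊆ Bd e p (min a1 a2) (max a1 a2) ∪ (Ci (min a1 a2) ∪ Ci (max a1 a2)) := by
    rintro w ⟨⟨hS, hO⟩, hw⟩
    have hwp : ‖w‖ = p := by simpa using hw
    obtain ⟨-, θ, hθ, ω, hω, hW⟩ := OA_W hn h.he hO
    rw [hwp] at hW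
    rw [hW] at hS ⊢
    have hb := h.S_btw hn hp ha1 ha2 hω (Ioo_subset_Icc_self hθ) hS
    rcases hb.1.lt_or_eq with q1 | q1
    · rcases hb.2.lt_or_eq with q2 | q2
      · exact Or.inl ⟨θ, ⟨q1, q2⟩, ω, hω, rfl⟩
      · exact Or.inr (Or.inr ⟨q2 ▸ hθ, ω, hω, by rw [q2]⟩)
    · exact Or.inr (Or.inl ⟨q1 ▸ hθ, ω, hω, by rw [q1]⟩)
  refine (measure_mono hsub).trans ((measure_union_le _ _).trans ?_)
  rw [measure_union_null (hCi _) (hCi _), add_zero]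

theorem exit_lem {x y B r0 u0 d1 d2 : ℝ} (hr : r0 ∈ Icc x y) (hu : u0 ≤ B) (hd : 0 < d1) :
    ∃ t, 0 ≤ t ∧ (∀ t' ∈ Icc 0 t, r0 - t' * d2 ∈ Icc x y ∧ u0 + t' * d1 ≤ B) ∧
      (u0 + t * d1 = B ∨ (r0 - t * d2 = x ∧ 0 < d2) ∨ (r0 - t * d2 = y ∧ d2 < 0)) := by
  have hq : 0 ≤ (B - u0) / d1 := div_nonneg (by linarith) hd.le
  have hu' : ∀ t', t' ≤ (B - u0) / d1 → u0 + t' * d1 ≤ B := fun t' ht => by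
    rw [le_div_iff₀ hd] at ht; linarith
  rcases lt_trichotomy d2 0 with h | h | h
  · have h' : 0 < -d2 := by linarith
    have hq2 : 0 ≤ (y - r0) / (-d2) := div_nonneg (by linarith [hr.2]) h'.le
    refine ⟨min ((B - u0) / d1) ((y - r0) / (-d2)), le_min hq hq2, fun t' ht => ⟨⟨?_, ?_⟩, ?_⟩, ?_⟩
    · nlinarith [hr.1, ht.1]
    · have := ht.2.trans (min_le_right _ _)
      rw [le_div_iff₀ h'] at this; linarith
    · exact hu' _ (ht.2.trans (min_le_left _ _))
    · rcases le_total ((B - u0) / d1) ((y - r0) / (-d2)) with h3 | h3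
      · rw [min_eq_left h3]; left; field_simp; ring
      · rw [min_eq_right h3]; right; right; refine ⟨?_, h⟩
        have := h.ne; field_simp; ring
  · refine ⟨(B - u0) / d1, hq, fun t' ht => ⟨by rw [h]; simpa using hr, hu' _ ht.2⟩, Or.inl (by field_simp; ring)⟩
  · have hq2 : 0 ≤ (r0 - x) / d2 := div_nonneg (by linarith [hr.1]) h.le
    refine ⟨min ((B - u0) / d1) ((r0 - x) / d2), le_min hq hq2, fun t' ht => ⟨⟨?_, ?_⟩, ?_⟩, ?_⟩
    · have := ht.2.trans (min_le_right _ _)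
      rw [le_div_iff₀ h] at this; linarith
    · nlinarith [hr.2, ht.1]
    · exact hu' _ (ht.2.trans (min_le_left _ _))
    · rcases le_total ((B - u0) / d1) ((r0 - x) / d2) with h3 | h3
      · rw [min_eq_left h3]; left; field_simp; ring
      · rw [min_eq_right h3]; right; left; refine ⟨?_, h⟩
        have := h.ne'; field_simp; ring

theorem path_frontier {Y : Type*} [TopologicalSpace Y] {U : Set Y} (hU : IsOpen U) {g : ℝ → Y} (hg : Continuous g)
    {a b : ℝ} (hab : a ≤ b) (ha : g a ∈ U) (hb : g b ∉ U) : ∃ t ∈ Icc a b, g t ∈ frontier U := by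
  obtain ⟨s, hs, h⟩ := seg_frontier (hU.preimage hg) (x := a) (h := b - a) ha (by simpa using hb)
  refine ⟨a + s * (b - a), ⟨by nlinarith [hs.1], by nlinarith [hs.2]⟩, ?_⟩
  exact hg.frontier_preimage_subset U h

set_option maxHeartbeats 2000000 in
theorem Prf.CL (hf : GoodF f) (h : Pf) (hmt : m ≠ ⊤)
    {p δ a η c ρ x0 : ℝ} {l : ℝ≥0} (hc : 0 < c) (hη1 : 0 < a - η) (hη2 : a + η < π)
    (hd : ∀ r r' θ θ' ω ω', r ∈ Icc p (p + δ) → r' ∈ Icc p (p + δ) → θ ∈ Icc (a - η) (a + η) → θ' ∈ Icc (a - η) (a + η) →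
        Om e ω → Om e ω' →
        (r - r') ^ 2 + (c * (θ - θ')) ^ 2 + ρ ^ 2 * dist ω ω' ^ 2 ≤ dist (W e r θ ω) (W e r' θ' ω') ^ 2)
    (hl : ∀ A : Set ℝ, MeasurableSet A → Hm (Zc e ρ A) = l * volume A)
    {x y T1 T2 : ℝ} (hx : x ∈ Gd) (hy : y ∈ Gd) (hxy : x < y) (hxp : p ≤ x) (hyp : y ≤ p + δ) (hx0 : x0 ≤ x)
    (hT1 : a - η ≤ T1) (hT2 : T2 ≤ a + η)
    (hc1 : Tendsto (fun k => Hm ((symmDiff (U k) E ∪ {w | 0 < ‖w‖ ∧ ‖w‖ ∉ Gd}) ∩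
      {w | x0 ≤ ‖w‖ ∧ inner ℝ w e = ‖w‖ * Real.cos T1})) atTop (𝓝 0))
    (hc2 : Tendsto (fun k => Hm ((symmDiff (U k) E ∪ {w | 0 < ‖w‖ ∧ ‖w‖ ∉ Gd}) ∩
      {w | x0 ≤ ‖w‖ ∧ inner ℝ w e = ‖w‖ * Real.cos T2})) atTop (𝓝 0))
    (hα : ∀ r ∈ Gd, r ∈ Icc x y → α r ∈ Ioo T1 T2) {cf : EN}
    (hcf : cf ≠ ⊤) (hcf2 : ∀ w : EE n, x ≤ ‖w‖ → cf ≤ ofReal (f w)) :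
    cf * (l * ofReal (√((y - x) ^ 2 + (c * (α y - α x)) ^ 2))) ≤ ofReal (N y - N x) := by
  have hx00 := h.gpos x hx
  set L := √((y - x) ^ 2 + (c * (α y - α x)) ^ 2) with hL
  have hLs : L ^ 2 = (y - x) ^ 2 + (c * (α y - α x)) ^ 2 := Real.sq_sqrt (by positivity)
  have hL0 : 0 < L := Real.sqrt_pos.2 (by have : 0 < y - x := by linarith
                                          positivity)
  set d1 := (y - x) / L with hd1
  set d2 := c * (α y - α x) / L with hd2
  have hd1p : 0 < d1 := div_pos (by linarith) hL0
  have hL1 : L * d1 = y - x := by rw [hd1]; field_simp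
  have hL2 : L * d2 = c * (α y - α x) := by rw [hd2]; field_simp
  have hdd : d1 ^ 2 + d2 ^ 2 = 1 := by
    rw [hd1, hd2, div_pow, div_pow, ← add_div, ← hLs]; field_simp
  have hαx := hα x hx ⟨le_rfl, hxy.le⟩
  have hαy := hα y hy ⟨hxy.le, le_rfl⟩
  set sg : ℝ → ℝ → ℝ := fun r θ => (r - x) * d1 + c * (θ - α x) * d2 with hsg
  have hvol : (l : EN) * ofReal L = Hm (Zc e ρ (Ioo 0 L)) := by
    rw [hl _ measurableSet_Ioo, Real.volume_Ioo, sub_zero]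
  rw [hvol]
  set D := fun k => symmDiff (U k) E
  set D' := fun k => symmDiff (U k) E ∪ {w | 0 < ‖w‖ ∧ ‖w‖ ∉ Gd}
  refine h.lim hf hmt hy hxy hcf hcf2 (err := fun k => (Hm (D k ∩ sphere 0 x) + Hm (D k ∩ sphere 0 y)) +
    (Hm (D' k ∩ {w | x0 ≤ ‖w‖ ∧ inner ℝ w e = ‖w‖ * Real.cos T1}) +
     Hm (D' k ∩ {w | x0 ≤ ‖w‖ ∧ inner ℝ w e = ‖w‖ * Real.cos T2}))) (by
      have := ((h.gsl x hx).add (h.gsl y hy)).add (hc1.add hc2)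
      simpa only [add_zero] using this) fun k => ?_
  have hrel := haus_rel (n := n) (A := (frontier (U k) ∩ (closedBall 0 y \ ball 0 x)) ∪
    (((D k ∩ sphere 0 x) ∪ (D k ∩ sphere 0 y)) ∪ ((D' k ∩ {w | x0 ≤ ‖w‖ ∧ inner ℝ w e = ‖w‖ * Real.cos T1}) ∪
     (D' k ∩ {w | x0 ≤ ‖w‖ ∧ inner ℝ w e = ‖w‖ * Real.cos T2})))) (B := Zc e ρ (Ioo 0 L))
    (fun w b => ∃ r ∈ Icc x y, ∃ θ ∈ Icc T1 T2, ∃ ω, Om e ω ∧ w = W e r θ ω ∧ b = (sg r θ) • e + ρ • ω) 1 ?_ ?_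
  · rw [ENNReal.coe_one, one_pow, one_mul] at hrel
    refine hrel.trans ((measure_union_le _ _).trans (add_le_add le_rfl ((measure_union_le _ _).trans
      (add_le_add (measure_union_le _ _) (measure_union_le _ _)))))
  · rintro _ ⟨s, hs, ω, hω, rfl⟩
    set r0 := x + s * d1 with hr0
    set u0 := c * α x + s * d2 with hu0
    have hr0m : r0 ∈ Icc x y := ⟨by linarith [mul_pos hs.1 hd1p], by linarith [mul_lt_mul_of_pos_right hs.2 hd1p]⟩
    have hu0e : u0 = c * ((1 - s / L) * α x + s / L * α y) := by
      rw [hu0, hd2]; field_simp; ring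
    have hsL : 0 ≤ s / L ∧ s / L ≤ 1 := ⟨div_nonneg hs.1.le hL0.le, by rw [div_le_one hL0]; exact hs.2.le⟩
    have hu0l : c * T1 ≤ u0 := by
      rw [hu0e]; gcongr
      nlinarith [hαx.1, hαy.1, hsL.1, hsL.2]
    have hu0u : u0 ≤ c * T2 := by
      rw [hu0e]; gcongr
      nlinarith [hαx.2, hαy.2, hsL.1, hsL.2]
    obtain ⟨tp, htp0, htp, htpe⟩ := exit_lem hr0m hu0u hd1p (d2 := d2)
    obtain ⟨tm, htm0, htm, htme⟩ := exit_lem hr0m (show -u0 ≤ -(c * T1) by linarith) hd1p (d2 := -d2)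
    set g : ℝ → EE n := fun t => W e (r0 - t * d2) ((u0 + t * d1) / c) ω with hg
    have hgc : Continuous g := by
      simp only [hg, W]
      fun_prop
    have hmem : ∀ t ∈ Icc (-tm) tp, r0 - t * d2 ∈ Icc x y ∧ (u0 + t * d1) / c ∈ Icc T1 T2 := by
      intro t ht
      rw [mem_Icc (a := T1), le_div_iff₀ hc, div_le_iff₀ hc]
      rcases le_total 0 t with h0 | h0
      · obtain ⟨q1, q2⟩ := htp t ⟨h0, ht.2⟩
        exact ⟨q1, by linarith [mul_nonneg h0 hd1p.le], by linarith⟩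
      · obtain ⟨q1, q2⟩ := htm (-t) ⟨by linarith, by linarith [ht.1]⟩
        rw [show r0 - -t * -d2 = r0 - t * d2 by ring] at q1
        exact ⟨q1, by linarith, by linarith [mul_nonneg (neg_nonneg.2 h0) hd1p.le]⟩
    have hR : ∀ t ∈ Icc (-tm) tp, ∃ r ∈ Icc x y, ∃ θ ∈ Icc T1 T2, ∃ ω', Om e ω' ∧ g t = W e r θ ω' ∧
        s • e + ρ • ω = (sg r θ) • e + ρ • ω' := by
      intro t ht
      obtain ⟨q1, q2⟩ := hmem t ht
      refine ⟨_, q1, _, q2, ω, hω, rfl, ?_⟩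
      have : sg (r0 - t * d2) ((u0 + t * d1) / c) = s := by
        simp only [hsg]
        rw [show c * ((u0 + t * d1) / c - α x) = (u0 + t * d1) - c * α x by field_simp, hr0, hu0]
        linear_combination s * hdd
      rw [this]
    have hnorm : ∀ t ∈ Icc (-tm) tp, ‖g t‖ = r0 - t * d2 := fun t ht =>
      W_norm h.he hω (by linarith [(hmem t ht).1.1]) _
    have hinn : ∀ t, inner ℝ (g t) e = (r0 - t * d2) * Real.cos ((u0 + t * d1) / c) := fun t =>
      W_inner h.he hω _ _
    have hpI : tp ∈ Icc (-tm) tp := ⟨by linarith, le_rfl⟩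
    have hmI : -tm ∈ Icc (-tm) tp := ⟨le_rfl, by linarith⟩
    have hrp := (hmem tp hpI)
    have hrm := (hmem (-tm) hmI)
    by_cases hb1 : g tp ∈ ((D k ∩ sphere 0 x) ∪ (D k ∩ sphere 0 y)) ∪ ((D' k ∩ {w | x0 ≤ ‖w‖ ∧ inner ℝ w e = ‖w‖ * Real.cos T1}) ∪
     (D' k ∩ {w | x0 ≤ ‖w‖ ∧ inner ℝ w e = ‖w‖ * Real.cos T2}))
    · exact ⟨g tp, Or.inr hb1, hR tp hpI⟩
    by_cases hb2 : g (-tm) ∈ ((D k ∩ sphere 0 x) ∪ (D k ∩ sphere 0 y)) ∪ ((D' k ∩ {w | x0 ≤ ‖w‖ ∧ inner ℝ w e = ‖w‖ * Real.cos T1}) ∪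
     (D' k ∩ {w | x0 ≤ ‖w‖ ∧ inner ℝ w e = ‖w‖ * Real.cos T2}))
    · exact ⟨g (-tm), Or.inr hb2, hR (-tm) hmI⟩
    have hout : g tp ∉ U k := by
      have hnE : g tp ∉ E → g tp ∉ D k → g tp ∉ U k := fun h1 h2 h3 => h2 (Or.inl ⟨h3, h1⟩)
      have hrpos : 0 < r0 - tp * d2 := by linarith [hrp.1.1]
      rcases htpe with q | ⟨q, q'⟩ | ⟨q, q'⟩
      · have hθ : (u0 + tp * d1) / c = T2 := by rw [q]; field_simp
        have hD : g tp ∉ D' k := fun hD => hb1 (Or.inr (Or.inr ⟨hD, by rw [hnorm tp hpI]; linarith [hrp.1.1], by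
          rw [hinn, hnorm tp hpI, hθ]⟩))
        refine hnE ?_ (fun hD2 => hD (Or.inl hD2))
        have hgd : r0 - tp * d2 ∈ Gd := by
          by_contra hng
          refine hD (Or.inr ?_)
          change 0 < ‖g tp‖ ∧ ‖g tp‖ ∉ Gd
          rw [hnorm tp hpI]; exact ⟨hrpos, hng⟩
        refine h.out _ _ _ hrpos (by linarith [hrp.2.2]) hω ?_
        rw [hθ]; exact (hα _ hgd hrp.1).2
      · have hD : g tp ∉ D k := fun hD => hb1 (Or.inl (Or.inl ⟨hD, by rw [mem_sphere_zero_iff_norm, hnorm tp hpI, q]⟩))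
        refine hnE ?_ hD
        refine h.out _ _ _ hrpos (by linarith [hrp.2.2]) hω ?_
        rw [q, lt_div_iff₀ hc]
        have := mul_pos hs.1 q'
        have := mul_nonneg htp0 hd1p.le
        linarith
      · have hD : g tp ∉ D k := fun hD => hb1 (Or.inl (Or.inr ⟨hD, by rw [mem_sphere_zero_iff_norm, hnorm tp hpI, q]⟩))
        refine hnE ?_ hD
        refine h.out _ _ _ hrpos (by linarith [hrp.2.2]) hω ?_
        rw [q, lt_div_iff₀ hc]
        have := mul_pos (sub_pos.2 hs.2) (neg_pos.2 q')
        have := mul_nonneg htp0 hd1p.le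
        linarith
    have hin : g (-tm) ∈ U k := by
      have hnE : g (-tm) ∈ E → g (-tm) ∉ D k → g (-tm) ∈ U k := fun h1 h2 => by
        by_contra h3
        exact h2 (Or.inr ⟨h1, h3⟩)
      have hrpos : 0 < r0 - (-tm) * d2 := by linarith [hrm.1.1]
      rcases htme with q | ⟨q, q'⟩ | ⟨q, q'⟩
      · have hθ : (u0 + (-tm) * d1) / c = T1 := by
          rw [show u0 + (-tm) * d1 = c * T1 by linarith]; field_simp
        have hD : g (-tm) ∉ D' k := fun hD => hb2 (Or.inr (Or.inl ⟨hD, by rw [hnorm _ hmI]; linarith [hrm.1.1], by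
          rw [hinn, hnorm _ hmI, hθ]⟩))
        refine hnE ?_ (fun hD2 => hD (Or.inl hD2))
        have hgd : r0 - (-tm) * d2 ∈ Gd := by
          by_contra hng
          refine hD (Or.inr ?_)
          change 0 < ‖g (-tm)‖ ∧ ‖g (-tm)‖ ∉ Gd
          rw [hnorm _ hmI]; exact ⟨hrpos, hng⟩
        refine h.ins _ _ _ hrpos (by linarith [hrm.2.1]) hω ?_
        rw [hθ]; exact (hα _ hgd hrm.1).1
      · rw [show r0 - tm * -d2 = r0 - (-tm) * d2 by ring] at q
        have hD : g (-tm) ∉ D k := fun hD => hb2 (Or.inl (Or.inl ⟨hD, by rw [mem_sphere_zero_iff_norm, hnorm _ hmI, q]⟩))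
        refine hnE ?_ hD
        refine h.ins _ _ _ hrpos (by linarith [hrm.2.1]) hω ?_
        rw [q, div_lt_iff₀ hc]
        have := mul_pos hs.1 q'
        have := mul_nonneg htm0 hd1p.le
        linarith
      · rw [show r0 - tm * -d2 = r0 - (-tm) * d2 by ring] at q
        have hD : g (-tm) ∉ D k := fun hD => hb2 (Or.inl (Or.inr ⟨hD, by rw [mem_sphere_zero_iff_norm, hnorm _ hmI, q]⟩))
        refine hnE ?_ hD
        refine h.ins _ _ _ hrpos (by linarith [hrm.2.1]) hω ?_
        rw [q, div_lt_iff₀ hc]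
        have := mul_pos (sub_pos.2 hs.2) (neg_pos.2 q')
        have := mul_nonneg htm0 hd1p.le
        linarith
    obtain ⟨t, ht, hfr⟩ := path_frontier (h.op k) hgc (show -tm ≤ tp by linarith) hin hout
    refine ⟨g t, Or.inl ⟨hfr, ?_, ?_⟩, hR t ht⟩
    · rw [mem_closedBall_zero_iff, hnorm t ht]; exact (hmem t ht).1.2
    · rw [mem_ball_zero_iff, hnorm t ht, not_lt]; exact (hmem t ht).1.1
  · rintro _ _ _ _ ⟨r, hr, θ, hθ, ω, hω, rfl, rfl⟩ ⟨r', hr', θ', hθ', ω', hω', rfl, rfl⟩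
    rw [NNReal.coe_one, one_mul]
    refine abs_le_of_sq_le_sq' ?_ dist_nonneg |>.2
    rw [Zc_dist h.he hω hω']
    have key := hd r r' θ θ' ω ω' ⟨hxp.trans hr.1, hr.2.trans hyp⟩ ⟨hxp.trans hr'.1, hr'.2.trans hyp⟩
      ⟨hT1.trans hθ.1, hθ.2.trans hT2⟩ ⟨hT1.trans hθ'.1, hθ'.2.trans hT2⟩ hω hω'
    have hcs : (sg r θ - sg r' θ') ^ 2 ≤ (r - r') ^ 2 + (c * (θ - θ')) ^ 2 := by
      have e1 : sg r θ - sg r' θ' = (r - r') * d1 + (c * (θ - θ')) * d2 := by simp only [hsg]; ring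
      rw [e1]
      have e2 : ((r - r') * d1 + (c * (θ - θ')) * d2) ^ 2 + ((r - r') * d2 - (c * (θ - θ')) * d1) ^ 2 =
        ((r - r') ^ 2 + (c * (θ - θ')) ^ 2) * (d1 ^ 2 + d2 ^ 2) := by ring
      rw [hdd, mul_one] at e2
      nlinarith [sq_nonneg ((r - r') * d2 - (c * (θ - θ')) * d1)]
    linarith

def Sc (E : Set (EE n)) (e : EE n) (N : ℝ → ℝ) : Set (EE n) := {w | w ∈ Sb E ∧ w ∈ OA e ∧ ContinuousAt N ‖w‖}

theorem GoodF.f_le (hf : GoodF f) {e : EE n} (he : ‖e‖ = 1) {p : ℝ} (hp : 0 ≤ p) {w : EE n} (hw : p ≤ ‖w‖) :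
    f (p • e) ≤ f w := hf.mono _ _ (by rw [norm_smul, he, mul_one, Real.norm_of_nonneg hp]; exact hw)

theorem GoodF.f_ge (hf : GoodF f) {e : EE n} (he : ‖e‖ = 1) {p : ℝ} (hp : 0 ≤ p) {w : EE n} (hw : ‖w‖ ≤ p) :
    f w ≤ f (p • e) := hf.mono _ _ (by rw [norm_smul, he, mul_one, Real.norm_of_nonneg hp]; exact hw)

theorem Prf.Sc_lim (hn : 1 ≤ n) (hf : GoodF f) (h : Pf) (hmt : m ≠ ⊤)
    {w : EE n} (hw : w ∈ Sc E e N) : 0 < ‖w‖ ∧ ∃ θ ∈ Ioo 0 π, ∃ ω, Om e ω ∧ w = W e ‖w‖ θ ω ∧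
      Tendsto α (𝓝 ‖w‖ ⊓ 𝓟 Gd) (𝓝 θ) := by
  obtain ⟨h1, h2, h3⟩ := hw
  obtain ⟨h0, θ, hθ, ω, hω, hW⟩ := OA_W hn h.he h2
  refine ⟨h0, θ, hθ, ω, hω, hW, ?_⟩
  obtain ⟨a, ha⟩ := h.alim hn hf hmt h0 le_rfl h3
  have := h.S_btw hn h0 (ha.mono_left (inf_le_inf_right _ nhdsWithin_le_nhds))
    (ha.mono_left (inf_le_inf_right _ nhdsWithin_le_nhds)) hω ⟨hθ.1.le, hθ.2.le⟩ (hW ▸ h1)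
  rw [min_self, max_self, Icc_self, mem_singleton_iff] at this
  rwa [this]

theorem Prf.gN (h : Pf) {p : ℝ} (hp : 0 < p) :
    (𝓝 p ⊓ 𝓟 Gd).NeBot := by
  have := h.gR hp
  exact NeBot.mono this (inf_le_inf_right _ nhdsWithin_le_nhds)

set_option maxHeartbeats 1000000 in
theorem Prf.UB (hn : 1 ≤ n) (hf : GoodF f) (h : Pf) (hmt : m ≠ ⊤)
    {p a K : ℝ} (hp : 0 < p) (ha : a ∈ Ioo 0 π) (hal : Tendsto α (𝓝[>] p ⊓ 𝓟 Gd) (𝓝 a)) (hK : 1 < K) :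
    ∃ δ > 0, ∀ y ∈ Ioo p (p + δ), ∫⁻ w in Sc E e N ∩ {w | p < ‖w‖ ∧ ‖w‖ < y}, ofReal (f w) ∂Hm ≤
      ofReal K ^ (n + 1) * ofReal (Function.leftLim N y - Function.rightLim N p) := by
  obtain ⟨δ, η, c, ρ, hδ, hη, hc, hρ, hη1, hη2, hd, l, hl0, hl⟩ := loc hn h.he hp ha hK
  obtain ⟨T1, hT1, hc1⟩ := h.cone (a - η) a p hη1.le (by linarith) ha.2.le hp
  obtain ⟨T2, hT2, hc2⟩ := h.cone a (a + η) p ha.1.le (by linarith) hη2.le hp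
  have hF0 : 0 < f (p • e) := hf.pos _
  set F := f (p • e) with hF
  obtain ⟨δ1, hδ1, hd1⟩ : ∃ δ1 > 0, ∀ r ∈ Gd, r ∈ Ioo p (p + δ1) → α r ∈ Ioo T1 T2 := by
    have := hal.eventually (Ioo_mem_nhds hT1.2 hT2.1)
    rw [eventually_inf_principal] at this
    obtain ⟨b, hb, hb2⟩ := mem_nhdsGT_iff_exists_Ioo_subset.1 this
    exact ⟨b - p, sub_pos.2 hb, fun r hr hr2 => hb2 (by simpa using hr2) hr⟩
  obtain ⟨δ2, hδ2, hd2⟩ : ∃ δ2 > 0, ∀ r ∈ Ioo p (p + δ2), f (r • e) ≤ K * F := by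
    have hcc : ContinuousAt (fun r : ℝ => f (r • e)) p := (hf.cont.comp (by fun_prop)).continuousAt
    have : ∀ᶠ r in 𝓝 p, f (r • e) < K * F := hcc.eventually_lt_const (by nlinarith)
    obtain ⟨b, hb, hb2⟩ := mem_nhdsGT_iff_exists_Ioo_subset.1 (nhdsWithin_le_nhds (s := Ioi p) this)
    exact ⟨b - p, sub_pos.2 hb, fun r hr => le_of_lt (hb2 (by simpa using hr))⟩
  set d := min δ (min δ1 δ2) with hdd
  have hdδ : d ≤ δ := min_le_left _ _
  have hdδ1 : d ≤ δ1 := (min_le_right _ _).trans (min_le_left _ _)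
  have hdδ2 : d ≤ δ2 := (min_le_right _ _).trans (min_le_right _ _)
  have hFl : 0 < F * l := mul_pos hF0 (by exact_mod_cast hl0)
  have key : ∀ x ∈ Gd, ∀ y ∈ Gd, x ∈ Ioo p (p + d) → y ∈ Ioo p (p + d) → x < y →
      F * l * √((y - x) ^ 2 + (c * (α y - α x)) ^ 2) ≤ N y - N x := by
    intro x hx y hy hxd hyd hxy
    have := h.CL hf hmt hc hη1 hη2 (fun r r' θ θ' ω ω' q1 q2 q3 q4 q5 q6 => (hd r r' θ θ' ω ω' q1 q2 q3 q4 q5 q6).1) hl hx hy hxy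
      hxd.1.le (by linarith [hyd.2]) hxd.1.le hT1.1.le hT2.2.le hc1 hc2
      (fun r hr hr2 => hd1 r hr ⟨by linarith [hr2.1, hxd.1], by linarith [hr2.2, hyd.2]⟩) (cf := ofReal F) ENNReal.ofReal_ne_top
      (fun w hw => ENNReal.ofReal_le_ofReal (hf.f_le h.he hp.le (hxd.1.le.trans hw)))
    rw [← ENNReal.ofReal_coe_nnreal (p := l), ← ENNReal.ofReal_mul (by positivity), ← ENNReal.ofReal_mul hF0.le,
      ENNReal.ofReal_le_ofReal_iff (sub_nonneg.2 (h.mono hxy.le))] at this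
    linarith
  have key2 : ∀ r r' θ θ', r ∈ Ioo p (p + d) → r' ∈ Ioo p (p + d) → ContinuousAt N r → ContinuousAt N r' →
      Tendsto α (𝓝 r ⊓ 𝓟 Gd) (𝓝 θ) → Tendsto α (𝓝 r' ⊓ 𝓟 Gd) (𝓝 θ') → r < r' →
      F * l * √((r' - r) ^ 2 + (c * (θ' - θ)) ^ 2) ≤ N r' - N r := by
    intro r r' θ θ' hr hr' hN hN' ht ht' hlt
    have i1 := h.gN (hp.trans hr.1)
    have i2 := h.gN (hp.trans hr'.1)
    have t1 : Tendsto (Prod.fst : ℝ × ℝ → ℝ) ((𝓝 r ⊓ 𝓟 Gd) ×ˢ (𝓝 r' ⊓ 𝓟 Gd)) (𝓝 r ⊓ 𝓟 Gd) := tendsto_fst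
    have t2 : Tendsto (Prod.snd : ℝ × ℝ → ℝ) ((𝓝 r ⊓ 𝓟 Gd) ×ˢ (𝓝 r' ⊓ 𝓟 Gd)) (𝓝 r' ⊓ 𝓟 Gd) := tendsto_snd
    have t1' := t1.mono_right inf_le_left
    have t2' := t2.mono_right inf_le_left
    refine le_of_tendsto_of_tendsto (((((t2'.sub t1').pow 2).add ((((ht'.comp t2).sub (ht.comp t1)).const_mul c).pow 2)).sqrt).const_mul (F * l))
      ((hN'.tendsto.comp t2').sub (hN.tendsto.comp t1')) ?_
    obtain ⟨q, hq1, hq2⟩ := exists_between hlt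
    filter_upwards [t1.eventually (eventually_inf_principal.2 (Eventually.of_forall fun _ hx => hx)),
      t2.eventually (eventually_inf_principal.2 (Eventually.of_forall fun _ hx => hx)),
      t1'.eventually (Ioo_mem_nhds hr.1 hr.2), t2'.eventually (Ioo_mem_nhds hr'.1 hr'.2),
      t1'.eventually (Iio_mem_nhds hq1), t2'.eventually (Ioi_mem_nhds hq2)] with z z1 z2 z3 z4 z5 z6
    exact key z.1 z1 z.2 z2 z3 z4 (lt_trans z5 z6)
  have key3 : ∀ r r' θ θ', r ∈ Ioo p (p + d) → r' ∈ Ioo p (p + d) → ContinuousAt N r → ContinuousAt N r' →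
      Tendsto α (𝓝 r ⊓ 𝓟 Gd) (𝓝 θ) → Tendsto α (𝓝 r' ⊓ 𝓟 Gd) (𝓝 θ') →
      (r - r') ^ 2 + (c * (θ - θ')) ^ 2 ≤ (N r / (F * l) - N r' / (F * l)) ^ 2 := by
    have aux : ∀ A B s : ℝ, 0 ≤ A → F * l * √A ≤ B → A ≤ (B / (F * l)) ^ 2 := fun A B s hA hB => by
      have : √A ≤ B / (F * l) := by rw [le_div_iff₀ hFl]; linarith
      calc A = √A ^ 2 := (Real.sq_sqrt hA).symm
        _ ≤ _ := pow_le_pow_left₀ (Real.sqrt_nonneg _) this 2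
    intro r r' θ θ' hr hr' hN hN' ht ht'
    rcases lt_trichotomy r r' with hlt | heq | hlt
    · have := aux _ _ 0 (by positivity) (key2 r r' θ θ' hr hr' hN hN' ht ht' hlt)
      rw [sub_div] at this; linarith
    · subst heq
      have i1 := h.gN (hp.trans hr.1)
      rw [tendsto_nhds_unique ht ht']; simp
    · have := aux _ _ 0 (by positivity) (key2 r' r θ' θ hr' hr hN' hN ht' ht hlt)
      rw [sub_div] at this; linarith
  refine ⟨d, by positivity, fun y hy => ?_⟩
  set B := Sc E e N ∩ {w | p < ‖w‖ ∧ ‖w‖ < y} with hB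
  have hH : Hm B ≤ ofReal K ^ n * Hm (Zc e ρ (Icc (Function.rightLim N p / (F * l)) (Function.leftLim N y / (F * l)))) := by
    refine haus_rel (K := K.toNNReal) (fun b' b => ∃ r θ ω, r ∈ Ioo p (p + d) ∧ ContinuousAt N r ∧ Tendsto α (𝓝 r ⊓ 𝓟 Gd) (𝓝 θ) ∧
      Om e ω ∧ θ ∈ Icc (a - η) (a + η) ∧ b = W e r θ ω ∧ b' = (N r / (F * l)) • e + ρ • ω) ?_ ?_
    · rintro w ⟨hw, hw1, hw2⟩
      obtain ⟨h0, θ, hθ, ω, hω, hW, ht⟩ := h.Sc_lim hn hf hmt hw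
      refine ⟨_, ⟨N ‖w‖ / (F * l), ⟨?_, ?_⟩, ω, hω, rfl⟩, ‖w‖, θ, ω, ⟨hw1, hw2.trans hy.2⟩, hw.2.2, ht, hω, ?_, hW, rfl⟩
      · exact div_le_div_of_nonneg_right (h.mono.rightLim_le hw1) hFl.le
      · exact div_le_div_of_nonneg_right (h.mono.le_leftLim hw2) hFl.le
      · have i1 := h.gN h0
        have := isClosed_Icc.mem_of_tendsto ht (b := 𝓝 ‖w‖ ⊓ 𝓟 Gd) (s := Icc T1 T2) (by
          rw [eventually_inf_principal]
          filter_upwards [Ioo_mem_nhds hw1 (hw2.trans hy.2)] with r hr hrG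
          have := hd1 r hrG ⟨hr.1, by linarith [hr.2]⟩
          exact ⟨this.1.le, this.2.le⟩)
        exact ⟨by linarith [this.1, hT1.1], by linarith [this.2, hT2.2]⟩
    · rintro _ _ _ _ ⟨r, θ, ω, q1, q2, q3, q4, q5, rfl, rfl⟩ ⟨r', θ', ω', q1', q2', q3', q4', q5', rfl, rfl⟩
      rw [Real.coe_toNNReal _ (by linarith)]
      refine abs_le_of_sq_le_sq' ?_ (by positivity) |>.2
      rw [mul_pow, Zc_dist h.he q4 q4']
      refine (hd r r' θ θ' ω ω' ⟨q1.1.le, by linarith [q1.2]⟩ ⟨q1'.1.le, by linarith [q1'.2]⟩ q5 q5' q4 q4').2.trans ?_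
      have := key3 r r' θ θ' q1 q1' q2 q2' q3 q3'
      gcongr
  rw [hl _ measurableSet_Icc, Real.volume_Icc, ← sub_div] at hH
  calc ∫⁻ w in B, ofReal (f w) ∂Hm ≤ ∫⁻ w in B, ofReal (K * F) ∂Hm := by
        refine setLIntegral_mono measurable_const fun w hw => ENNReal.ofReal_le_ofReal ?_
        exact (hf.f_ge h.he (norm_nonneg w) le_rfl).trans (hd2 _ ⟨hw.2.1, by linarith [hw.2.2, hy.2]⟩)
    _ = ofReal (K * F) * Hm B := setLIntegral_const _ _
    _ ≤ ofReal (K * F) * (ofReal K ^ n * (l * ofReal ((Function.leftLim N y - Function.rightLim N p) / (F * l)))) :=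
        mul_le_mul' le_rfl hH
    _ = _ := by
        rw [← ENNReal.ofReal_coe_nnreal (p := l), ← ENNReal.ofReal_pow (by linarith), ← ENNReal.ofReal_mul (by positivity),
          ← ENNReal.ofReal_mul (by positivity), ← ENNReal.ofReal_mul (by positivity), ← ENNReal.ofReal_pow (by linarith),
          ← ENNReal.ofReal_mul (by positivity)]
        congr 1
        have : (l : ℝ) ≠ 0 := by exact_mod_cast hl0.ne'
        have := hF0.ne'
        field_simp
        ring

def Sj (E : Set (EE n)) (e : EE n) (N : ℝ → ℝ) (J : Set ℝ) (q : ℝ) : Set (EE n) :=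
  {w | w ∈ Sb E ∧ w ∈ OA e ∧ (ContinuousAt N ‖w‖ ∨ ‖w‖ ∈ J) ∧ |inner ℝ w e| ≤ q * ‖w‖}

theorem Prf.rstep (hn : 1 ≤ n) (hf : GoodF f) (h : Pf) (hmt : m ≠ ⊤)
    {J : Set ℝ} (hJ : J.Finite) {q K p : ℝ} (hq0 : 0 < q) (hq : q < 1) (hK : 1 < K) (hp : 0 < p) :
    ∃ δ > 0, ∀ y ∈ Ioo p (p + δ), ∫⁻ w in Sj E e N J q ∩ {w | p ≤ ‖w‖ ∧ ‖w‖ < y}, ofReal (f w) ∂Hm ≤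
      ofReal K ^ (n + 1) * ofReal (Function.leftLim N y - Function.leftLim N p) := by
  obtain ⟨δ0, hδ0, hdJ⟩ : ∃ δ0 > 0, ∀ r ∈ J, r ∉ Ioo p (p + δ0) := by
    have : (J \ {p})ᶜ ∈ 𝓝 p := (hJ.subset sdiff_subset).isClosed.isOpen_compl.mem_nhds (by simp)
    obtain ⟨b, hb, hb2⟩ := mem_nhdsGT_iff_exists_Ioo_subset.1 (nhdsWithin_le_nhds (s := Ioi p) this)
    exact ⟨b - p, sub_pos.2 hb, fun r hr hr2 => hb2 (by simpa using hr2) ⟨hr, hr2.1.ne'⟩⟩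
  obtain ⟨a, ha⟩ := h.alim hn hf hmt hp nhdsWithin_le_nhds (h.mono.tendsto_rightLim p)
  have i1 := h.gR hp
  have har : a ∈ Icc 0 π := isClosed_Icc.mem_of_tendsto ha (Eventually.of_forall h.rng)
  obtain ⟨δ1, hδ1, hd1⟩ : ∃ δ1 > 0, ∀ y ∈ Ioo p (p + δ1),
      ∫⁻ w in (Sc E e N ∩ {w | |inner ℝ w e| ≤ q * ‖w‖}) ∩ {w | p < ‖w‖ ∧ ‖w‖ < y}, ofReal (f w) ∂Hm ≤
      ofReal K ^ (n + 1) * ofReal (Function.leftLim N y - Function.rightLim N p) := by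
    by_cases hab : a ∈ Ioo 0 π
    · obtain ⟨δ, hδ, hd⟩ := h.UB hn hf hmt hp hab ha hK
      exact ⟨δ, hδ, fun y hy => (lintegral_mono_set (inter_subset_inter_left _ inter_subset_left)).trans (hd y hy)⟩
    · have hcos : q < |Real.cos a| := by
        rcases har.1.eq_or_lt with h0 | h0
        · rw [← h0]; simpa using hq
        · rcases har.2.eq_or_lt with h1 | h1
          · rw [h1]; simpa using hq
          · exact absurd ⟨h0, h1⟩ hab
      obtain ⟨q', hq', hq2⟩ := exists_between hcos
      have := (Real.continuous_cos.abs.tendsto a).comp ha |>.eventually (Ioi_mem_nhds hq2)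
      rw [eventually_inf_principal] at this
      obtain ⟨b, hb, hb2⟩ := mem_nhdsGT_iff_exists_Ioo_subset.1 this
      refine ⟨b - p, sub_pos.2 hb, fun y hy => ?_⟩
      rw [show (Sc E e N ∩ {w | |inner ℝ w e| ≤ q * ‖w‖}) ∩ {w | p < ‖w‖ ∧ ‖w‖ < y} = ∅ by
        refine eq_empty_of_forall_notMem ?_
        rintro w ⟨⟨hw, hwq⟩, hw1, hw2⟩
        obtain ⟨h0, θ, hθ, ω, hω, hW, ht⟩ := h.Sc_lim hn hf hmt hw
        have i1 := h.gN h0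
        have := ge_of_tendsto ((Real.continuous_cos.abs.tendsto θ).comp ht) (b := q') (by
          rw [eventually_inf_principal]
          filter_upwards [Ioo_mem_nhds hw1 (show ‖w‖ < b by linarith [hy.2])] with r hr hrG
          exact le_of_lt (hb2 hr hrG))
        rw [mem_ofPred_eq] at hwq
        have hin : inner ℝ w e = ‖w‖ * Real.cos θ := by
          conv_lhs => rw [hW, W_inner h.he hω]
        rw [hin, abs_mul, abs_of_pos h0, mul_comm q] at hwq
        have := le_of_mul_le_mul_left hwq h0
        linarith]
      simp
  refine ⟨min δ0 δ1, by positivity, fun y hy => ?_⟩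
  have hy0 : y ≤ p + δ0 := hy.2.le.trans (by linarith [min_le_left δ0 δ1])
  have hy1 : y ∈ Ioo p (p + δ1) := ⟨hy.1, hy.2.trans_le (by linarith [min_le_right δ0 δ1])⟩
  have hsub : Sj E e N J q ∩ {w | p ≤ ‖w‖ ∧ ‖w‖ < y} ⊆ (Sb E ∩ OA e ∩ sphere 0 p) ∪
      ((Sc E e N ∩ {w | |inner ℝ w e| ≤ q * ‖w‖}) ∩ {w | p < ‖w‖ ∧ ‖w‖ < y}) := by
    rintro w ⟨⟨h1, h2, h3, h4⟩, h5, h6⟩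
    rcases h5.eq_or_lt with h7 | h7
    · exact Or.inl ⟨⟨h1, h2⟩, by rw [mem_sphere_zero_iff_norm, h7]⟩
    · refine Or.inr ⟨⟨⟨h1, h2, h3.resolve_right fun hJ => hdJ _ hJ ⟨h7, h6.trans_le hy0⟩⟩, h4⟩, h7, h6⟩
  have hK1 : 1 ≤ ofReal K ^ (n + 1) := one_le_pow₀ (by rw [← ENNReal.ofReal_one]; exact ENNReal.ofReal_le_ofReal hK.le)
  have hsp : ∫⁻ w in Sb E ∩ OA e ∩ sphere 0 p, ofReal (f w) ∂Hm ≤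
      ofReal (Function.rightLim N p - Function.leftLim N p) := by
    refine le_trans ?_ (h.JC hn hf hmt hp)
    rw [← setLIntegral_const]
    refine setLIntegral_mono measurable_const fun w hw => ENNReal.ofReal_le_ofReal (hf.f_ge h.he hp.le ?_)
    exact (mem_sphere_zero_iff_norm.1 hw.2).le
  calc _ ≤ _ := lintegral_mono_set hsub
    _ ≤ _ := lintegral_union_le _ _ _
    _ ≤ ofReal K ^ (n + 1) * ofReal (Function.rightLim N p - Function.leftLim N p) +
        ofReal K ^ (n + 1) * ofReal (Function.leftLim N y - Function.rightLim N p) :=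
      add_le_add (hsp.trans (le_mul_of_one_le_left' hK1)) (hd1 y hy1)
    _ = _ := by
      rw [← mul_add, ← ENNReal.ofReal_add (sub_nonneg.2 (h.mono.leftLim_le_rightLim le_rfl)) (sub_nonneg.2 (h.mono.rightLim_le_leftLim hy.1))]
      congr 2; ring

theorem Prf.ind (hn : 1 ≤ n) (hf : GoodF f) (h : Pf) (hmt : m ≠ ⊤)
    {J : Set ℝ} (hJ : J.Finite) {q K x0 T : ℝ} (hq0 : 0 < q) (hq : q < 1) (hK : 1 < K) (hx0 : 0 < x0) (hT : x0 ≤ T) :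
    ∫⁻ w in Sj E e N J q ∩ {w | x0 ≤ ‖w‖ ∧ ‖w‖ < T}, ofReal (f w) ∂Hm ≤
      ofReal K ^ (n + 1) * ofReal (Function.leftLim N T - Function.leftLim N x0) := by
  by_contra hbad
  set Q : Set ℝ := {T | x0 ≤ T ∧ ¬ (∫⁻ w in Sj E e N J q ∩ {w | x0 ≤ ‖w‖ ∧ ‖w‖ < T}, ofReal (f w) ∂Hm ≤
      ofReal K ^ (n + 1) * ofReal (Function.leftLim N T - Function.leftLim N x0))} with hQ
  have hQb : BddBelow Q := ⟨x0, fun T h => h.1⟩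
  have hQn : Q.Nonempty := ⟨T, hT, hbad⟩
  set t := sInf Q with ht
  have htx : x0 ≤ t := le_csInf hQn fun T h => h.1
  have hlow : ∀ T' < t, ∫⁻ w in Sj E e N J q ∩ {w | x0 ≤ ‖w‖ ∧ ‖w‖ < T'}, ofReal (f w) ∂Hm ≤
      ofReal K ^ (n + 1) * ofReal (Function.leftLim N t - Function.leftLim N x0) := by
    intro T' hT'
    rcases lt_or_ge T' x0 with h1 | h1
    · rw [show Sj E e N J q ∩ {w | x0 ≤ ‖w‖ ∧ ‖w‖ < T'} = ∅ from
        eq_empty_of_forall_notMem fun w hw => by linarith [hw.2.1, hw.2.2]]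
      simp
    · have : T' ∉ Q := fun hh => absurd (csInf_le hQb hh) (not_le.2 hT')
      have := not_not.1 fun hh => this ⟨h1, hh⟩
      refine this.trans (mul_le_mul' le_rfl (ENNReal.ofReal_le_ofReal (by linarith [h.mono.leftLim hT'.le])))
  have hPt : ∫⁻ w in Sj E e N J q ∩ {w | x0 ≤ ‖w‖ ∧ ‖w‖ < t}, ofReal (f w) ∂Hm ≤
      ofReal K ^ (n + 1) * ofReal (Function.leftLim N t - Function.leftLim N x0) := by
    have hun : Sj E e N J q ∩ {w | x0 ≤ ‖w‖ ∧ ‖w‖ < t} = ⋃ j : ℕ, Sj E e N J q ∩ {w | x0 ≤ ‖w‖ ∧ ‖w‖ < t - 1 / ((j : ℝ) + 1)} := by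
      ext w
      simp only [mem_inter_iff, mem_iUnion, mem_ofPred_eq]
      constructor
      · rintro ⟨h1, h2, h3⟩
        obtain ⟨j, hj⟩ := exists_nat_one_div_lt (sub_pos.2 h3)
        exact ⟨j, h1, h2, by linarith⟩
      · rintro ⟨j, h1, h2, h3⟩
        have : (0 : ℝ) < 1 / ((j : ℝ) + 1) := by positivity
        exact ⟨h1, h2, by linarith⟩
    rw [hun, setLIntegral_iUnion_of_directed]
    · exact iSup_le fun j => hlow _ (by have : (0 : ℝ) < 1 / ((j : ℝ) + 1) := by positivity
                                        linarith)
    · refine Monotone.directed_le fun i j hij => inter_subset_inter_right _ fun w hw => ⟨hw.1, hw.2.trans_le ?_⟩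
      have := one_div_le_one_div_of_le (show (0 : ℝ) < (i : ℝ) + 1 by positivity) (show (i : ℝ) + 1 ≤ j + 1 by exact_mod_cast Nat.succ_le_succ hij)
      linarith
  obtain ⟨δ, hδ, hd⟩ := h.rstep hn hf hmt hJ hq0 hq hK (hx0.trans_le htx) (p := t)
  obtain ⟨y, hyQ, hyt⟩ := exists_lt_of_csInf_lt hQn (show t < t + δ by linarith)
  rcases (csInf_le hQb hyQ).eq_or_lt with heq | hlt
  · exact hyQ.2 (by rw [← heq]; exact hPt)
  · refine hyQ.2 ?_
    calc _ ≤ ∫⁻ w in (Sj E e N J q ∩ {w | x0 ≤ ‖w‖ ∧ ‖w‖ < t}) ∪ (Sj E e N J q ∩ {w | t ≤ ‖w‖ ∧ ‖w‖ < y}), ofReal (f w) ∂Hm := by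
          refine lintegral_mono_set fun w hw => ?_
          rcases lt_or_ge ‖w‖ t with h1 | h1
          · exact Or.inl ⟨hw.1, hw.2.1, h1⟩
          · exact Or.inr ⟨hw.1, h1, hw.2.2⟩
      _ ≤ _ := lintegral_union_le _ _ _
      _ ≤ _ := add_le_add hPt (hd y ⟨hlt, hyt⟩)
      _ = _ := by
        rw [← mul_add, ← ENNReal.ofReal_add (sub_nonneg.2 (h.mono.leftLim htx)) (sub_nonneg.2 (h.mono.leftLim hlt.le))]
        congr 2; ring

theorem Prf.main (hn : 1 ≤ n) (hf : GoodF f) (h : Pf) (hmt : m ≠ ⊤) :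
    ∫⁻ w in Sb E ∩ OA e, ofReal (f w) ∂Hm ≤ m := by
  set D : Set ℝ := {r | ¬ ContinuousAt N r}
  have : Countable D := h.mono.countable_not_continuousAt.to_subtype
  have hK : ∀ K : ℝ, 1 < K → ∫⁻ w in Sb E ∩ OA e, ofReal (f w) ∂Hm ≤ ofReal K ^ (n + 1) * m := by
    intro K hK
    set s : Finset D × ℕ → Set (EE n) := fun i => Sj E e N (((↑) : D → ℝ) '' (i.1 : Set D)) (1 - 1 / ((i.2 : ℝ) + 2)) ∩
      {w | 1 / ((i.2 : ℝ) + 2) ≤ ‖w‖ ∧ ‖w‖ < (i.2 : ℝ) + 2} with hs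
    have hun : Sb E ∩ OA e ⊆ ⋃ i, s i := by
      rintro w ⟨h1, h2⟩
      have h2' : |inner ℝ w e| < ‖w‖ := h2
      have hw0 : 0 < ‖w‖ := (abs_nonneg _).trans_lt h2'
      obtain ⟨j1, hj1⟩ := exists_nat_one_div_lt (div_pos (sub_pos.2 h2') hw0)
      obtain ⟨j2, hj2⟩ := exists_nat_one_div_lt hw0
      obtain ⟨j3, hj3⟩ := exists_nat_gt ‖w‖
      set j := j1 + j2 + j3
      have e1 : 1 / ((j : ℝ) + 2) ≤ 1 / ((j1 : ℝ) + 1) := one_div_le_one_div_of_le (by positivity) (by push_cast [j]; linarith [j2.cast_nonneg (α := ℝ), j3.cast_nonneg (α := ℝ)])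
      have e2 : 1 / ((j : ℝ) + 2) ≤ 1 / ((j2 : ℝ) + 1) := one_div_le_one_div_of_le (by positivity) (by push_cast [j]; linarith [j1.cast_nonneg (α := ℝ), j3.cast_nonneg (α := ℝ)])
      have hb : |inner ℝ w e| ≤ (1 - 1 / ((j : ℝ) + 2)) * ‖w‖ := by
        have := e1.trans hj1.le
        rw [le_div_iff₀ hw0] at this; linarith
      have hc : 1 / ((j : ℝ) + 2) ≤ ‖w‖ ∧ ‖w‖ < (j : ℝ) + 2 := ⟨e2.trans hj2.le, by push_cast [j]; linarith [j1.cast_nonneg (α := ℝ), j2.cast_nonneg (α := ℝ)]⟩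
      rw [mem_iUnion]
      by_cases hD : ContinuousAt N ‖w‖
      · exact ⟨(∅, j), ⟨h1, h2, Or.inl hD, hb⟩, hc⟩
      · exact ⟨({⟨‖w‖, hD⟩}, j), ⟨h1, h2, Or.inr ⟨⟨‖w‖, hD⟩, by simp, rfl⟩, hb⟩, hc⟩
    refine (lintegral_mono_set hun).trans ?_
    rw [setLIntegral_iUnion_of_directed]
    · refine iSup_le fun i => ?_
      have h0 : (0 : ℝ) < 1 / ((i.2 : ℝ) + 2) := by positivity
      have h1 : 1 / ((i.2 : ℝ) + 2) < 1 := by rw [div_lt_one (by positivity)]; linarith [i.2.cast_nonneg (α := ℝ)]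
      refine (h.ind hn hf hmt ((Finset.finite_toSet i.1).image _) (by linarith) (by linarith) hK h0 (by linarith [i.2.cast_nonneg (α := ℝ)])).trans ?_
      refine mul_le_mul' le_rfl (le_trans (ENNReal.ofReal_le_ofReal ?_) (h.nm' ((i.2 : ℝ) + 2)))
      have := h.mono.leftLim_le (le_refl ((i.2 : ℝ) + 2))
      have h3 := h.mono.le_leftLim (show 1 / ((i.2 : ℝ) + 2) - 1 < 1 / ((i.2 : ℝ) + 2) by linarith)
      linarith [h.n0 (1 / ((i.2 : ℝ) + 2) - 1)]
    · refine Monotone.directed_le fun i j hij => ?_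
      rintro w ⟨⟨h1, h2, h3, h4⟩, h5, h6⟩
      have hc : (i.2 : ℝ) ≤ j.2 := by exact_mod_cast hij.2
      have := one_div_le_one_div_of_le (show (0 : ℝ) < (i.2 : ℝ) + 2 by positivity) (show (i.2 : ℝ) + 2 ≤ j.2 + 2 by linarith)
      exact ⟨⟨h1, h2, h3.imp_right fun hh => image_mono (Finset.coe_subset.2 hij.1) hh, h4.trans
        (mul_le_mul_of_nonneg_right (by linarith) (norm_nonneg _))⟩, this.trans h5, by linarith⟩
  have hlim : Tendsto (fun K : ℝ => ofReal K ^ (n + 1) * m) (𝓝[>] 1) (𝓝 (ofReal 1 ^ (n + 1) * m)) := by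
    refine ENNReal.Tendsto.mul_const ?_ (Or.inr hmt)
    exact ((ENNReal.continuous_pow _).comp ENNReal.continuous_ofReal).continuousAt.tendsto.mono_left nhdsWithin_le_nhds
  rw [ENNReal.ofReal_one, one_pow, one_mul] at hlim
  exact ge_of_tendsto hlim (eventually_mem_nhdsWithin.mono hK)

theorem wvol_wd (f : EE n → ℝ) (A : Set (EE n)) :
    wvol f A = (volume.withDensity (fun x => ofReal (f x))) A := (withDensity_apply' _ _).symm

theorem wvol_union_le (f : EE n → ℝ) (A B : Set (EE n)) : wvol f (A ∪ B) ≤ wvol f A + wvol f B :=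
  lintegral_union_le _ _ _

theorem f_iso (hf : GoodF f) (R : EE n ≃ₗᵢ[ℝ] EE n) (x : EE n) : f (R x) = f x :=
  le_antisymm (hf.mono _ _ (by simp)) (hf.mono _ _ (by simp))

theorem wvol_iso (hf : GoodF f) (R : EE n ≃ₗᵢ[ℝ] EE n) (A : Set (EE n)) :
    wvol f (R ⁻¹' A) = wvol f A := by
  unfold wvol
  rw [← R.measurePreserving.setLIntegral_comp_preimage_emb R.toHomeomorph.measurableEmbedding _ A]
  simp only [f_iso hf]

theorem wper_iso (hf : GoodF f) (R : EE n ≃ₗᵢ[ℝ] EE n) (A : Set (EE n)) :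
    wper f (R ⁻¹' A) = wper f A := by
  unfold wper
  rw [← (R.toIsometryEquiv.measurePreserving_hausdorffMeasure n).setLIntegral_comp_preimage_emb
    R.toHomeomorph.measurableEmbedding _ (frontier A)]
  have : frontier (R ⁻¹' A) = R.toIsometryEquiv ⁻¹' frontier A := (R.toHomeomorph.preimage_frontier A).symm
  rw [this]
  refine lintegral_congr fun x => ?_
  exact congrArg _ (f_iso hf R x).symm

theorem wper_submod (hf : GoodF f) {A B : Set (EE n)} (hA : IsOpen A) (hB : IsOpen B) :
    wper f (A ∪ B) + wper f (A ∩ B) ≤ wper f A + wper f B := by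
  have hm : ∀ S : Set (EE n), Measurable ((frontier S).indicator fun x => ofReal (f x)) := fun S =>
    hf.meas.indicator isClosed_frontier.measurableSet
  unfold wper
  simp only [← lintegral_indicator isClosed_frontier.measurableSet]
  rw [← lintegral_add_left (hm _), ← lintegral_add_left (hm _)]
  refine lintegral_mono fun x => ?_
  classical
  simp only [Set.indicator_apply]
  have h1 : x ∈ frontier (A ∪ B) ∨ x ∈ frontier (A ∩ B) → x ∈ frontier A ∨ x ∈ frontier B := by
    rintro (h | h)
    · rcases frontier_union_subset _ _ h with h | h
      · exact Or.inl h.1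
      · exact Or.inr h.2
    · rcases frontier_inter_subset _ _ h with h | h
      · exact Or.inl h.1
      · exact Or.inr h.2
  have h2 : x ∈ frontier (A ∪ B) → x ∈ frontier (A ∩ B) → x ∈ frontier A ∧ x ∈ frontier B := by
    intro h1 h2
    rw [fr_open (hA.union hB)] at h1
    rw [fr_open (hA.inter hB)] at h2
    rw [fr_open hA, fr_open hB]
    exact ⟨⟨closure_mono inter_subset_left h2.1, fun h => h1.2 (Or.inl h)⟩,
      ⟨closure_mono inter_subset_right h2.1, fun h => h1.2 (Or.inr h)⟩⟩
  by_cases a : x ∈ frontier (A ∪ B) <;> by_cases b : x ∈ frontier (A ∩ B) <;>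
    by_cases c : x ∈ frontier A <;> by_cases d : x ∈ frontier B <;> simp_all

theorem overlap_cont (hf : GoodF f) {R : unitInterval → (EE n ≃ₗᵢ[ℝ] EE n)}
    (hR : Continuous fun p : unitInterval × EE n => R p.1 p.2) {A : Set (EE n)} (hA : IsOpen A) (hv : wvol f A ≠ ⊤) :
    Continuous fun s => wvol f (R s ⁻¹' A \ A) := by
  obtain ⟨μ, hμ⟩ : ∃ μ, μ = (volume : Measure (EE n)).withDensity (fun x => ofReal (f x)) := ⟨_, rfl⟩
  have hw : ∀ S, wvol f S = μ S := fun S => by rw [hμ, wvol_wd]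
  have hlf : IsLocallyFiniteMeasure μ := by
    rw [hμ]; exact IsLocallyFiniteMeasure.withDensity_ofReal (μ := (volume : Measure (EE n))) hf.cont
  have hmp : ∀ s, MeasurePreserving (R s) μ μ := fun s => by
    refine ⟨(R s).continuous.measurable, Measure.ext fun S hS => ?_⟩
    rw [Measure.map_apply (R s).continuous.measurable hS, ← hw, ← hw, wvol_iso hf]
  have hi : μ.InnerRegularCompactLTTop := inferInstance
  obtain ⟨F, hFR⟩ : ∃ F : unitInterval → C(EE n, EE n), ∀ s, ⇑(F s) = R s := ⟨fun s => ⟨R s, (R s).continuous⟩, fun s => rfl⟩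
  have hF : Continuous F := by
    refine ContinuousMap.continuous_of_continuous_uncurry _ ?_
    have : Function.uncurry (fun x y => F x y) = fun p : unitInterval × EE n => R p.1 p.2 := by
      ext1 p; simp only [Function.uncurry, hFR]
    rwa [this]
  have hle : ∀ s t, wvol f (R s ⁻¹' A \ A) ≤ wvol f (R t ⁻¹' A \ A) + μ (symmDiff (R s ⁻¹' A) (R t ⁻¹' A)) := by
    intro s t
    rw [← hw]
    refine (wvol_mono ?_).trans (wvol_union_le f _ _)
    rintro x ⟨h1, h2⟩
    by_cases h : x ∈ R t ⁻¹' A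
    · exact Or.inl ⟨h, h2⟩
    · exact Or.inr (Or.inl ⟨h1, h⟩)
  refine continuous_iff_continuousAt.2 fun t => ?_
  have h1 : Tendsto (fun s => μ (symmDiff (R s ⁻¹' A) (R t ⁻¹' A))) (𝓝 t) (𝓝 0) := by
    have h0 := tendsto_measure_symmDiff_preimage_nhds_zero (μ := μ) (ν := μ) (s := A) (f := F) (g := F t) (hF.tendsto t)
      (Eventually.of_forall fun s => by rw [hFR]; exact hmp s) (by rw [hFR]; exact hmp t)
      (IsOpen.measurableSet hA).nullMeasurableSet (by rwa [← hw])
    simpa only [hFR] using h0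
  have hft : wvol f (R t ⁻¹' A \ A) ≠ ⊤ :=
    ne_top_of_le_ne_top hv ((wvol_mono sdiff_subset).trans (wvol_iso hf _ _).le)
  refine (ENNReal.tendsto_nhds hft).2 fun ε hε => ?_
  filter_upwards [(ENNReal.tendsto_nhds_zero.1 h1) ε hε] with s hs
  refine ⟨?_, (hle s t).trans (add_le_add_right hs _)⟩
  rw [tsub_le_iff_right]
  refine (hle t s).trans (add_le_add_right ?_ _)
  rwa [symmDiff_comm]

theorem dbl_step (hf : GoodF f) {V m : EN} (hV : V ≠ ⊤) (hmt : m ≠ ⊤)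
    (hmin : ∀ A : Set (EE n), IsOpen A → wvol f A = V → m ≤ wper f A)
    {R : unitInterval → (EE n ≃ₗᵢ[ℝ] EE n)} (hR : Continuous fun p : unitInterval × EE n => R p.1 p.2)
    (hR0 : ∀ x, R 0 x = x) {A : Set (EE n)} (hA : IsOpen A) {v g : EN} (h1 : wvol f A + v = V) (h2 : wper f A + g ≤ m)
    (h3 : v ≤ wvol f (R 1 ⁻¹' A \ A)) :
    ∃ A' ⊆ A, IsOpen A' ∧ wvol f A' + 2 * v = V ∧ wper f A' + 2 * g ≤ m := by
  have hAt : wvol f A ≠ ⊤ := ne_top_of_le_ne_top hV (h1 ▸ le_self_add)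
  have hvt : v ≠ ⊤ := ne_top_of_le_ne_top hV (h1 ▸ le_add_self)
  have hPt : wper f A ≠ ⊤ := ne_top_of_le_ne_top hmt (le_self_add.trans h2)
  obtain ⟨s, hs⟩ := mem_range_of_exists_le_of_exists_ge (overlap_cont hf hR hA hAt) ⟨0, show _ ≤ v by
    have : (R 0 ⁻¹' A \ A) = ∅ := by ext x; simp [hR0]
    rw [this]; simp [wvol]⟩ ⟨1, h3⟩
  have hB : IsOpen (R s ⁻¹' A) := hA.preimage (R s).continuous
  have e1 : wvol f (A ∪ R s ⁻¹' A) = V := by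
    rw [← h1, ← hs]
    simp only [wvol_wd]
    rw [← measure_union disjoint_sdiff_right (MeasurableSet.diff hB.measurableSet hA.measurableSet), union_sdiff_self]
  have e2 : wvol f (A ∩ R s ⁻¹' A) + v = wvol f A := by
    rw [← wvol_iso hf (R s) A, ← hs]
    simp only [wvol_wd]
    rw [inter_comm]
    exact measure_inter_add_sdiff _ hA.measurableSet
  refine ⟨A ∩ R s ⁻¹' A, inter_subset_left, hA.inter hB, by rw [two_mul, ← add_assoc, e2, h1], ?_⟩
  have h4 := (add_le_add_left (hmin _ (hA.union hB) e1) _).trans (wper_submod hf hA hB)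
  rw [wper_iso hf] at h4
  have h5 : m + (wper f (A ∩ R s ⁻¹' A) + 2 * g) ≤ m + m := by
    calc _ ≤ (wper f A + wper f A) + 2 * g := by rw [← add_assoc]; exact add_le_add_left h4 _
      _ = (wper f A + g) + (wper f A + g) := by ring
      _ ≤ _ := add_le_add h2 h2
  exact (ENNReal.add_le_add_iff_left hmt).1 h5

theorem dbl (hf : GoodF f) {V m : EN} (hV : V ≠ ⊤) (hmt : m ≠ ⊤)
    (hmin : ∀ A : Set (EE n), IsOpen A → wvol f A = V → m ≤ wper f A)
    {R : unitInterval → (EE n ≃ₗᵢ[ℝ] EE n)} (hR : Continuous fun p : unitInterval × EE n => R p.1 p.2)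
    (hR0 : ∀ x, R 0 x = x) {A : Set (EE n)} (hA : IsOpen A) {v g B : EN} (h1 : wvol f A + v = V) (h2 : wper f A + g ≤ m)
    (hB : B ≤ wvol f (R 1 ⁻¹' A \ A)) (hvB : v ≤ B) : g * B ≤ 2 * m * v := by
  rcases eq_or_ne v 0 with rfl | hv0
  · have h3 := (add_le_add_left (hmin A hA (by simpa using h1)) g).trans h2
    have : g ≤ 0 := (ENNReal.add_le_add_iff_left hmt).1 (by simpa using h3)
    simp [le_zero_iff.1 this]
  have hAt : wvol f A ≠ ⊤ := ne_top_of_le_ne_top hV (h1 ▸ le_self_add)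
  have hvt : v ≠ ⊤ := ne_top_of_le_ne_top hV (h1 ▸ le_add_self)
  have hBt : B ≠ ⊤ := ne_top_of_le_ne_top hAt (hB.trans ((wvol_mono sdiff_subset).trans (wvol_iso hf _ _).le))
  have key : ∀ j : ℕ, 2 ^ j * v ≤ B → ∃ A' ⊆ A, IsOpen A' ∧ wvol f A' + 2 ^ j * v = V ∧ wper f A' + 2 ^ j * g ≤ m := by
    intro j
    induction j with
    | zero => exact fun _ => ⟨A, subset_rfl, hA, by simpa using h1, by simpa using h2⟩
    | succ j ih =>
      intro hj
      have hj2 : 2 ^ j * v + 2 ^ j * v ≤ B := by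
        convert hj using 1
        ring
      obtain ⟨A', hs, ho, e1, e2⟩ := ih (le_self_add.trans hj2)
      have e3 : wvol f (A \ A') ≤ 2 ^ j * v := by
        have h4 : wvol f A' + wvol f (A \ A') = wvol f A := by
          simp only [wvol_wd]
          have := measure_inter_add_sdiff (μ := volume.withDensity (fun x => ofReal (f x))) A ho.measurableSet
          rwa [inter_eq_right.2 hs] at this
        have h5 : wvol f A' + wvol f (A \ A') ≤ wvol f A' + 2 ^ j * v := by
          rw [h4, e1, ← h1]; exact le_self_add
        exact (ENNReal.add_le_add_iff_left (ne_top_of_le_ne_top hV (e1 ▸ le_self_add))).1 h5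
      have e4 : 2 ^ j * v ≤ wvol f (R 1 ⁻¹' A' \ A') := by
        have h6 : B ≤ wvol f (R 1 ⁻¹' A' \ A') + 2 ^ j * v := by
          refine hB.trans ((wvol_mono ?_).trans ((wvol_union_le f _ (R 1 ⁻¹' (A \ A'))).trans
            (add_le_add_right ((wvol_iso hf _ _).le.trans e3) _)))
          rintro x ⟨h7, h8⟩
          by_cases h9 : R 1 x ∈ A'
          · exact Or.inl ⟨h9, fun h => h8 (hs h)⟩
          · exact Or.inr ⟨h7, h9⟩
        exact (ENNReal.add_le_add_iff_right (show 2 ^ j * v ≠ ⊤ by finiteness)).1 (hj2.trans h6)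
      obtain ⟨A2, k1, k2, k3, k4⟩ := dbl_step hf hV hmt hmin hR hR0 ho e1 e2 e4
      exact ⟨A2, k1.trans hs, k2, by rw [pow_succ']; rwa [mul_assoc], by rw [pow_succ']; rwa [mul_assoc]⟩
  have hx : 1 ≤ B.toReal / v.toReal := by
    rw [one_le_div (ENNReal.toReal_pos hv0 hvt)]
    exact ENNReal.toReal_mono hBt hvB
  obtain ⟨j, j1, j2⟩ := exists_nat_pow_near hx (one_lt_two)
  rw [le_div_iff₀ (ENNReal.toReal_pos hv0 hvt)] at j1
  rw [div_lt_iff₀ (ENNReal.toReal_pos hv0 hvt)] at j2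
  obtain ⟨A', -, -, -, e2⟩ := key j ((ENNReal.toReal_le_toReal (by finiteness) hBt).1 (by simpa using j1))
  have j3 : B ≤ 2 ^ (j + 1) * v := (ENNReal.toReal_le_toReal hBt (by finiteness)).1 (by simpa using j2.le)
  calc g * B ≤ g * (2 ^ (j + 1) * v) := mul_le_mul' le_rfl j3
    _ = 2 * (2 ^ j * g) * v := by ring
    _ ≤ _ := mul_le_mul' (mul_le_mul' le_rfl (le_add_self.trans e2)) le_rfl

theorem wper_cov (hf : GoodF f) {e : EE n} (he : ‖e‖ = 1) {y : ℝ} (hy : 0 ≤ y)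
    {A S T1 T2 Z : Set (EE n)} (h : frontier A ⊆ S ∪ (T1 ∪ T2) ∪ Z) (hZ : Hm Z = 0) (h1 : ∀ w ∈ T1, ‖w‖ ≤ y)
    (h2 : ∀ w ∈ T2, ‖w‖ ≤ y) :
    wper f A ≤ (∫⁻ w in S, ofReal (f w) ∂Hm) + ofReal (f (y • e)) * (Hm T1 + Hm T2) := by
  have hT : ∀ T : Set (EE n), (∀ w ∈ T, ‖w‖ ≤ y) →
      ∫⁻ w in T, ofReal (f w) ∂Hm ≤ ofReal (f (y • e)) * Hm T := fun T hT => by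
    rw [← setLIntegral_const]
    exact setLIntegral_mono measurable_const fun w hw => ENNReal.ofReal_le_ofReal (hf.f_ge he hy (hT w hw))
  refine (lintegral_mono_set h).trans ((lintegral_union_le _ _ _).trans ?_)
  rw [setLIntegral_measure_zero _ _ hZ, add_zero, mul_add]
  exact (lintegral_union_le _ _ _).trans (add_le_add_right ((lintegral_union_le _ _ _).trans
    (add_le_add (hT _ h1) (hT _ h2))) _)

theorem cl_norm {A : Set (EE n)} {w : EE n} (hw : w ∈ closure A) {P : Set ℝ} (hP : IsClosed P)
    (h : ∀ a ∈ A, ‖a‖ ∈ P) : ‖w‖ ∈ P :=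
  closure_minimal h (hP.preimage continuous_norm) hw

theorem wper_split (f : EE n → ℝ) (U : Set (EE n)) (x y : ℝ) :
    wper f U = (∫⁻ w in frontier U \ (ball 0 y \ ball 0 x), ofReal (f w) ∂Hm) +
      ∫⁻ w in frontier U ∩ (ball 0 y \ ball 0 x), ofReal (f w) ∂Hm := by
  rw [add_comm]
  exact (lintegral_inter_add_sdiff _ _ (measurableSet_ball.diff measurableSet_ball)).symm

theorem ann_cut (hf : GoodF f) {e : EE n} (he : ‖e‖ = 1) {x y : ℝ} (hx : 0 < x) (hxy : x < y)
    {U : Set (EE n)} (hU : IsOpen U) (h0 : Hm (frontier U ∩ sphere 0 x) = 0) :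
    wper f (U \ (closedBall 0 y \ ball 0 x)) + (∫⁻ w in frontier U ∩ (ball 0 y \ ball 0 x), ofReal (f w) ∂Hm) ≤
      wper f U + ofReal (f (y • e)) * (Hm (U ∩ sphere 0 x) + Hm (U ∩ sphere 0 y)) := by
  have hA : IsOpen (U \ (closedBall 0 y \ ball 0 x)) := hU.sdiff (isClosed_closedBall.sdiff isOpen_ball)
  have hy := hx.trans hxy
  rw [wper_split f U x y, add_right_comm]
  refine add_le_add_left (wper_cov hf he hy.le (Z := frontier U ∩ sphere 0 x) ?_ h0 ?_ ?_) _
  · intro w hw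
    have hw' := hw
    rw [fr_open hA] at hw
    have hc : w ∈ closure U := closure_mono sdiff_subset hw.1
    have hn : ‖w‖ ∈ Iic x ∪ Ici y := cl_norm hw.1 (isClosed_Iic.union isClosed_Ici) (by
      rintro a ⟨-, h2⟩
      simp only [Set.mem_sdiff, mem_closedBall, mem_ball, dist_zero_right, not_and, not_not] at h2
      by_contra h3
      simp only [mem_union, mem_Iic, mem_Ici, not_or, not_le] at h3
      linarith [h2 h3.2.le])
    simp only [mem_union, Set.mem_sdiff, mem_inter_iff, mem_ball, mem_sphere_iff_norm, sub_zero, dist_zero_right, fr_open hU]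
    have h2 := hw.2
    simp only [Set.mem_sdiff, mem_closedBall, mem_ball, dist_zero_right, not_and, not_not] at h2
    by_cases hwU : w ∈ U
    · have h3 := h2 hwU
      rcases hn with h4 | h4
      · simp only [mem_Iic] at h4
        refine Or.inl (Or.inr (Or.inl ⟨hwU, h4.antisymm ?_⟩))
        by_contra h5
        exact h3 (fun _ => not_le.1 h5)
      · simp only [mem_Ici] at h4
        refine Or.inl (Or.inr (Or.inr ⟨hwU, le_antisymm ?_ h4⟩))
        by_contra h5
        exact h3 (fun h6 => absurd h6 h5)
    · rcases eq_or_ne ‖w‖ x with h3 | h3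
      · exact Or.inr ⟨⟨hc, hwU⟩, h3⟩
      · refine Or.inl (Or.inl ⟨⟨hc, hwU⟩, fun h4 => ?_⟩)
        rcases hn with h5 | h5
        · exact h4.2 (lt_of_le_of_ne h5 h3)
        · exact absurd h4.1 (not_lt.2 h5)
  · rintro w ⟨-, hw⟩
    rw [mem_sphere_zero_iff_norm] at hw
    linarith
  · rintro w ⟨-, hw⟩
    rw [mem_sphere_zero_iff_norm] at hw
    linarith

theorem ann_in (hf : GoodF f) {e : EE n} (he : ‖e‖ = 1) {x y : ℝ} (hx : 0 < x) (hxy : x < y)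
    {U : Set (EE n)} (hU : IsOpen U) (h0 : Hm (frontier U ∩ sphere 0 y) = 0) :
    wper f (U ∩ (ball 0 y \ closedBall 0 x)) ≤ (∫⁻ w in frontier U ∩ (ball 0 y \ ball 0 x), ofReal (f w) ∂Hm) +
      ofReal (f (y • e)) * (Hm (U ∩ sphere 0 x) + Hm (U ∩ sphere 0 y)) := by
  have hA : IsOpen (U ∩ (ball 0 y \ closedBall 0 x)) := hU.inter (isOpen_ball.sdiff isClosed_closedBall)
  have hy := hx.trans hxy
  refine wper_cov hf he hy.le (Z := frontier U ∩ sphere 0 y) ?_ h0 ?_ ?_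
  · intro w hw
    rw [fr_open hA] at hw
    have hc : w ∈ closure U := closure_mono inter_subset_left hw.1
    have hn : ‖w‖ ∈ Icc x y := cl_norm hw.1 isClosed_Icc (by
      rintro a ⟨-, h2⟩
      simp only [Set.mem_sdiff, mem_closedBall, mem_ball, dist_zero_right, not_le] at h2
      exact ⟨h2.2.le, h2.1.le⟩)
    have h2 := hw.2
    simp only [mem_union, Set.mem_sdiff, mem_inter_iff, mem_ball, mem_sphere_iff_norm, sub_zero, dist_zero_right, fr_open hU, mem_closedBall,
      not_lt, not_le] at h2 ⊢
    by_cases hwU : w ∈ U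
    · refine Or.inl (Or.inr ?_)
      rcases hn.1.eq_or_lt with h3 | h3
      · exact Or.inl ⟨hwU, h3.symm⟩
      · refine Or.inr ⟨hwU, hn.2.antisymm ?_⟩
        by_contra h4
        exact h2 ⟨hwU, not_le.1 h4, h3⟩
    · rcases hn.2.eq_or_lt with h3 | h3
      · exact Or.inr ⟨⟨hc, hwU⟩, h3⟩
      · exact Or.inl (Or.inl ⟨⟨hc, hwU⟩, h3, hn.1⟩)
  · rintro w ⟨-, hw⟩
    rw [mem_sphere_zero_iff_norm] at hw
    linarith
  · rintro w ⟨-, hw⟩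
    rw [mem_sphere_zero_iff_norm] at hw
    linarith

theorem ann_fill (hf : GoodF f) {e : EE n} (he : ‖e‖ = 1) {x y : ℝ} (hx : 0 < x) (hxy : x < y)
    {U : Set (EE n)} (hU : IsOpen U) :
    wper f (U ∪ (ball 0 y \ closedBall 0 x)) + (∫⁻ w in frontier U ∩ (ball 0 y \ ball 0 x), ofReal (f w) ∂Hm) ≤
      wper f U + ofReal (f (y • e)) * (Hm (sphere 0 x \ U) + Hm (sphere 0 y \ U)) := by
  have hA : IsOpen (U ∪ (ball 0 y \ closedBall 0 x)) := hU.union (isOpen_ball.sdiff isClosed_closedBall)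
  have hy := hx.trans hxy
  rw [wper_split f U x y, add_right_comm]
  refine add_le_add_left (wper_cov hf he hy.le (Z := ∅) ?_ (by simp) ?_ ?_) _
  · intro w hw
    rw [fr_open hA, closure_union] at hw
    simp only [mem_union, Set.mem_sdiff, mem_inter_iff, mem_ball, mem_sphere_iff_norm, sub_zero, dist_zero_right, fr_open hU, mem_closedBall,
      not_lt, not_le, not_or, not_and, mem_empty_iff_false, or_false] at hw ⊢
    obtain ⟨h1, h2, h3⟩ := hw
    by_cases hs : ‖w‖ = x ∨ ‖w‖ = y
    · rcases hs with h | h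
      · exact Or.inr (Or.inl ⟨h, h2⟩)
      · exact Or.inr (Or.inr ⟨h, h2⟩)
    · push Not at hs
      have h4 : ‖w‖ < y → ‖w‖ < x := fun h => lt_of_le_of_ne (h3 h) hs.1
      refine Or.inl ⟨⟨?_, h2⟩, h4⟩
      rcases h1 with h1 | h1
      · exact h1
      · exfalso
        have hn : ‖w‖ ∈ Icc x y := cl_norm h1 isClosed_Icc (by
          rintro a h2
          simp only [Set.mem_sdiff, mem_closedBall, mem_ball, dist_zero_right, not_le] at h2
          exact ⟨h2.2.le, h2.1.le⟩)
        linarith [h4 (lt_of_le_of_ne hn.2 hs.2), hn.1]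
  · rintro w ⟨hw, -⟩
    rw [mem_sphere_zero_iff_norm] at hw
    linarith
  · rintro w ⟨hw, -⟩
    rw [mem_sphere_zero_iff_norm] at hw
    linarith

theorem Prf.Ilim (h : Pf) (hmt : m ≠ ⊤)
    {x y : ℝ} (hxy : x < y) : Tendsto (fun k => ∫⁻ w in frontier (U k) ∩ (ball 0 y \ ball 0 x), ofReal (f w) ∂Hm)
      (hyperfilter ℕ) (𝓝 (ofReal (N y - N x))) := by
  refine (ENNReal.tendsto_ofReal ((h.nlim y).sub (h.nlim x))).congr fun k => ?_
  have hqn : ∀ r, ∫⁻ w in frontier (U k) ∩ ball 0 r, ofReal (f w) ∂Hm ≠ ⊤ := fun r =>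
    ne_top_of_le_ne_top (ne_top_of_le_ne_top (by
    have : ((k : EN) + 1) ≠ 0 := by simp
    finiteness) (h.per k)) (lintegral_mono_set inter_subset_left)
  rw [ENNReal.ofReal_sub _ ENNReal.toReal_nonneg, ENNReal.ofReal_toReal (hqn y), ENNReal.ofReal_toReal (hqn x)]
  refine ENNReal.sub_eq_of_eq_add (hqn x) ?_
  rw [← lintegral_inter_add_sdiff _ (frontier (U k) ∩ ball 0 y) (measurableSet_ball (x := (0 : EE n)) (ε := x)), add_comm, inter_assoc,
    inter_eq_right.2 (ball_subset_ball hxy.le), inter_sdiff_assoc]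

theorem cap_small (hn : 1 ≤ n) {q : EE n} (X : ℝ) {η : EN} (hη : η ≠ 0) :
    ∃ δ > 0, ∀ x ∈ Ioc 0 X, ∀ T : Set (EE n), T ⊆ sphere 0 x → (∀ w ∈ T, dist (x⁻¹ • w) q < δ) → Hm T ≤ η := by
  obtain ⟨C, hC⟩ := sphere_haus n
  have hfin : Hm (sphere (0 : EE n) 1) ≠ ⊤ := ne_top_of_le_ne_top (by finiteness) (hC 0 1 zero_le_one)
  have : IsFiniteMeasure ((Hm : Measure (EE n)).restrict (sphere 0 1)) := ⟨by simpa using hfin.lt_top⟩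
  have hna : NullSingletonClass (Hm : Measure (EE n)) := Measure.nullSingletonClass_hausdorff _ (by exact_mod_cast hn)
  set K : ℝ≥0 := Real.toNNReal X
  obtain ⟨η', h0, h1⟩ : ∃ η' : EN, η' ≠ 0 ∧ (K : EN) ^ n * η' ≤ η := by
    refine ⟨η / (K ^ n + 1), ?_, ?_⟩
    · exact (ENNReal.div_pos hη (by finiteness)).ne'
    · rw [← mul_div_assoc]
      refine ENNReal.div_le_of_le_mul ?_
      rw [mul_comm]
      exact mul_le_mul' le_rfl le_self_add
  obtain ⟨u, hu1, hu2, hu3⟩ := Set.exists_isOpen_lt_of_lt {q} (μ := (Hm : Measure (EE n)).restrict (sphere 0 1)) η'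
    (by rw [measure_singleton]; exact pos_iff_ne_zero.2 h0)
  obtain ⟨δ, hδ, hb⟩ := Metric.isOpen_iff.1 hu2 q (hu1 rfl)
  refine ⟨δ, hδ, fun x hx T hT hd => ?_⟩
  rw [Measure.restrict_apply hu2.measurableSet] at hu3
  refine le_trans (haus_rel (A := u ∩ sphere 0 1) (fun a b => b = x • a) K ?_ ?_) ((mul_le_mul' le_rfl hu3.le).trans h1)
  · intro b hb'
    refine ⟨x⁻¹ • b, ⟨hb (hd b hb'), ?_⟩, by rw [smul_smul, mul_inv_cancel₀ hx.1.ne', one_smul]⟩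
    have := mem_sphere_zero_iff_norm.1 (hT hb')
    rw [mem_sphere_zero_iff_norm, norm_smul, this, norm_inv, Real.norm_of_nonneg hx.1.le, inv_mul_cancel₀ hx.1.ne']
  · rintro a b a' b' rfl rfl
    rw [dist_smul₀, Real.norm_of_nonneg hx.1.le]
    exact mul_le_mul_of_nonneg_right (hx.2.trans (Real.le_coe_toNNReal X)) dist_nonneg

theorem Prf.capE (hn : 1 ≤ n) (h : Pf) (X : ℝ)
    {η : EN} (hη : η ≠ 0) : ∃ δ > 0, ∀ x ∈ Ioc 0 X, (α x < δ → Hm (E ∩ sphere 0 x) ≤ η) ∧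
      (π - δ < α x → Hm (sphere 0 x \ E) ≤ η) := by
  have he := h.he
  obtain ⟨δ, hδ, hd⟩ := cap_small hn (q := e) X hη
  obtain ⟨δ', hδ', hd'⟩ := cap_small hn (q := -e) X hη
  have hsc : ∀ x : ℝ, 0 < x → ∀ w : EE n, w ∈ sphere 0 x → ∃ θ ∈ Icc 0 π, ∃ ω, Om e ω ∧ w = W e x θ ω ∧ 
      dist (x⁻¹ • w) e ≤ θ ∧ dist (x⁻¹ • w) (-e) ≤ π - θ := by
    intro x hx w hw
    obtain ⟨θ, hθ, ω, hω, hw'⟩ := exists_W hn he w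
    rw [mem_sphere_zero_iff_norm.1 hw] at hw'
    have hW : x⁻¹ • w = W e 1 θ ω := by
      rw [hw', W_scale e ω hx.ne' 1 θ, one_div]
    refine ⟨θ, hθ, ω, hω, hw', ?_, ?_⟩
    · rw [hW]
      refine (abs_le_of_sq_le_sq' ?_ hθ.1).2
      rw [dist_eq_norm, norm_sub_sq_real, W_norm he hω zero_le_one, W_inner he hω, he]
      have := Real.one_sub_sq_div_two_le_cos (x := θ)
      linarith
    · rw [hW]
      refine (abs_le_of_sq_le_sq' ?_ (sub_nonneg.2 hθ.2)).2
      rw [dist_eq_norm, norm_sub_sq_real, W_norm he hω zero_le_one, inner_neg_right, W_inner he hω, norm_neg, he]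
      have := Real.one_sub_sq_div_two_le_cos (x := π - θ)
      rw [Real.cos_pi_sub] at this
      linarith
  refine ⟨min δ δ', lt_min hδ hδ', fun x hx => ⟨fun ha => hd x hx _ inter_subset_right ?_, fun ha => hd' x hx _ sdiff_subset ?_⟩⟩
  · rintro w ⟨hw1, hw2⟩
    obtain ⟨θ, hθ, ω, hω, hw', h1, -⟩ := hsc x hx.1 w hw2
    refine h1.trans_lt (lt_of_le_of_lt ?_ (ha.trans_le (min_le_left _ _)))
    by_contra h2
    exact h.out x θ ω hx.1 hθ.2 hω (not_le.1 h2) (hw' ▸ hw1)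
  · rintro w ⟨hw2, hw1⟩
    obtain ⟨θ, hθ, ω, hω, hw', -, h1⟩ := hsc x hx.1 w hw2
    have : α x ≤ θ := by
      by_contra h2
      exact hw1 (hw' ▸ h.ins x θ ω hx.1 hθ.1 hω (not_le.1 h2))
    have := min_le_right δ δ'
    refine h1.trans_lt ?_
    linarith

theorem W_ax (e ω : EE n) (p : ℝ) : W e p 0 ω = p • e ∧ W e p π ω = -(p • e) := by
  simp [W]

theorem Prf.ax0 (hn : 1 ≤ n) (hf : GoodF f) (h : Pf) (hmt : m ≠ ⊤)
    {p : ℝ} (hp : 0 < p) (hc : ContinuousAt N p) :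
    (p • e ∈ Sb E → Tendsto α (𝓝 p ⊓ 𝓟 Gd) (𝓝 0)) ∧ (-(p • e) ∈ Sb E → Tendsto α (𝓝 p ⊓ 𝓟 Gd) (𝓝 π)) := by
  obtain ⟨a, ha⟩ := h.alim hn hf hmt hp le_rfl hc
  have := h.gN hp
  have ha0 : 0 ≤ a := ge_of_tendsto' ha fun r => (h.rng r).1
  have ha1 : a ≤ π := le_of_tendsto' ha fun r => (h.rng r).2
  obtain ⟨ω, hω⟩ := exists_Om hn e
  have hle : 𝓝[≠] p ⊓ 𝓟 Gd ≤ 𝓝 p ⊓ 𝓟 Gd := inf_le_inf_right _ nhdsWithin_le_nhds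
  constructor
  · intro hS
    rcases ha0.eq_or_lt with h0 | h0
    · rwa [h0]
    · exact absurd hS ((W_ax e ω p).1 ▸ h.S_gt hn hp hω le_rfl (b := a / 2) (by linarith) (by linarith)
        (hle (ha.eventually (lt_mem_nhds (by linarith)))))
  · intro hS
    rcases ha1.eq_or_lt with h0 | h0
    · rwa [← h0]
    · exact absurd hS ((W_ax e ω p).2 ▸ h.S_lt hn hp hω le_rfl (b := (a + π) / 2) (by linarith) (by linarith)
        (hle (ha.eventually (gt_mem_nhds (by linarith)))))

theorem axis_null (hn : 1 ≤ n) {e : EE n} (he : ‖e‖ = 1) : volume {w : EE n | ∃ c : ℝ, w = c • e} = 0 := by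
  have h1 : (Submodule.span ℝ {e}) ≠ ⊤ := by
    intro h
    obtain ⟨ω, h1, h2⟩ := exists_Om hn e
    have : ω ∈ Submodule.span ℝ {e} := by rw [h]; trivial
    obtain ⟨c, rfl⟩ := Submodule.mem_span_singleton.1 this
    rw [inner_smul_right, real_inner_self_eq_norm_sq, he] at h2
    have : c = 0 := by simpa using h2
    simp [this] at h1
  refine measure_mono_null ?_ (Measure.addHaar_submodule volume _ h1)
  rintro w ⟨c, rfl⟩
  exact Submodule.smul_mem _ _ (Submodule.mem_span_singleton_self e)

theorem Prf.zlem (hn : 1 ≤ n) (h : Pf)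
    {a p b : ℝ} (ha : 0 ≤ a) (hap : a < p) (hpb : p < b) :
    (p • e ∈ Sb E → ∃ z ∈ Gd, z ∈ Ioo a b ∧ 0 < α z) ∧ (-(p • e) ∈ Sb E → ∃ z ∈ Gd, z ∈ Ioo a b ∧ α z < π) := by
  have he := h.he
  have hr : 0 < min (p - a) (b - p) := lt_min (by linarith) (by linarith)
  have hnull : volume ({w : EE n | 0 < ‖w‖ ∧ (‖w‖ = 0 ∨ ‖w‖ ∉ Gd)} ∪ {w : EE n | ∃ c : ℝ, w = c • e}) = 0 :=
    measure_union_null (h.bad_null 0) (axis_null hn he)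
  have hb : ∀ q w : EE n, ‖q‖ = p → w ∈ ball q (min (p - a) (b - p)) → ‖w‖ ∈ Ioo a b := by
    intro q w hq hw
    rw [mem_ball, dist_eq_norm] at hw
    have h1 := (abs_norm_sub_norm_le w q).trans_lt hw
    rw [hq, abs_lt] at h1
    have := min_le_left (p - a) (b - p)
    have := min_le_right (p - a) (b - p)
    exact ⟨by linarith, by linarith⟩
  have hpn : ‖p • e‖ = p := by rw [norm_smul, he, mul_one, Real.norm_of_nonneg (ha.trans hap.le)]
  constructor
  · intro hS
    by_contra hcon
    push Not at hcon
    refine (hS _ hr).1.ne' (measure_mono_null ?_ hnull)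
    rintro w ⟨hw1, hw2⟩
    have h1 := hb _ w hpn hw1
    by_cases hg : ‖w‖ ∈ Gd
    · obtain ⟨θ, hθ, ω, hω, hw⟩ := exists_W hn he w
      have h3 : θ ≤ 0 := by
        by_contra h3
        exact h.out ‖w‖ θ ω (ha.trans_lt h1.1) hθ.2 hω ((hcon _ hg h1).trans_lt (not_le.1 h3)) (hw ▸ hw2)
      refine Or.inr ⟨‖w‖, ?_⟩
      rw [← (W_ax e ω ‖w‖).1, ← h3.antisymm hθ.1]
      exact hw
    · exact Or.inl ⟨ha.trans_lt h1.1, Or.inr hg⟩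
  · intro hS
    by_contra hcon
    push Not at hcon
    refine (hS _ hr).2.ne' (measure_mono_null ?_ hnull)
    rintro w ⟨hw1, hw2⟩
    have h1 := hb _ w (by rw [norm_neg, hpn]) hw1
    by_cases hg : ‖w‖ ∈ Gd
    · obtain ⟨θ, hθ, ω, hω, hw⟩ := exists_W hn he w
      have h3 : π ≤ θ := by
        by_contra h3
        exact hw2 (hw ▸ h.ins ‖w‖ θ ω (ha.trans_lt h1.1) hθ.1 hω ((not_le.1 h3).trans_le (hcon _ hg h1)))
      refine Or.inr ⟨-‖w‖, ?_⟩
      rw [neg_smul, ← (W_ax e ω ‖w‖).2, ← hθ.2.antisymm h3]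
      exact hw
    · exact Or.inl ⟨ha.trans_lt h1.1, Or.inr hg⟩

theorem Prf.gap (hn : 1 ≤ n) (hf : GoodF f) (h : Pf) (hmt : m ≠ ⊤)
    {x y : ℝ} (hx : x ∈ Gd) (hy : y ∈ Gd) (hxy : x < y) (hα : α x ≠ α y) : N x < N y := by
  have hx0 := h.gpos x hx
  have h1 : 0 ≤ min (α x) (α y) := le_min (h.rng x).1 (h.rng y).1
  have h2 : max (α x) (α y) ≤ π := max_le (h.rng x).2 (h.rng y).2
  have h3 := h.RL hf hmt hx hy hxy (c := ofReal (f (x • e))) (by finiteness)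
    (fun w hw => ENNReal.ofReal_le_ofReal (hf.f_le h.he hx0.le hw)) h1 h2 (by
      rcases le_total (α x) (α y) with h4 | h4
      · left; simp [h4]
      · right; simp [h4])
  have h5 : 0 < Hm (Bd e x (min (α x) (α y)) (max (α x) (α y))) :=
    posi_band hn h.he hx0 h1 (min_lt_max.2 hα) h2
  have h6 := (ENNReal.mul_pos (by simpa using hf.pos _) h5.ne').trans_le h3
  have := ENNReal.ofReal_pos.1 h6
  linarith

theorem Prf.sel (hn : 1 ≤ n) (hf : GoodF f) (h : Pf) (hmt : m ≠ ⊤)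
    {p1 z p2 a : ℝ} (hp : 0 < p1) (h1 : p1 < z) (h2 : z < p2) (hz : z ∈ Gd) (hza : α z ≠ a)
    (t1 : Tendsto α (𝓝 p1 ⊓ 𝓟 Gd) (𝓝 a)) (t2 : Tendsto α (𝓝 p2 ⊓ 𝓟 Gd) (𝓝 a)) :
    ∃ g > 0, ∀ δ > 0, ∃ x ∈ Gd, ∃ y ∈ Gd, p1 < x ∧ x < y ∧ y < p2 ∧ dist (α x) a < δ ∧ dist (α y) a < δ ∧ g ≤ N y - N x := by
  have hR := h.gR hp
  have hL := h.gL (hp.trans (h1.trans h2))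
  have t1' := t1.mono_left (inf_le_inf_right (𝓟 Gd) (nhdsWithin_le_nhds (s := Ioi p1)))
  have t2' := t2.mono_left (inf_le_inf_right (𝓟 Gd) (nhdsWithin_le_nhds (s := Iio p2)))
  have e1 : ∀ b, p1 < b → ∀ᶠ x in 𝓝[>] p1 ⊓ 𝓟 Gd, x ∈ Gd ∧ x ∈ Ioo p1 b := fun b hb => by
    rw [eventually_inf_principal]
    filter_upwards [Ioo_mem_nhdsGT hb] with x hx hg using ⟨hg, hx⟩
  obtain ⟨x0, ⟨hx0, hx1⟩, hx2⟩ := ((e1 z h1).and (t1'.eventually_ne hza.symm)).exists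
  refine ⟨N z - N x0, sub_pos.2 (h.gap hn hf hmt hx0 hz hx1.2 hx2), fun δ hδ => ?_⟩
  obtain ⟨x, ⟨hx, hx3⟩, hx4⟩ := ((e1 x0 hx1.1).and (t1'.eventually (ball_mem_nhds a hδ))).exists
  have e2 : ∀ᶠ x in 𝓝[<] p2 ⊓ 𝓟 Gd, x ∈ Gd ∧ x ∈ Ioo z p2 := by
    rw [eventually_inf_principal]
    filter_upwards [Ioo_mem_nhdsLT h2] with x hx hg using ⟨hg, hx⟩
  obtain ⟨y, ⟨hy, hy3⟩, hy4⟩ := (e2.and (t2'.eventually (ball_mem_nhds a hδ))).exists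
  refine ⟨x, hx, y, hy, hx3.1, by linarith [hx3.2, hx1.2, hy3.1], hy3.2, hx4, hy4, ?_⟩
  linarith [h.mono hy3.1.le, h.mono hx3.2.le]

theorem Prf.nopi (hn : 1 ≤ n) (hf : GoodF f) (h : Pf) (hmt : m ≠ ⊤)
    (hV0 : 0 < V) (hV : V ≠ ⊤) (hmin : ∀ A : Set (EE n), IsOpen A → wvol f A = V → m ≤ wper f A) {p1 p p2 : ℝ}
    (hp : 0 < p1) (h1 : p1 < p) (h2 : p < p2) (hc1 : ContinuousAt N p1) (hc2 : ContinuousAt N p2)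
    (hS1 : -(p1 • e) ∈ Sb E) (hS : -(p • e) ∈ Sb E) (hS2 : -(p2 • e) ∈ Sb E) : False := by
  have hp2 : 0 < p2 := by linarith
  obtain ⟨z, hz, hz1, hz2⟩ := (h.zlem hn hp.le h1 h2).2 hS
  obtain ⟨g, hg, hsel⟩ := h.sel hn hf hmt hp hz1.1 hz1.2 hz hz2.ne ((h.ax0 hn hf hmt hp hc1).2 hS1)
    ((h.ax0 hn hf hmt hp2 hc2).2 hS2)
  set c := ofReal (f (p2 • e)) with hcd
  have hc0 : c ≠ 0 := by simpa [hcd] using hf.pos _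
  have hct : c ≠ ⊤ := by finiteness
  obtain ⟨δ, hδ, hcap⟩ := h.capE hn p2 (η := ofReal (g / 4) / c)
    (ENNReal.div_pos (by simpa using hg) hct).ne'
  obtain ⟨x, hx, y, hy, k1, k2, k3, k4, k5, k6⟩ := hsel δ hδ
  rw [Real.dist_eq, abs_lt] at k4 k5
  have hx0 := h.gpos x hx
  have c1 := (hcap x ⟨hx0, by linarith⟩).2 (by linarith)
  have c2 := (hcap y ⟨by linarith, by linarith⟩).2 (by linarith)
  have key : ∀ k, m + (∫⁻ w in frontier (U k) ∩ (ball 0 y \ ball 0 x), ofReal (f w) ∂Hm) ≤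
      m + ((k : EN) + 1)⁻¹ + c * ((Hm (symmDiff (U k) E ∩ sphere 0 x) + ofReal (g / 4) / c) +
        (Hm (symmDiff (U k) E ∩ sphere 0 y) + ofReal (g / 4) / c)) := by
    intro k
    have hA : IsOpen (U k ∪ (ball 0 y \ closedBall 0 x)) := (h.op k).union (isOpen_ball.sdiff isClosed_closedBall)
    have hAv : wvol f (U k ∪ (ball 0 y \ closedBall 0 x)) ≠ ⊤ := by
      refine ne_top_of_le_ne_top ?_ (wvol_union_le _ _ _)
      rw [h.vol k]
      exact ENNReal.add_ne_top.2 ⟨hV, ne_top_of_le_ne_top (wvol_ball_ne_top hf 0 y) (wvol_mono sdiff_subset)⟩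
    obtain ⟨A', a1, a2, a3⟩ := shrink_vol hf hA hAv hV0 (by rw [← h.vol k]; exact wvol_mono subset_union_left)
    refine (add_le_add_left ((hmin A' a1 a2).trans a3) _).trans ((ann_fill hf h.he hx0 k2 (h.op k)).trans ?_)
    refine add_le_add (h.per k) (mul_le_mul' (ENNReal.ofReal_le_ofReal ?_) ?_)
    · refine hf.mono _ _ ?_
      rw [norm_smul, norm_smul, h.he, mul_one, mul_one, Real.norm_of_nonneg (by linarith), Real.norm_of_nonneg hp2.le]
      exact k3.le
    · have hs : ∀ r : ℝ, Hm (sphere (0 : EE n) r \ U k) ≤ Hm (symmDiff (U k) E ∩ sphere 0 r) + Hm (sphere 0 r \ E) := by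
        intro r
        refine (measure_mono ?_).trans (measure_union_le _ _)
        rintro w ⟨w1, w2⟩
        by_cases w3 : w ∈ E
        · exact Or.inl ⟨Or.inr ⟨w3, w2⟩, w1⟩
        · exact Or.inr ⟨w1, w3⟩
      exact add_le_add ((hs x).trans (add_le_add_right c1 _)) ((hs y).trans (add_le_add_right c2 _))
  have hhy : ((hyperfilter ℕ : Ultrafilter ℕ) : Filter ℕ) ≤ atTop := by
    rw [← Nat.cofinite_eq_atTop]; exact hyperfilter_le_cofinite
  have hk1 : Tendsto (fun k : ℕ => ((k : EN) + 1)⁻¹) atTop (𝓝 0) :=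
    (ENNReal.tendsto_inv_nat_nhds_zero.comp (tendsto_add_atTop_nat 1)).congr fun k => by simp
  have L1 := (tendsto_const_nhds (x := m)).add (h.Ilim hmt k2)
  have L2 : Tendsto (fun k : ℕ => m + ((k : EN) + 1)⁻¹ + c * ((Hm (symmDiff (U k) E ∩ sphere 0 x) + ofReal (g / 4) / c) +
        (Hm (symmDiff (U k) E ∩ sphere 0 y) + ofReal (g / 4) / c))) (hyperfilter ℕ)
      (𝓝 (m + 0 + c * ((0 + ofReal (g / 4) / c) + (0 + ofReal (g / 4) / c)))) :=
    Tendsto.mono_left ((tendsto_const_nhds.add hk1).add (ENNReal.Tendsto.const_mul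
      (((h.gsl x hx).add_const _).add ((h.gsl y hy).add_const _)) (Or.inr hct))) hhy
  have hfin := le_of_tendsto_of_tendsto' L1 L2 key
  rw [add_zero, zero_add, ← two_mul, mul_left_comm, ENNReal.mul_div_cancel hc0 hct] at hfin
  have h7 := (ENNReal.add_le_add_iff_left hmt).1 hfin
  rw [show (2 : EN) = ofReal 2 by simp, ← ENNReal.ofReal_mul (by norm_num), ENNReal.ofReal_le_ofReal_iff (by linarith)] at h7
  linarith

theorem exists_rot (hn : 1 ≤ n) {e : EE n} (he : ‖e‖ = 1) : ∃ R : unitInterval → (EE n ≃ₗᵢ[ℝ] EE n),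
    (Continuous fun p : unitInterval × EE n => R p.1 p.2) ∧ (∀ x, R 0 x = x) ∧ R 1 e = -e := by
  obtain ⟨ω, hω1, hω2⟩ := exists_Om hn e
  have hform : ∀ v x : EE n, sg v x = x - (2 * (inner ℝ v x / ‖v‖ ^ 2)) • v := fun v x => by
    unfold sg
    rw [Submodule.reflection_orthogonal_apply, Submodule.reflection_singleton_apply (𝕜 := ℝ) v x]
    simp only [two_smul, mul_smul]; norm_num
  set v : unitInterval → EE n := fun s => (1 - (s : ℝ)) • ω + (s : ℝ) • e with hv
  have hvc : Continuous v := by fun_prop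
  have hv0 : ∀ s, ‖v s‖ ^ 2 ≠ 0 := fun s h0 => by
    have h1 : v s = 0 := by simpa using h0
    have h2 : inner ℝ e (v s) = (s : ℝ) := by
      simp [hv, inner_add_right, inner_smul_right, hω2, he]
    have h3 : inner ℝ ω (v s) = 1 - (s : ℝ) := by
      simp [hv, inner_add_right, inner_smul_right, real_inner_comm e ω, hω2, hω1]
    rw [h1, inner_zero_right] at h2 h3
    linarith
  refine ⟨fun s => (sg ω).trans (sg (v s)), ?_, fun x => ?_, ?_⟩
  · have : (fun p : unitInterval × EE n => ((sg ω).trans (sg (v p.1))) p.2) =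
        fun p : unitInterval × EE n => sg ω p.2 - (2 * (inner ℝ (v p.1) (sg ω p.2) / ‖v p.1‖ ^ 2)) • v p.1 :=
      funext fun p => by rw [LinearIsometryEquiv.trans_apply, hform (v p.1)]
    rw [this]
    have h1 : Continuous fun p : unitInterval × EE n => sg ω p.2 := (sg ω).continuous.comp continuous_snd
    have h2 : Continuous fun p : unitInterval × EE n => v p.1 := hvc.comp continuous_fst
    exact h1.sub ((continuous_const.mul ((h2.inner h1).div (h2.norm.pow 2) fun p => hv0 _)).smul h2)
  · have : v 0 = ω := by simp [hv]
    simp only [LinearIsometryEquiv.trans_apply, this, sg_sg]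
  · have h1 : v 1 = e := by simp [hv]
    have h2 : sg ω e = e := sg_fix (by rw [real_inner_comm, hω2])
    simp only [LinearIsometryEquiv.trans_apply, h1, h2]
    exact Submodule.reflection_orthogonalComplement_singleton_eq_neg e

theorem Prf.rot_pos (hn : 1 ≤ n) (hf : GoodF f) (h : Pf)
    {R : EE n ≃ₗᵢ[ℝ] EE n} (hR : R e = -e) {z : ℝ} (hz : 0 < z) (h1 : 0 < α z) (h2 : α z < π) :
    0 < wvol f (R ⁻¹' E \ E) := by
  rw [pos_iff_ne_zero]
  intro h0
  have hv := vol_le_wvol hf (R ⁻¹' E \ E)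
  rw [h0, nonpos_iff_eq_zero, mul_eq_zero] at hv
  have hv := hv.resolve_left (by simpa using hf.pos 0)
  obtain ⟨ω, hω⟩ := exists_Om hn e
  have hy := h.ins z 0 ω hz le_rfl hω h1
  have hx := h.out z π ω hz le_rfl hω h2
  rw [(W_ax e ω z).1] at hy
  rw [(W_ax e ω z).2] at hx
  have hRx : R (-(z • e)) = z • e := by rw [map_neg, map_smul, hR, smul_neg, neg_neg]
  refine hx ?_
  rw [← h.dp] at hy ⊢
  intro ε hε
  filter_upwards [hy ε hε] with r hr
  have hsub : closedBall (-(z • e)) r \ E ⊆ (R ⁻¹' E \ E) ∪ R ⁻¹' (closedBall (z • e) r \ E) := by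
    rintro w ⟨hz1, hz2⟩
    by_cases h : R w ∈ E
    · exact Or.inl ⟨h, hz2⟩
    · refine Or.inr ⟨?_, h⟩
      rw [mem_closedBall] at hz1 ⊢
      rw [← hRx, R.isometry.dist_eq]; exact hz1
  calc volume (closedBall (-(z • e)) r \ E) ≤ volume (R ⁻¹' E \ E) + volume (R ⁻¹' (closedBall (z • e) r \ E)) :=
        (measure_mono hsub).trans (measure_union_le _ _)
    _ = volume (closedBall (z • e) r \ E) := by
        rw [hv, zero_add]
        exact R.measurePreserving.measure_preimage_equiv (f := R.toHomeomorph.toMeasurableEquiv) _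
    _ ≤ ε * volume (closedBall (-(z • e)) r) := by
        rw [Measure.addHaar_closedBall_center volume (-(z • e)), ← Measure.addHaar_closedBall_center volume (z • e)]; exact hr

theorem num0 {a m f0 C : ℝ} (ha : 0 < a) (hm : 0 ≤ m) (hf : 0 < f0) (hC : 0 ≤ C) :
    ∃ g1 > 0, ∀ g v : ℝ, 0 < g → g < g1 → 0 ≤ v → f0 * v ^ n ≤ (C * (2 * g)) ^ (n + 1) →
      v ≤ a / 4 ∧ ¬ (g / 2 * (a / 2) ≤ 2 * m * v) := by
  set κ := a / (8 * (m + 1)) with hκ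
  have hκ0 : 0 < κ := by positivity
  set b := min (a / 4) κ with hb
  have hb0 : 0 < b := lt_min (by linarith) hκ0
  set K := (2 * C) ^ (n + 1) with hK
  have hK0 : 0 ≤ K := by positivity
  refine ⟨min 1 (f0 * b ^ n / (K + 1)), lt_min one_pos (by positivity), fun g v hg hg1 hv hle => ?_⟩
  obtain ⟨g2, g3⟩ := lt_min_iff.1 hg1
  rw [lt_div_iff₀ (by positivity)] at g3
  have e1 : (C * (2 * g)) ^ (n + 1) = K * g * g ^ n := by rw [hK, ← mul_assoc, mul_comm C 2, mul_pow, pow_succ g n]; ring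
  have h3 : v < b * g := by
    by_contra hcon
    push Not at hcon
    have h4 : f0 * (b * g) ^ n ≤ f0 * v ^ n := by gcongr
    rw [mul_pow] at h4
    have h5 : f0 * b ^ n * g ^ n ≤ K * g * g ^ n := by rw [e1] at hle; linarith
    have h6 := le_of_mul_le_mul_right h5 (by positivity)
    linarith [mul_comm g (K + 1)]
  have h4 : v < b := by nlinarith
  refine ⟨(h4.trans_le (min_le_left _ _)).le, fun hcon => ?_⟩
  have h5 : v < κ * g := h3.trans_le (by gcongr; exact min_le_right _ _)
  have h6 : κ * (8 * (m + 1)) = a := by rw [hκ]; field_simp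
  nlinarith [mul_pos hκ0 hg, mul_nonneg hm hv, mul_nonneg hm (sub_nonneg.2 h5.le)]

theorem Prf.volE (h : Pf) (hV : V ≠ ⊤) : wvol f E ≠ ⊤ := by
  have h1 : E ⊆ U 0 ∪ symmDiff (U 0) E := fun w hw => by
    by_cases h2 : w ∈ U 0
    · exact Or.inl h2
    · exact Or.inr (Or.inr ⟨hw, h2⟩)
  refine ne_top_of_le_ne_top ?_ ((wvol_mono h1).trans (wvol_union_le f _ _))
  rw [h.vol 0]
  exact ENNReal.add_ne_top.2 ⟨hV, ne_top_of_le_ne_top (by finiteness) (h.dif 0)⟩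

theorem wvol_sphere (f : EE n → ℝ) (r : ℝ) (hr : r ≠ 0) : wvol f (sphere 0 r) = 0 :=
  setLIntegral_measure_zero _ _ (Measure.addHaar_sphere_of_ne_zero volume 0 hr)

theorem Prf.no0 (hn : 1 ≤ n) (hf : GoodF f) (h : Pf) (hmt : m ≠ ⊤)
    (hV : V ≠ ⊤) (hmin : ∀ A : Set (EE n), IsOpen A → wvol f A = V → m ≤ wper f A) {p : ℝ}
    (hp : 0 < p) (hc : ContinuousAt N p) (hS : p • e ∈ Sb E)
    (hl : ∀ d < p, ∃ q ∈ Ioo d p, ContinuousAt N q ∧ q • e ∈ Sb E)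
    (hr : ∀ d > p, ∃ q ∈ Ioo p d, ContinuousAt N q ∧ q • e ∈ Sb E) : False := by
  obtain ⟨R, hR, hR0, hR1⟩ := exists_rot hn h.he
  set a0 := wvol f (R 1 ⁻¹' E \ E) with ha0
  have ha : a0 ≠ 0 := by
    have h1 := ((h.ax0 hn hf hmt hp hc).1 hS).eventually (gt_mem_nhds Real.pi_pos)
    rw [eventually_inf_principal] at h1
    obtain ⟨d, hd, hd1⟩ := Metric.eventually_nhds_iff.1 h1
    obtain ⟨z, hz, hz1, hz2⟩ := (h.zlem hn (a := max 0 (p - d)) (b := p + d) (le_max_left _ _)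
      (max_lt hp (by linarith)) (by linarith)).1 hS
    have h2 := max_lt_iff.1 hz1.1
    exact (h.rot_pos hn hf hR1 (h.gpos z hz) hz2 (hd1 (by
      rw [Real.dist_eq, abs_lt]; constructor <;> linarith [hz1.2]) hz)).ne'
  have hat : a0 ≠ ⊤ := ne_top_of_le_ne_top (h.volE hV) ((wvol_mono sdiff_subset).trans (wvol_iso hf _ _).le)
  obtain ⟨C, hC, hiso⟩ := isopW hn
  set a := a0.toReal with had
  have hap : 0 < a := ENNReal.toReal_pos ha hat
  have haa : a0 = ofReal a := (ENNReal.ofReal_toReal hat).symm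
  obtain ⟨g1, hg1, hnum⟩ := num0 (n := n) hap (ENNReal.toReal_nonneg (a := m)) (hf.pos 0) C.coe_nonneg
  obtain ⟨d, hd, hd1⟩ := Metric.continuousAt_iff.1 hc (g1 / 2) (by linarith)
  obtain ⟨p1, hp1, hc1, hS1⟩ := hl (max 0 (p - d)) (max_lt hp (by linarith))
  obtain ⟨p2, hp2, hc2, hS2⟩ := hr (p + d) (by linarith)
  obtain ⟨hp10, hp11⟩ := max_lt_iff.1 hp1.1
  have hp20 : 0 < p2 := hp.trans hp2.1
  obtain ⟨z, hz, hz1, hz2⟩ := (h.zlem hn hp10.le hp1.2 hp2.1).1 hS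
  obtain ⟨g, hg, hsel⟩ := h.sel hn hf hmt hp10 hz1.1 hz1.2 hz hz2.ne' ((h.ax0 hn hf hmt hp10 hc1).1 hS1)
    ((h.ax0 hn hf hmt hp20 hc2).1 hS2)
  set c := ofReal (f (p2 • e)) with hcd
  have hc0 : c ≠ 0 := by simpa [hcd] using hf.pos _
  have hct : c ≠ ⊤ := by finiteness
  set η := ofReal (g / 16) / c with hη
  obtain ⟨δ, hδ, hcap⟩ := h.capE hn p2 (η := η) (ENNReal.div_pos (by simpa using hg) hct).ne'
  obtain ⟨x, hx, y, hy, k1, k2, k3, k4, k5, k6⟩ := hsel δ hδ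
  rw [Real.dist_eq, abs_lt] at k4 k5
  have hx0 := h.gpos x hx
  have hy0 := h.gpos y hy
  have c1 := (hcap x ⟨hx0, by linarith⟩).1 (by linarith)
  have c2 := (hcap y ⟨by linarith, by linarith⟩).1 (by linarith)
  have hhy : ((hyperfilter ℕ : Ultrafilter ℕ) : Filter ℕ) ≤ atTop := by
    rw [← Nat.cofinite_eq_atTop]; exact hyperfilter_le_cofinite
  have hk1 : Tendsto (fun k : ℕ => ((k : EN) + 1)⁻¹) atTop (𝓝 0) :=
    (ENNReal.tendsto_inv_nat_nhds_zero.comp (tendsto_add_atTop_nat 1)).congr fun k => by simp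
  set g0 := N y - N x with hg0
  have hg0p : 0 < g0 := by linarith
  have hg01 : g0 < g1 := by
    have h1 := hd1 (x := y) (by rw [Real.dist_eq, abs_lt]; constructor <;> linarith [hp2.2, hp1.2, hp2.1])
    have h2 := hd1 (x := x) (by rw [Real.dist_eq, abs_lt]; constructor <;> linarith [hp2.2, hp1.2, hp2.1])
    rw [Real.dist_eq, abs_lt] at h1 h2
    linarith [h1.2, h2.1]
  have L2 : Tendsto (fun k : ℕ => ((k : EN) + 1)⁻¹ + c * ((Hm (symmDiff (U k) E ∩ sphere 0 x) + η) +
        (Hm (symmDiff (U k) E ∩ sphere 0 y) + η))) atTop (𝓝 (0 + c * ((0 + η) + (0 + η)))) :=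
    hk1.add (ENNReal.Tendsto.const_mul (((h.gsl x hx).add_const _).add ((h.gsl y hy).add_const _)) (Or.inr hct))
  have hlim : 0 + c * ((0 + η) + (0 + η)) < ofReal (g0 / 4) := by
    rw [zero_add, zero_add, ← two_mul, mul_left_comm, hη, ENNReal.mul_div_cancel hc0 hct,
      show (2 : EN) = ofReal 2 by simp, ← ENNReal.ofReal_mul (by norm_num), ENNReal.ofReal_lt_ofReal_iff (by linarith)]
    linarith
  have L3 : Tendsto (fun k : ℕ => (2 : EN) * 2⁻¹ ^ k) atTop (𝓝 (2 * 0)) :=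
    ENNReal.Tendsto.const_mul (ENNReal.tendsto_pow_atTop_nhds_zero_of_lt_one (by simp)) (Or.inr (by simp))
  rw [mul_zero] at L3
  have L1 := h.Ilim hmt k2
  have E1 := L1.eventually_const_lt (u := ofReal (3 / 4 * g0)) (by
    rw [ENNReal.ofReal_lt_ofReal_iff hg0p]; linarith)
  have E2 := L1.eventually_lt_const (u := ofReal (3 / 2 * g0)) (by
    rw [ENNReal.ofReal_lt_ofReal_iff (by linarith)]; linarith)
  have E3 := (L2.eventually_lt_const hlim).filter_mono hhy
  have E4 := (L3.eventually_lt_const (u := ofReal (a / 8)) (by simpa using hap)).filter_mono hhy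
  obtain ⟨k, ⟨⟨e1, e2⟩, e3⟩, e4⟩ := (((E1.and E2).and E3).and E4).exists
  have e5 := (h.dif k).trans e4.le
  set I := ∫⁻ w in frontier (U k) ∩ (ball 0 y \ ball 0 x), ofReal (f w) ∂Hm with hI
  have herr : ofReal (f (y • e)) * (Hm (U k ∩ sphere 0 x) + Hm (U k ∩ sphere 0 y)) ≤
      c * ((Hm (symmDiff (U k) E ∩ sphere 0 x) + η) + (Hm (symmDiff (U k) E ∩ sphere 0 y) + η)) := by
    refine mul_le_mul' (ENNReal.ofReal_le_ofReal ?_) ?_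
    · refine hf.mono _ _ ?_
      rw [norm_smul, norm_smul, h.he, mul_one, mul_one, Real.norm_of_nonneg hy0.le, Real.norm_of_nonneg hp20.le]
      exact k3.le
    · have hs : ∀ r : ℝ, Hm (U k ∩ sphere 0 r) ≤ Hm (symmDiff (U k) E ∩ sphere 0 r) + Hm (E ∩ sphere 0 r) := by
        intro r
        refine (measure_mono ?_).trans (measure_union_le _ _)
        rintro w ⟨w1, w2⟩
        by_cases w3 : w ∈ E
        · exact Or.inr ⟨w3, w2⟩
        · exact Or.inl ⟨Or.inl ⟨w1, w3⟩, w2⟩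
      exact add_le_add ((hs x).trans (add_le_add_right c1 _)) ((hs y).trans (add_le_add_right c2 _))
  have hAo : IsOpen (U k \ (closedBall 0 y \ ball 0 x)) := (h.op k).sdiff (isClosed_closedBall.sdiff isOpen_ball)
  have hcut := ann_cut hf h.he hx0 k2 (h.op k) (h.gfr x hx k)
  have hin := ann_in hf h.he hx0 k2 (h.op k) (h.gfr y hy k)
  set A := U k \ (closedBall 0 y \ ball 0 x) with hA
  set G := U k ∩ (ball 0 y \ closedBall 0 x) with hG
  set v := wvol f (U k ∩ (closedBall 0 y \ ball 0 x)) with hv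
  have hGo : IsOpen G := (h.op k).inter (isOpen_ball.sdiff isClosed_closedBall)
  have hAv : wvol f A + v = V := by
    rw [← h.vol k, hv, hA, wvol_wd, wvol_wd, wvol_wd]
    exact measure_sdiff_add_inter _ (MeasurableSet.diff isClosed_closedBall.measurableSet isOpen_ball.measurableSet)
  have hAp : wper f A + ofReal (g0 / 2) ≤ m := by
    have h1 : wper f A + ofReal (3 / 4 * g0) ≤ m + ofReal (g0 / 4) := by
      refine (add_le_add_right e1.le _).trans (hcut.trans ((add_le_add (h.per k) herr).trans ?_))
      rw [add_assoc]
      exact add_le_add_right e3.le _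
    rw [show 3 / 4 * g0 = g0 / 2 + g0 / 4 by ring, ENNReal.ofReal_add (by linarith) (by linarith), ← add_assoc] at h1
    exact (ENNReal.add_le_add_iff_right (by finiteness)).1 h1
  have hGp : wper f G ≤ ofReal (2 * g0) := by
    refine hin.trans ((add_le_add e2.le (herr.trans (le_add_self.trans e3.le))).trans ?_)
    rw [← ENNReal.ofReal_add (by linarith) (by linarith)]
    exact ENNReal.ofReal_le_ofReal (by linarith)
  have hGV : wvol f G ≠ ⊤ := ne_top_of_le_ne_top hV ((wvol_mono inter_subset_left).trans (h.vol k).le)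
  have hvt : v ≠ ⊤ := ne_top_of_le_ne_top hV ((wvol_mono inter_subset_left).trans (h.vol k).le)
  have hvG : v ≤ wvol f G := by
    have h1 : U k ∩ (closedBall 0 y \ ball 0 x) ⊆ G ∪ (sphere 0 x ∪ sphere 0 y) := by
      rintro w ⟨w1, w2, w3⟩
      rw [mem_closedBall_zero_iff] at w2
      rw [mem_ball_zero_iff, not_lt] at w3
      rcases w2.lt_or_eq with w4 | w4
      · rcases w3.lt_or_eq with w5 | w5
        · exact Or.inl ⟨w1, by simpa using w4, by simpa using w5⟩
        · exact Or.inr (Or.inl (by simpa using w5.symm))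
      · exact Or.inr (Or.inr (by simpa using w4))
    refine (wvol_mono h1).trans ((wvol_union_le f _ _).trans ?_)
    have h2 := wvol_union_le f (sphere 0 x) (sphere 0 y)
    rw [wvol_sphere f x hx0.ne', wvol_sphere f y hy0.ne', add_zero, nonpos_iff_eq_zero] at h2
    rw [h2, add_zero]
  have hI2 := (mul_le_mul' le_rfl (pow_le_pow_left' hvG n)).trans ((hiso f hf G (ofReal (f 0)) hGo hGV
    (fun w _ => ENNReal.ofReal_le_ofReal (hf.mono 0 w (by simp)))).trans
    (pow_le_pow_left' (mul_le_mul' le_rfl hGp) (n + 1)))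
  have hI3 := ENNReal.toReal_mono (by finiteness) hI2
  simp only [ENNReal.toReal_mul, ENNReal.toReal_pow, ENNReal.toReal_ofReal (hf.pos 0).le,
    ENNReal.toReal_ofReal (show 0 ≤ 2 * g0 by linarith), ENNReal.coe_toReal] at hI3
  obtain ⟨r1, r2⟩ := hnum g0 v.toReal hg0p hg01 ENNReal.toReal_nonneg hI3
  have hva : v ≤ ofReal (a / 4) := by
    rw [← ENNReal.ofReal_toReal hvt]; exact ENNReal.ofReal_le_ofReal r1
  have hB : ofReal (a / 2) ≤ wvol f (R 1 ⁻¹' A \ A) := by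
    have h1 : R 1 ⁻¹' E \ E ⊆ (R 1 ⁻¹' A \ A) ∪ (R 1 ⁻¹' (symmDiff (U k) E ∪ (U k ∩ (closedBall 0 y \ ball 0 x))) ∪ symmDiff (U k) E) := by
      rintro w ⟨w1, w2⟩
      by_cases w3 : R 1 w ∈ A
      · by_cases w4 : w ∈ A
        · exact Or.inr (Or.inr (Or.inl ⟨w4.1, w2⟩))
        · exact Or.inl ⟨w3, w4⟩
      · refine Or.inr (Or.inl ?_)
        by_cases w5 : R 1 w ∈ U k
        · refine Or.inr ⟨w5, ?_⟩
          by_contra w6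
          exact w3 ⟨w5, w6⟩
        · exact Or.inl (Or.inr ⟨w1, w5⟩)
    have h2 := (wvol_mono (f := f) h1).trans ((wvol_union_le f _ _).trans (add_le_add_right ((wvol_union_le f _ _).trans
      (add_le_add ((wvol_iso hf _ _).le.trans ((wvol_union_le f _ _).trans (add_le_add e5 hva))) e5)) _))
    rw [← ha0, haa, ← ENNReal.ofReal_add (by linarith) (by linarith), ← ENNReal.ofReal_add (by linarith) (by linarith),
      show a / 8 + a / 4 + a / 8 = a / 2 by ring] at h2
    nth_rw 1 [show a = a / 2 + a / 2 by ring] at h2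
    rw [ENNReal.ofReal_add (by linarith) (by linarith)] at h2
    exact (ENNReal.add_le_add_iff_right (by finiteness)).1 h2
  have hfin := dbl hf hV hmt hmin hR hR0 hAo hAv hAp hB (hva.trans (ENNReal.ofReal_le_ofReal (by linarith)))
  have hfin2 := ENNReal.toReal_mono (by finiteness) hfin
  simp only [ENNReal.toReal_mul, ENNReal.toReal_ofReal (show 0 ≤ g0 / 2 by linarith),
    ENNReal.toReal_ofReal (show 0 ≤ a / 2 by linarith), ENNReal.toReal_ofNat] at hfin2
  exact r2 hfin2

theorem cnt_acc {T : Set ℝ} (h : ∀ p ∈ T, (∀ d < p, ∃ q ∈ Ioo d p, q ∈ T) → (∀ d > p, ∃ q ∈ Ioo p d, q ∈ T) → False) :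
    T.Countable := by
  refine ((countable_setOfPred_isolated_right_within (s := T)).union (countable_setOfPred_isolated_left_within (s := T))).mono ?_
  intro p hp
  by_contra hcon
  rw [mem_union, not_or] at hcon
  have h1 : (𝓝[T ∩ Ioi p] p).NeBot := neBot_iff.2 fun h0 => hcon.1 ⟨hp, h0⟩
  have h2 : (𝓝[T ∩ Iio p] p).NeBot := neBot_iff.2 fun h0 => hcon.2 ⟨hp, h0⟩
  refine h p hp (fun d hd => ?_) fun d hd => ?_
  · obtain ⟨q, ⟨q1, q2⟩, q3⟩ := h2.nonempty_of_mem (inter_mem self_mem_nhdsWithin (mem_nhdsWithin_of_mem_nhds (Ioi_mem_nhds hd)))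
    exact ⟨q, ⟨q3, q2⟩, q1⟩
  · obtain ⟨q, ⟨q1, q2⟩, q3⟩ := h1.nonempty_of_mem (inter_mem self_mem_nhdsWithin (mem_nhdsWithin_of_mem_nhds (Iio_mem_nhds hd)))
    exact ⟨q, ⟨q2, q3⟩, q1⟩

theorem Prf.axis (hn : 1 ≤ n) (hf : GoodF f) (h : Pf) (hmt : m ≠ ⊤)
    (hV0 : 0 < V) (hV : V ≠ ⊤) (hmin : ∀ A : Set (EE n), IsOpen A → wvol f A = V → m ≤ wper f A) :
    Hm (Sb E \ OA e) = 0 := by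
  have hT0 : {p : ℝ | 0 < p ∧ ContinuousAt N p ∧ p • e ∈ Sb E}.Countable := cnt_acc fun p hp hl hr =>
    h.no0 hn hf hmt hV hmin hp.1 hp.2.1 hp.2.2 (fun d hd => (hl d hd).imp fun q hq => ⟨hq.1, hq.2.2⟩)
      fun d hd => (hr d hd).imp fun q hq => ⟨hq.1, hq.2.2⟩
  have hT1 : {p : ℝ | 0 < p ∧ ContinuousAt N p ∧ -(p • e) ∈ Sb E}.Countable := cnt_acc fun p hp hl hr => by
    obtain ⟨p1, q1, q2⟩ := hl 0 hp.1
    obtain ⟨p2, q3, q4⟩ := hr (p + 1) (by linarith)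
    exact h.nopi hn hf hmt hV0 hV hmin q1.1 q1.2 q3.1 q2.2.1 q4.2.1 q2.2.2 hp.2.2 q4.2.2
  have hD := h.mono.countable_not_continuousAt
  have hc : (Sb E \ OA e).Countable := by
    refine ((countable_singleton 0).union (((hT0.union hD).image fun p : ℝ => p • e).union
      ((hT1.union hD).image fun p : ℝ => -(p • e)))).mono ?_
    rintro w ⟨w1, w2⟩
    rcases eq_or_ne w 0 with w0 | w0
    · exact Or.inl w0
    have hw0 := norm_pos_iff.2 w0
    have w3 : ‖w‖ ≤ |inner ℝ w e| := not_lt.1 w2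
    have w4 : |inner ℝ w e| ≤ ‖w‖ := by simpa [h.he] using abs_real_inner_le_norm w e
    have w5 := le_antisymm w4 w3
    refine Or.inr ?_
    rcases abs_choice (inner ℝ w e) with w6 | w6
    · have w7 : w = ‖w‖ • e := by
        have := (inner_eq_norm_mul_iff_real (x := w) (y := e)).1 (by rw [h.he, mul_one, ← w5, w6])
        rwa [h.he, one_smul] at this
      refine Or.inl ⟨‖w‖, ?_, w7.symm⟩
      by_cases hcn : ContinuousAt N ‖w‖
      · exact Or.inl ⟨hw0, hcn, w7 ▸ w1⟩
      · exact Or.inr hcn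
    · have w7 : w = -(‖w‖ • e) := by
        have := (inner_eq_norm_mul_iff_real (x := w) (y := -e)).1 (by rw [norm_neg, h.he, mul_one, ← w5, w6, inner_neg_right])
        rwa [norm_neg, h.he, one_smul, smul_neg] at this
      refine Or.inr ⟨‖w‖, ?_, w7.symm⟩
      by_cases hcn : ContinuousAt N ‖w‖
      · exact Or.inl ⟨hw0, hcn, w7 ▸ w1⟩
      · exact Or.inr hcn
  have := Measure.nullSingletonClass_hausdorff (EE n) (d := (n : ℝ)) (by exact_mod_cast hn)
  exact hc.measure_zero _

theorem Prf.fin (hn : 1 ≤ n) (hf : GoodF f) (h : Pf) (hmt : m ≠ ⊤)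
    (hV0 : 0 < V) (hV : V ≠ ⊤) (hmin : ∀ A : Set (EE n), IsOpen A → wvol f A = V → m ≤ wper f A) :
    ∃ Ω, IsIsopRegion f Ω V := by
  have hS : ∫⁻ w in Sb E, ofReal (f w) ∂Hm ≤ m := by
    have h1 : Sb E = (Sb E ∩ OA e) ∪ (Sb E \ OA e) := (inter_union_sdiff _ _).symm
    rw [h1]
    refine (lintegral_union_le _ _ _).trans ?_
    rw [setLIntegral_measure_zero _ _ (h.axis hn hf hmt hV0 hV hmin), add_zero]
    exact h.main hn hf hmt
  have hSv : volume (Sb E) = 0 := by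
    refine vol_null_of_haus n _ fun htop => ?_
    have h1 : ofReal (f 0) * Hm (Sb E) ≤ m := by
      refine le_trans ?_ hS
      rw [← setLIntegral_const]
      exact setLIntegral_mono hf.meas fun x _ => ENNReal.ofReal_le_ofReal (hf.mono _ _ (by simp))
    rw [htop, ENNReal.mul_top (by simpa using hf.pos 0)] at h1
    exact hmt (top_le_iff.1 h1)
  have hE : wvol f E = V := by
    have L3 : Tendsto (fun k : ℕ => (2 : EN) * 2⁻¹ ^ k) atTop (𝓝 (2 * 0)) :=
      ENNReal.Tendsto.const_mul (ENNReal.tendsto_pow_atTop_nhds_zero_of_lt_one (by simp)) (Or.inr (by simp))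
    rw [mul_zero] at L3
    have hs : ∀ A B : Set (EE n), wvol f A ≤ wvol f B + wvol f (symmDiff A B) := fun A B => by
      refine (wvol_mono fun w hw => ?_).trans (wvol_union_le f _ _)
      by_cases h2 : w ∈ B
      · exact Or.inl h2
      · exact Or.inr (Or.inl ⟨hw, h2⟩)
    refine le_antisymm (ge_of_tendsto' (by simpa using (tendsto_const_nhds (x := V)).add L3) fun k => ?_)
      (ge_of_tendsto' (by simpa using (tendsto_const_nhds (x := wvol f E)).add L3) fun k => ?_)
    · refine (hs E (U k)).trans ?_
      rw [h.vol k, symmDiff_comm]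
      exact add_le_add_right (h.dif k) _
    · rw [← h.vol k]
      exact (hs (U k) E).trans (add_le_add_right (h.dif k) _)
  set Ω : Set (EE n) := {x | ∃ r > 0, volume (ball x r \ E) = 0} with hΩ
  have hop : IsOpen Ω := by
    rw [Metric.isOpen_iff]
    rintro x ⟨r, hr, hx⟩
    refine ⟨r, hr, fun y hy => ⟨r - dist y x, sub_pos.2 hy, measure_mono_null (sdiff_subset_sdiff_left ?_) hx⟩⟩
    exact ball_subset_ball' (by linarith)
  have hΩE : Ω ⊆ E := by
    rintro x ⟨r, hr, hx⟩
    rw [← h.dp]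
    intro ε hε
    filter_upwards [Ioo_mem_nhdsGT hr] with s hs
    rw [measure_mono_null (sdiff_subset_sdiff_left (closedBall_subset_ball hs.2)) hx]
    exact zero_le
  have hEΩ : E ⊆ Ω ∪ Sb E := by
    intro x hx
    by_contra hcon
    rw [mem_union, not_or] at hcon
    obtain ⟨c1, c2⟩ := hcon
    simp only [Sb, mem_ofPred_eq, not_forall, not_and_or, pos_iff_ne_zero, not_not] at c2
    obtain ⟨r, hr, c2⟩ := c2
    have c3 := c2.resolve_right fun c3 => c1 ⟨r, hr, c3⟩
    rw [← h.dp] at hx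
    obtain ⟨s, s1, s2⟩ := ((hx 2⁻¹ (by simp)).and (Ioo_mem_nhdsGT hr)).exists
    have c4 : volume (closedBall x s) ≤ 2⁻¹ * volume (closedBall x s) := by
      refine ((measure_le_inter_add_sdiff volume _ E).trans ?_).trans s1
      rw [measure_mono_null (inter_subset_inter_left E (closedBall_subset_ball s2.2)) c3, zero_add]
    have c5 : volume (closedBall x s) ≠ ⊤ := measure_closedBall_lt_top.ne
    refine (ENNReal.half_lt_self (cb_pos x s2.1) c5).not_ge ?_
    rw [div_eq_mul_inv, mul_comm]; exact c4
  have hfr : frontier Ω ⊆ Sb E := by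
    intro x hx r hr
    rw [fr_open hop] at hx
    refine ⟨?_, pos_iff_ne_zero.2 fun h0 => hx.2 ⟨r, hr, h0⟩⟩
    obtain ⟨y, ⟨s, hs, hy⟩, hyx⟩ := Metric.mem_closure_iff.1 hx.1 r hr
    have ht : 0 < min s (r - dist y x) := lt_min hs (by rw [dist_comm]; linarith)
    have h1 := (measure_ball_pos volume y ht).trans_le (measure_le_inter_add_sdiff volume _ E)
    rw [measure_mono_null (sdiff_subset_sdiff_left (ball_subset_ball (min_le_left _ _))) hy, add_zero] at h1
    exact h1.trans_le (measure_mono (inter_subset_inter_left E (ball_subset_ball' (by linarith [min_le_right s (r - dist y x)]))))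
  refine ⟨Ω, hop, le_antisymm ((wvol_mono hΩE).trans hE.le) ?_, fun A hA hA1 => ?_⟩
  · rw [← hE]
    refine (wvol_mono hEΩ).trans ((wvol_union_le f _ _).trans ?_)
    rw [show wvol f (Sb E) = 0 from setLIntegral_measure_zero _ _ hSv, add_zero]
  · exact ((lintegral_mono_set hfr).trans hS).trans (hmin A hA hA1)

theorem final_thm (hn : 1 ≤ n) (hf : GoodF f) {V : EN} (hV0 : 0 < V) (hV : V ≠ ⊤) :
    ∃ Ω, IsIsopRegion f Ω V := by
  set m := sInf {p | ∃ W : Set (EE n), IsOpen W ∧ wvol f W = V ∧ wper f W = p} with hm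
  have hmin : ∀ A : Set (EE n), IsOpen A → wvol f A = V → m ≤ wper f A := fun A hA hA1 => sInf_le ⟨A, hA, hA1, rfl⟩
  obtain ⟨A, a1, a2, a3⟩ := exists_finite_comp hf hV0 hV
  have hmt : m ≠ ⊤ := ne_top_of_le_ne_top a3 (hmin A a1 a2)
  obtain ⟨e, U, E, α, N, Gd, h⟩ := exists_prf hn hf hV hm hmt
  exact h.fin hn hf hmt hV0 hV hmin
end

/-- Existence and boundedness of isoperimetric regions in `ℝ^{n+1}`
for a continuous, radial, nondecreasing density `f = e^ψ` tending to `+∞` at infinity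
and satisfying `ψ(x) ≤ C ((n+1)/n − ε)^{|x|/2}`. -/
theorem exists_bounded_isoperimetric_region_of_radial_log_bound
    (n : ℕ) (hn : 1 ≤ n) (f : EuclideanSpace ℝ (Fin (n + 1)) → ℝ)
    (hcont : Continuous f) (hpos : ∀ x, 0 < f x)
    (hrad : ∀ x y : EuclideanSpace ℝ (Fin (n + 1)), ‖x‖ = ‖y‖ → f x = f y)
    (hmono : ∀ x y : EuclideanSpace ℝ (Fin (n + 1)), ‖x‖ ≤ ‖y‖ → f x ≤ f y)
    (hinf : Tendsto f (Bornology.cobounded (EuclideanSpace ℝ (Fin (n + 1)))) atTop)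
    (C : ℝ) (hC : 0 < C) (ε : ℝ) (hε : ε ∈ Set.Ioo (0 : ℝ) 1)
    (hψ : ∀ x : EuclideanSpace ℝ (Fin (n + 1)),
      Real.log (f x) ≤ C * ((((n : ℝ) + 1) / n) - ε) ^ (‖x‖ / 2))
    (V : ℝ) (hV : 0 < V) :
    (∃ Ω : Set (EuclideanSpace ℝ (Fin (n + 1))),
        Bornology.IsBounded Ω ∧ IsIsopRegion f Ω (ENNReal.ofReal V)) ∧
    ∀ Ω : Set (EuclideanSpace ℝ (Fin (n + 1))),
        IsIsopRegion f Ω (ENNReal.ofReal V) → Bornology.IsBounded Ω := by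
  have hf : GoodF f := ⟨hcont, hpos, hmono, hinf⟩
  have hV0 : 0 < ENNReal.ofReal V := ENNReal.ofReal_pos.2 hV
  refine ⟨?_, fun Ω hΩ => part2 hn hf hV0 ENNReal.ofReal_ne_top hΩ⟩
  obtain ⟨Ω, hΩ⟩ := final_thm hn hf hV0 ENNReal.ofReal_ne_top
  exact ⟨Ω, part2 hn hf hV0 ENNReal.ofReal_ne_top hΩ, hΩ⟩
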